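/- For every constant C ∈ ℕ there exists c > 0 such that the following holds. Let m ≥ 1, let S₀,…,S_m be disjoint subsets of ℤ² with #S_j ≤ 2^j for each j, let λ₀,…,λ_m ≥ 0, and let f = Σ_{j=0}^m λ_j 2^{−j/2} χ_{S_j}. Assume that for each j = 0,…,m and each ξ ∈ S_j there exists at most one line ℓ ⊂ ℝ² through ξ with #(ℓ ∩ S_j) ≥ 2^{j/2+C}. Then for every M ∈ 2^ℕ, (1/M) Σ_{τ ∈ ℕ, M ≤ τ < 2M} Σ_{Q ∈ 𝒬^τ} f(Q) ≤ c (Σ_{j=0}^m λ_j²)². -/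

import Mathlib

open scoped BigOperators

noncomputable section

/-- Points of the integer lattice `ℤ²`. -/
abbrev Pt := ℤ × ℤ

/-- A quadruple of lattice points, viewed as a function on `Fin 4`
(indices taken cyclically). -/
abbrev Quad := Fin 4 → Pt

/-- The embedding `ℤ² ↪ ℝ²`. -/
def emb (ξ : Pt) : ℝ × ℝ := ((ξ.1 : ℝ), (ξ.2 : ℝ))

/-- An affine line in the plane `ℝ²`. -/
def IsLine (ℓ : Set (ℝ × ℝ)) : Prop :=
  ∃ p v : ℝ × ℝ, v ≠ 0 ∧ ℓ = {x | ∃ t : ℝ, x = p + t • v}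

/-- The line through two lattice points `p ≠ q` (a degenerate point if `p = q`). -/
def lineThrough (p q : Pt) : Set (ℝ × ℝ) :=
  {x | ∃ t : ℝ, x = emb p + t • (emb q - emb p)}

/-- The number of points of a finite set `T ⊂ ℤ²` on a set `ℓ ⊂ ℝ²`,
i.e. `#(ℓ ∩ T)`. -/
def lineCount (ℓ : Set (ℝ × ℝ)) (T : Finset Pt) : ℕ :=
  (ℓ ∩ (emb '' (T : Set Pt))).ncard

/-- `Q = (ξ₁,ξ₂,ξ₃,ξ₄)` is a parallelogram: `ξ₁ + ξ₃ = ξ₂ + ξ₄`. -/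
def IsPara (Q : Quad) : Prop := Q 0 + Q 2 = Q 1 + Q 3

/-- The dot product `(ξ₁ − ξ₂)·(ξ₁ − ξ₄)`. -/
def dotQ (Q : Quad) : ℤ :=
  ((Q 0).1 - (Q 1).1) * ((Q 0).1 - (Q 3).1) + ((Q 0).2 - (Q 1).2) * ((Q 0).2 - (Q 3).2)

/-- `τ_Q = ||ξ₁|² − |ξ₂|² + |ξ₃|² − |ξ₄|²| = 2|(ξ₁−ξ₂)·(ξ₁−ξ₄)|`. -/
def tauQ (Q : Quad) : ℤ := 2 * |dotQ Q|

/-- `Q` is a rectangle: a parallelogram with `τ_Q = 0`. Membership in `𝒬⁰`. -/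
def IsRect (Q : Quad) : Prop := IsPara Q ∧ dotQ Q = 0

/-- `f(Q) = f(ξ₁)f(ξ₂)f(ξ₃)f(ξ₄)`. -/
def fQ (f : Pt → ℝ) (Q : Quad) : ℝ := ∏ k : Fin 4, f (Q k)

/-- The weight `f = ∑_{j=0}^m λ_j 2^{−j/2} χ_{S_j}`. -/
def fWt (S : ℕ → Finset Pt) (lam : ℕ → ℝ) (m : ℕ) (ξ : Pt) : ℝ :=
  ∑ j ∈ Finset.range (m + 1), if ξ ∈ S j then lam j * (2 : ℝ) ^ (-(j : ℝ) / 2) else 0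

/-- `gcd((a,b)) = gcd(|a|,|b|)` for `(a,b) ∈ ℤ²`. -/
def gcdP (ξ : Pt) : ℕ := Int.gcd ξ.1 ξ.2

/-- `max{#(ℓ(ξ,η₁) ∩ S_j), #(ℓ(ξ,η₂) ∩ S_j)}`, where `η₁, η₂` are the two
neighboring vertices of `ξ` in a rectangle. -/
def crossMax (S : ℕ → Finset Pt) (j : ℕ) (ξ η₁ η₂ : Pt) : ℕ :=
  max (lineCount (lineThrough ξ η₁) (S j)) (lineCount (lineThrough ξ η₂) (S j))

/-- `ξ` lies in some `S_j`, `j ≤ m`, and is a vertex of type `α ∈ {1,2,3}`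
relative to its neighbors `η₁, η₂`: with `a := log₂ crossMax`, type 1 means
`a ≥ j/2 + C` (i.e. `crossMax ≥ 2^{j/2+C}`), type 2 means `1 ≤ a < j/2 + C`
(i.e. `2 ≤ crossMax < 2^{j/2+C}`), and type 3 means `a = 0` (`crossMax = 1`). -/
def VertexType (S : ℕ → Finset Pt) (C m : ℕ) (α : ℕ) (ξ η₁ η₂ : Pt) : Prop :=
  ∃ j ≤ m, ξ ∈ S j ∧
    ((α = 1 ∧ (2 : ℝ) ^ ((j : ℝ) / 2 + (C : ℝ)) ≤ (crossMax S j ξ η₁ η₂ : ℝ)) ∨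
     (α = 2 ∧ 2 ≤ crossMax S j ξ η₁ η₂ ∧
        (crossMax S j ξ η₁ η₂ : ℝ) < (2 : ℝ) ^ ((j : ℝ) / 2 + (C : ℝ))) ∨
     (α = 3 ∧ crossMax S j ξ η₁ η₂ = 1))

/-- The set `𝒬⁰_{α,β}`: rectangles with four distinct vertices, all in
`∪_{j=0}^m S_j`, with `ξ₁, ξ₂` of type `α` and `ξ₃, ξ₄` of type `β`. -/
def QZeroAB (S : ℕ → Finset Pt) (C m : ℕ) (α β : ℕ) : Set Quad :=
  {Q | IsRect Q ∧ Function.Injective Q ∧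
    VertexType S C m α (Q 0) (Q 1) (Q 3) ∧
    VertexType S C m α (Q 1) (Q 2) (Q 0) ∧
    VertexType S C m β (Q 2) (Q 3) (Q 1) ∧
    VertexType S C m β (Q 3) (Q 0) (Q 2)}

/-- The set `𝒬⁰(j⃗, a⃗)`: rectangles with distinct vertices `ξ_k ∈ S_{j_k}` such
that for each `k` (cyclically), `2^{a_k} ≤ max{#(ℓ(ξ_k,ξ_{k+1}) ∩ S_{j_k}),
#(ℓ(ξ_k,ξ_{k−1}) ∩ S_{j_k})} < 2^{a_k+1}`. -/
def QZeroJA (S : ℕ → Finset Pt) (j a : Fin 4 → ℕ) : Set Quad :=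
  {Q | IsRect Q ∧ Function.Injective Q ∧ (∀ k, Q k ∈ S (j k)) ∧
    ∀ k : Fin 4,
      2 ^ (a k) ≤ max (lineCount (lineThrough (Q k) (Q (k + 1))) (S (j k)))
          (lineCount (lineThrough (Q k) (Q (k - 1))) (S (j k))) ∧
        max (lineCount (lineThrough (Q k) (Q (k + 1))) (S (j k)))
          (lineCount (lineThrough (Q k) (Q (k - 1))) (S (j k))) < 2 ^ (a k + 1)}

/-- Twice the signed area of the triangle `u v w`. -/
def orient (u v w : Pt) : ℤ := (v.1 - u.1) * (w.2 - u.2) - (v.2 - u.2) * (w.1 - u.1)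

/-- The segments `e` and `e'` cross at an interior point of both. -/
def SegCross (e e' : Pt × Pt) : Prop :=
  orient e.1 e.2 e'.1 * orient e.1 e.2 e'.2 < 0 ∧ orient e'.1 e'.2 e.1 * orient e'.1 e'.2 e.2 < 0

theorem SegCross.symm {e e' : Pt × Pt} (h : SegCross e e') : SegCross e' e := ⟨h.2, h.1⟩

theorem segCross_of_between {u q u' p' w : Pt} (hu : u.1 < u'.1) (hu' : u'.1 < w.1)
    (hwq : w.1 ≤ q.1) (hwp : w.1 ≤ p'.1) (h1 : 0 < orient u q u') (h2 : orient u q w ≤ 0)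
    (h3 : 0 ≤ orient u' p' w) (h4 : orient u q w < 0 ∨ 0 < orient u' p' w) :
    SegCross (u, q) (u', p') := by
  have hq : 0 < q.1 - u.1 := by linarith
  have hp : 0 < p'.1 - u'.1 := by linarith
  have hw : 0 < w.1 - u'.1 := by linarith
  -- `D z` is a positive multiple of the height of the line `u q` over the line `u' p'` at `z`
  obtain ⟨D, hD⟩ : ∃ D : ℤ → ℤ, ∀ z, D z =
      (u.2 * (q.1 - u.1) + (q.2 - u.2) * (z - u.1)) * (p'.1 - u'.1) -
        (u'.2 * (p'.1 - u'.1) + (p'.2 - u'.2) * (z - u'.1)) * (q.1 - u.1) := ⟨_, fun _ => rfl⟩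
  have e1 : D u'.1 = -(p'.1 - u'.1) * orient u q u' := by rw [hD]; unfold orient; ring
  have e2 : D w.1 = -(p'.1 - u'.1) * orient u q w + (q.1 - u.1) * orient u' p' w := by
    rw [hD]; unfold orient; ring
  have e3 : D u.1 = (q.1 - u.1) * orient u' p' u := by rw [hD]; unfold orient; ring
  have e4 : D q.1 = (q.1 - u.1) * orient u' p' q := by rw [hD]; unfold orient; ring
  have e5 : D p'.1 = -(p'.1 - u'.1) * orient u q p' := by rw [hD]; unfold orient; ring
  have d1 : D u'.1 < 0 := by rw [e1]; nlinarith
  have d2 : 0 < D w.1 := by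
    rw [e2]
    rcases h4 with h4 | h4 <;> nlinarith [mul_nonneg hq.le h3, mul_nonneg hp.le (neg_nonneg.2 h2)]
  have key : ∀ z, D z * (w.1 - u'.1) = D w.1 * (z - u'.1) + D u'.1 * (w.1 - z) := by
    intro z; simp only [hD]; ring
  have d3 : D u.1 < 0 := by
    have := key u.1
    by_contra hcon
    push Not at hcon
    nlinarith [mul_nonneg hcon hw.le]
  have pos : ∀ z, w.1 ≤ z → 0 < D z := by
    intro z hz
    have := key z
    by_contra hcon
    push Not at hcon
    nlinarith [mul_nonneg (neg_nonneg.2 hcon) hw.le]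
  have d4 := pos _ hwq
  have d5 := pos _ hwp
  rw [e3] at d3
  rw [e4] at d4
  rw [e5] at d5
  have s3 : orient u' p' u < 0 := by
    by_contra hcon; push Not at hcon; nlinarith [mul_nonneg hq.le hcon]
  have s4 : 0 < orient u' p' q := pos_of_mul_pos_right d4 hq.le
  have s5 : orient u q p' < 0 := by
    by_contra hcon; push Not at hcon; nlinarith [mul_nonneg hp.le hcon]
  exact ⟨mul_neg_of_pos_of_neg h1 s5, mul_neg_of_neg_of_pos s3 s4⟩

theorem orient_reflect (u v w : Pt) :
    orient (u.1, -u.2) (v.1, -v.2) (w.1, -w.2) = -orient u v w := by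
  simp only [orient]; ring

theorem segCross_of_between' {u q u' p' w : Pt} (hu : u.1 < u'.1) (hu' : u'.1 < w.1)
    (hwq : w.1 ≤ q.1) (hwp : w.1 ≤ p'.1) (h1 : orient u q u' < 0) (h2 : 0 ≤ orient u q w)
    (h3 : orient u' p' w ≤ 0) (h4 : 0 < orient u q w ∨ orient u' p' w < 0) :
    SegCross (u, q) (u', p') := by
  have := segCross_of_between (u := (u.1, -u.2)) (q := (q.1, -q.2)) (u' := (u'.1, -u'.2))
    (p' := (p'.1, -p'.2)) (w := (w.1, -w.2)) hu hu' hwq hwp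
  simp only [orient_reflect, SegCross, neg_mul_neg] at this
  exact this (by linarith) (by linarith) (by linarith) (by
    rcases h4 with h | h
    · left; linarith
    · right; linarith)

/-- A straight-line drawing: every edge points to the right and has no vertex in its interior. -/
structure IsDrawing (P : Finset Pt) (E : Finset (Pt × Pt)) : Prop where
  inj : Set.InjOn Prod.fst (P : Set Pt)
  left_mem : ∀ e ∈ E, e.1 ∈ P
  right_mem : ∀ e ∈ E, e.2 ∈ P
  lt : ∀ e ∈ E, e.1.1 < e.2.1
  not_between : ∀ e ∈ E, ∀ w ∈ P, orient e.1 e.2 w = 0 → w.1 ≤ e.1.1 ∨ e.2.1 ≤ w.1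

/-- The edges `u p` and `u q` are consecutive around `u`, and `w` is the first vertex
in the cone they span. -/
structure IsCone (P : Finset Pt) (E : Finset (Pt × Pt)) (u p q w : Pt) : Prop where
  lower : (u, p) ∈ E
  upper : (u, q) ∈ E
  pos : 0 < orient u p q
  next : ∀ r, (u, r) ∈ E → 0 < orient u p r → 0 ≤ orient u q r
  mem : w ∈ P
  lt : u.1 < w.1
  above : 0 ≤ orient u p w
  below : orient u q w ≤ 0
  first : ∀ z ∈ P, u.1 < z.1 → 0 ≤ orient u p z → orient u q z ≤ 0 → w.1 ≤ z.1

theorem orient_swap (u v w : Pt) : orient u w v = -orient u v w := by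
  simp only [orient]; ring

theorem orient_self (u v : Pt) : orient u v v = 0 := by
  simp only [orient]; ring

theorem orient_trans {u a b c : Pt} (ha : u.1 < a.1) (hb : u.1 < b.1) (hc : u.1 < c.1)
    (h1 : 0 ≤ orient u a b) (h2 : 0 ≤ orient u b c) : 0 ≤ orient u a c := by
  have : (b.1 - u.1) * orient u a c = (c.1 - u.1) * orient u a b + (a.1 - u.1) * orient u b c := by
    simp only [orient]; ring
  by_contra hcon
  push Not at hcon
  nlinarith [mul_nonneg (sub_pos.2 hc).le h1, mul_nonneg (sub_pos.2 ha).le h2]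

namespace IsCone
variable {P : Finset Pt} {E : Finset (Pt × Pt)} {u p q w u' p' q' : Pt}

theorem le_lower (hE : IsDrawing P E) (h : IsCone P E u p q w) : w.1 ≤ p.1 :=
  h.first p (hE.right_mem _ h.lower) (hE.lt _ h.lower) (orient_self _ _).ge
    (by rw [orient_swap]; linarith [h.pos])

theorem le_upper (hE : IsDrawing P E) (h : IsCone P E u p q w) : w.1 ≤ q.1 :=
  h.first q (hE.right_mem _ h.upper) (hE.lt _ h.upper) h.pos.le (orient_self _ _).le

theorem eq_lower (hE : IsDrawing P E) (h : IsCone P E u p q w) (h0 : orient u p w = 0) :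
    w = p := by
  rcases hE.not_between _ h.lower _ h.mem h0 with h1 | h1
  · exact absurd h.lt (not_lt.2 h1)
  · exact hE.inj h.mem (hE.right_mem _ h.lower) (le_antisymm (h.le_lower hE) h1)

theorem eq_upper (hE : IsDrawing P E) (h : IsCone P E u p q w) (h0 : orient u q w = 0) :
    w = q := by
  rcases hE.not_between _ h.upper _ h.mem h0 with h1 | h1
  · exact absurd h.lt (not_lt.2 h1)
  · exact hE.inj h.mem (hE.right_mem _ h.upper) (le_antisymm (h.le_upper hE) h1)

theorem lower_ne_upper (h : IsCone P E u p q w) : p ≠ q := by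
  rintro rfl
  have := h.pos
  rw [orient_self] at this
  exact lt_irrefl _ this

theorem not_lt_apex (hE : IsDrawing P E) (hc : ∀ e ∈ E, ∀ e' ∈ E, ¬SegCross e e')
    (h : IsCone P E u p q w) (h' : IsCone P E u' p' q' w) (hw : w = p ↔ w = p') :
    ¬u.1 < u'.1 := by
  intro hu
  have hmem := hE.left_mem _ h'.lower
  by_cases h1 : 0 < orient u q u'
  · by_cases h4 : orient u q w < 0 ∨ 0 < orient u' p' w
    · exact hc _ h.upper _ h'.lower (segCross_of_between hu h'.lt (h.le_upper hE)
        (h'.le_lower hE) h1 h.below h'.above h4)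
    · push Not at h4
      have e1 := h.eq_upper hE (le_antisymm h.below h4.1)
      have e2 := hw.2 (h'.eq_lower hE (le_antisymm h4.2 h'.above))
      exact h.lower_ne_upper (e2.symm.trans e1)
  · by_cases h2 : orient u p u' < 0
    · by_cases h4 : 0 < orient u p w ∨ orient u' q' w < 0
      · exact hc _ h.lower _ h'.upper (segCross_of_between' hu h'.lt (h.le_lower hE)
          (h'.le_upper hE) h2 h.above h'.below h4)
      · push Not at h4
        have e1 := hw.1 (h.eq_lower hE (le_antisymm h4.1 h.above))
        have e2 := h'.eq_upper hE (le_antisymm h'.below h4.2)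
        exact h'.lower_ne_upper (e1.symm.trans e2)
    · push Not at h1 h2
      exact absurd (h.first u' hmem hu h2 h1) (not_le.2 h'.lt)

theorem not_pos_orient (hE : IsDrawing P E)
    (h : IsCone P E u p q w) (h' : IsCone P E u p' q' w) (hw : w = p ↔ w = p') :
    ¬0 < orient u p p' := by
  intro hp
  have h1 := h.next p' h'.lower hp
  have h2 : 0 ≤ orient u q w :=
    orient_trans (hE.lt _ h.upper) (hE.lt _ h'.lower) h.lt h1 h'.above
  have e1 := h.eq_upper hE (le_antisymm h.below h2)
  have h3 : 0 ≤ orient u w p' := e1 ▸ h1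
  rw [orient_swap] at h3
  have e2 := h'.eq_lower hE (le_antisymm (by linarith) h'.above)
  exact h.lower_ne_upper ((hw.2 e2).symm.trans e1)

theorem unique (hE : IsDrawing P E) (hc : ∀ e ∈ E, ∀ e' ∈ E, ¬SegCross e e')
    (h : IsCone P E u p q w) (h' : IsCone P E u' p' q' w) (hw : w = p ↔ w = p') :
    (u, p) = (u', p') := by
  have hu : u = u' := hE.inj (hE.left_mem _ h.lower) (hE.left_mem _ h'.lower)
    (le_antisymm (not_lt.1 (h'.not_lt_apex hE hc h hw.symm)) (not_lt.1 (h.not_lt_apex hE hc h' hw)))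
  subst hu
  have h1 := h.not_pos_orient hE h' hw
  have h2 := h'.not_pos_orient hE h hw.symm
  rw [orient_swap] at h2
  have h0 : orient u p p' = 0 := by omega
  rcases hE.not_between _ h.lower _ (hE.right_mem _ h'.lower) h0 with h3 | h3
  · exact absurd (hE.lt _ h'.lower) (not_lt.2 h3)
  · have h0' : orient u p' p = 0 := by rw [orient_swap, h0, neg_zero]
    rcases hE.not_between _ h'.lower _ (hE.right_mem _ h.lower) h0' with h4 | h4
    · exact absurd (hE.lt _ h.lower) (not_lt.2 h4)
    · exact Prod.ext rfl
        (hE.inj (hE.right_mem _ h.lower) (hE.right_mem _ h'.lower) (le_antisymm h3 h4))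

end IsCone

theorem IsDrawing.exists_cone {P : Finset Pt} {E : Finset (Pt × Pt)} (hE : IsDrawing P E)
    {u p r : Pt} (hp : (u, p) ∈ E) (hr : (u, r) ∈ E) (hpr : 0 < orient u p r) :
    ∃ q w, IsCone P E u p q w := by
  classical
  obtain ⟨q, hq, hmin⟩ := Finset.exists_min_image
    (P.filter fun q => (u, q) ∈ E ∧ 0 < orient u p q)
    (fun q => ((q.2 - u.2 : ℤ) : ℚ) / ((q.1 - u.1 : ℤ) : ℚ))
    ⟨r, Finset.mem_filter.2 ⟨hE.right_mem _ hr, hr, hpr⟩⟩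
  obtain ⟨hqP, hqE, hqpos⟩ := Finset.mem_filter.1 hq
  obtain ⟨w, hw, hwmin⟩ := Finset.exists_min_image
    (P.filter fun z => u.1 < z.1 ∧ 0 ≤ orient u p z ∧ orient u q z ≤ 0) Prod.fst
    ⟨q, Finset.mem_filter.2 ⟨hqP, hE.lt _ hqE, hqpos.le, (orient_self _ _).le⟩⟩
  obtain ⟨hwP, h1, h2, h3⟩ := Finset.mem_filter.1 hw
  refine ⟨q, w, hp, hqE, hqpos, fun s hs hps => ?_, hwP, h1, h2, h3, fun z hz a b c =>
    hwmin z (Finset.mem_filter.2 ⟨hz, a, b, c⟩)⟩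
  have := hmin s (Finset.mem_filter.2 ⟨hE.right_mem _ hs, hs, hps⟩)
  have a1 : (0 : ℚ) < ((q.1 - u.1 : ℤ) : ℚ) := by exact_mod_cast sub_pos.2 (hE.lt _ hqE)
  have a2 : (0 : ℚ) < ((s.1 - u.1 : ℤ) : ℚ) := by exact_mod_cast sub_pos.2 (hE.lt _ hs)
  rw [div_le_div_iff₀ a1 a2] at this
  have h : (q.2 - u.2) * (s.1 - u.1) ≤ (s.2 - u.2) * (q.1 - u.1) := by exact_mod_cast this
  simp only [orient]
  linarith

/-- A straight-line drawing without crossings has at most `3 n` edges. -/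
theorem IsDrawing.card_le_of_noncrossing {P : Finset Pt} {E : Finset (Pt × Pt)}
    (hE : IsDrawing P E) (hc : ∀ e ∈ E, ∀ e' ∈ E, ¬SegCross e e') : E.card ≤ 3 * P.card := by
  classical
  have h1 : (E.filter fun e => ¬∃ r, (e.1, r) ∈ E ∧ 0 < orient e.1 e.2 r).card ≤ P.card := by
    refine Finset.card_le_card_of_injOn Prod.fst
      (fun e he => hE.left_mem e (Finset.mem_filter.1 he).1) ?_
    rintro ⟨u, p⟩ he ⟨u', p'⟩ he' (rfl : u = u')
    obtain ⟨m, t⟩ := Finset.mem_filter.1 he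
    obtain ⟨m', t'⟩ := Finset.mem_filter.1 he'
    push Not at t t'
    have a := t p' m'
    have b := t' p m
    simp only at a b
    rw [orient_swap] at b
    have h0 : orient u p p' = 0 := by omega
    have h0' : orient u p' p = 0 := by rw [orient_swap, h0, neg_zero]
    have l := hE.lt _ m
    have l' := hE.lt _ m'
    have c := hE.not_between _ m _ (hE.right_mem _ m') h0
    have c' := hE.not_between _ m' _ (hE.right_mem _ m) h0'
    simp only at l l' c c'
    exact Prod.ext rfl (hE.inj (hE.right_mem _ m) (hE.right_mem _ m') (by simp only; omega))
  have h2 : (E.filter fun e => ∃ r, (e.1, r) ∈ E ∧ 0 < orient e.1 e.2 r).card ≤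
      (P ×ˢ (Finset.univ : Finset Bool)).card := by
    have ex : ∀ e : Pt × Pt, ∃ w, e ∈ (E.filter fun e => ∃ r, (e.1, r) ∈ E ∧
        0 < orient e.1 e.2 r) → ∃ q, IsCone P E e.1 e.2 q w := by
      intro e
      by_cases he : e ∈ E.filter fun e => ∃ r, (e.1, r) ∈ E ∧ 0 < orient e.1 e.2 r
      · obtain ⟨m, r, hr, hp⟩ := Finset.mem_filter.1 he
        obtain ⟨q, w, h⟩ := hE.exists_cone m hr hp
        exact ⟨w, fun _ => ⟨q, h⟩⟩
      · exact ⟨0, fun h => absurd h he⟩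
    choose w hw using ex
    refine Finset.card_le_card_of_injOn (fun e => (w e, decide (w e = e.2))) ?_ ?_
    · intro e he
      obtain ⟨q, h⟩ := hw e he
      exact Finset.mem_coe.2 (Finset.mem_product.2 ⟨h.mem, Finset.mem_univ _⟩)
    · intro e he e' he' heq
      obtain ⟨q, h⟩ := hw e he
      obtain ⟨q', h'⟩ := hw e' he'
      simp only [Prod.mk.injEq] at heq
      obtain ⟨hww, hd⟩ := heq
      rw [← hww] at h'
      refine h.unique hE hc h' ?_
      rw [decide_eq_decide, ← hww] at hd
      exact hd
  rw [Finset.card_product, Finset.card_univ, Fintype.card_bool] at h2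
  have := Finset.card_filter_add_card_filter_not (s := E)
    (fun e => ∃ r, (e.1, r) ∈ E ∧ 0 < orient e.1 e.2 r)
  omega

section CrossingLemma
open scoped Classical in
/-- The ordered pairs of crossing edges. -/
def crossings (E : Finset (Pt × Pt)) : Finset ((Pt × Pt) × (Pt × Pt)) :=
  (E ×ˢ E).filter fun x => SegCross x.1 x.2

theorem IsDrawing.mono {P P' : Finset Pt} {E E' : Finset (Pt × Pt)} (hE : IsDrawing P E)
    (hP : P' ⊆ P) (hE' : E' ⊆ E) (h1 : ∀ e ∈ E', e.1 ∈ P') (h2 : ∀ e ∈ E', e.2 ∈ P') :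
    IsDrawing P' E' :=
  ⟨hE.inj.mono (by exact_mod_cast hP), h1, h2, fun e he => hE.lt e (hE' he),
    fun e he w hw => hE.not_between e (hE' he) w (hP hw)⟩

theorem IsDrawing.card_le_add_crossings {P : Finset Pt} {E : Finset (Pt × Pt)}
    (hE : IsDrawing P E) : E.card ≤ 3 * P.card + (crossings E).card := by
  classical
  have h1 : (E.filter fun e => ¬∃ e' ∈ E, SegCross e e').card ≤ 3 * P.card := by
    refine (hE.mono (E' := E.filter fun e => ¬∃ e' ∈ E, SegCross e e') subset_rfl
      (Finset.filter_subset _ _) (fun e he => hE.left_mem e (Finset.mem_filter.1 he).1)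
      (fun e he => hE.right_mem e (Finset.mem_filter.1 he).1)).card_le_of_noncrossing ?_
    intro e he e' he' h
    exact (Finset.mem_filter.1 he).2 ⟨e', (Finset.mem_filter.1 he').1, h⟩
  have h2 : (E.filter fun e => ∃ e' ∈ E, SegCross e e').card ≤ (crossings E).card := by
    refine (Finset.card_le_card (t := (crossings E).image Prod.fst) ?_).trans
      Finset.card_image_le
    intro e he
    obtain ⟨m, e', m', h⟩ := Finset.mem_filter.1 he
    exact Finset.mem_image.2 ⟨(e, e'),
      Finset.mem_filter.2 ⟨Finset.mem_product.2 ⟨m, m'⟩, h⟩, rfl⟩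
  have := Finset.card_filter_add_card_filter_not (s := E) (fun e => ∃ e' ∈ E, SegCross e e')
  omega

open scoped Classical in
theorem card_colorings_zero_on {α : Type*} (P A : Finset α) (hA : A ⊆ P) (q : ℕ) :
    ((Finset.univ : Finset (P → Fin (q + 1))).filter fun c => ∀ x : P, x.1 ∈ A → c x = 0).card *
      (q + 1) ^ A.card = (q + 1) ^ P.card := by
  have h1 : ((Finset.univ : Finset (P → Fin (q + 1))).filter
      fun c => ∀ x : P, x.1 ∈ A → c x = 0) =
      Fintype.piFinset fun x : P => if x.1 ∈ A then {0} else Finset.univ := by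
    ext c
    simp only [Finset.mem_filter, Finset.mem_univ, true_and, Fintype.mem_piFinset]
    refine forall_congr' fun x => ?_
    split_ifs with h <;> simp [h]
  have h2 : (q + 1) ^ A.card = ∏ x : P, if x.1 ∈ A then q + 1 else 1 := by
    rw [Finset.prod_coe_sort P (fun x => if x ∈ A then q + 1 else 1), Finset.prod_ite_mem,
      Finset.inter_eq_right.2 hA, Finset.prod_const]
  rw [h1, Fintype.card_piFinset, h2, ← Finset.prod_mul_distrib]
  have : ∀ x : P, (if x.1 ∈ A then ({0} : Finset (Fin (q + 1))) else Finset.univ).card *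
      (if x.1 ∈ A then q + 1 else 1) = q + 1 := by
    intro x
    split_ifs <;> simp
  rw [Finset.prod_congr rfl fun x _ => this x]
  simp

theorem SegCross.ne {e e' : Pt × Pt} (h : SegCross e e') :
    e.1 ≠ e.2 ∧ e.1 ≠ e'.1 ∧ e.1 ≠ e'.2 ∧ e.2 ≠ e'.1 ∧ e.2 ≠ e'.2 ∧ e'.1 ≠ e'.2 := by
  obtain ⟨h1, h2⟩ := h
  refine ⟨?_, ?_, ?_, ?_, ?_, ?_⟩ <;> intro h <;> simp only [h, orient] at h1 h2 <;>
    ring_nf at h1 h2 <;>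
    simp at h1 h2

/-- The crossing lemma, in a form with an explicit sampling parameter. -/
theorem IsDrawing.card_mul_sq_le {P : Finset Pt} {E : Finset (Pt × Pt)} (hE : IsDrawing P E)
    {q : ℕ} (hq : 1 ≤ q) :
    E.card * q ^ 2 ≤ 3 * P.card * q ^ 3 + (crossings E).card := by
  classical
  obtain ⟨q, rfl⟩ : ∃ r, q = r + 1 := ⟨q - 1, by omega⟩
  let T : (P → Fin (q + 1)) → Finset Pt := fun c => P.filter fun x => ∀ h : x ∈ P, c ⟨x, h⟩ = 0
  have hT : ∀ c x, x ∈ T c ↔ x ∈ P ∧ ∀ h : x ∈ P, c ⟨x, h⟩ = 0 := fun c x => Finset.mem_filter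
  have count : ∀ A ⊆ P, ((Finset.univ : Finset (P → Fin (q + 1))).filter fun c => A ⊆ T c).card *
      (q + 1) ^ A.card = (q + 1) ^ P.card := by
    intro A hA
    rw [← card_colorings_zero_on P A hA q]
    congr 2
    ext c
    simp only [Finset.mem_filter, Finset.mem_univ, true_and]
    constructor
    · exact fun h x hx => ((hT c _).1 (h hx)).2 x.2
    · exact fun h x hx => (hT c x).2 ⟨hA hx, fun hP => h ⟨x, hP⟩ hx⟩
  let Ec : (P → Fin (q + 1)) → Finset (Pt × Pt) := fun c =>
    E.filter fun e => ({e.1, e.2} : Finset Pt) ⊆ T c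
  have hEc : ∀ c, (Ec c).card ≤ 3 * (T c).card +
      ((crossings E).filter fun x =>
        ({x.1.1, x.1.2, x.2.1, x.2.2} : Finset Pt) ⊆ T c).card := by
    intro c
    refine ((hE.mono (P' := T c) (E' := Ec c) (Finset.filter_subset _ _)
      (Finset.filter_subset _ _) ?_ ?_).card_le_add_crossings).trans ?_
    · exact fun e he => (Finset.mem_filter.1 he).2 (by simp)
    · exact fun e he => (Finset.mem_filter.1 he).2 (by simp)
    · refine Nat.add_le_add_left (Finset.card_le_card ?_) _
      intro x hx
      simp only [crossings, Finset.mem_filter, Finset.mem_product, Ec] at hx ⊢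
      refine ⟨⟨⟨hx.1.1.1, hx.1.2.1⟩, hx.2⟩, ?_⟩
      intro y hy
      simp only [Finset.mem_insert, Finset.mem_singleton] at hy
      rcases hy with rfl | rfl | rfl | rfl
      · exact hx.1.1.2 (by simp)
      · exact hx.1.1.2 (by simp)
      · exact hx.1.2.2 (by simp)
      · exact hx.1.2.2 (by simp)
  have swap : ∀ {β : Type} (X : Finset β) (A : β → Finset Pt) (k : ℕ),
      (∀ x ∈ X, A x ⊆ P ∧ (A x).card = k) →
      (∑ c : P → Fin (q + 1), (X.filter fun x => A x ⊆ T c).card) * (q + 1) ^ k =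
        X.card * (q + 1) ^ P.card := by
    intro β X A k hX
    simp only [Finset.card_filter]
    rw [Finset.sum_comm, Finset.sum_mul]
    rw [Finset.sum_congr rfl (g := fun _ => (q + 1) ^ P.card), Finset.sum_const, smul_eq_mul]
    intro x hx
    rw [← Finset.card_filter, ← (hX x hx).2, count _ (hX x hx).1]
  have s1 := swap E (fun e => {e.1, e.2}) 2 fun e he => by
    refine ⟨?_, Finset.card_pair fun h => ?_⟩
    · intro y hy
      simp only [Finset.mem_insert, Finset.mem_singleton] at hy
      rcases hy with rfl | rfl
      · exact hE.left_mem e he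
      · exact hE.right_mem e he
    · have := hE.lt e he
      rw [h] at this
      exact lt_irrefl _ this
  have s2 := swap P (fun x => {x}) 1 fun x hx => ⟨by simpa using hx, by simp⟩
  have s3 := swap (crossings E) (fun x => {x.1.1, x.1.2, x.2.1, x.2.2}) 4 fun x hx => by
    simp only [crossings, Finset.mem_filter, Finset.mem_product] at hx
    refine ⟨?_, ?_⟩
    · intro y hy
      simp only [Finset.mem_insert, Finset.mem_singleton] at hy
      rcases hy with rfl | rfl | rfl | rfl
      · exact hE.left_mem _ hx.1.1
      · exact hE.right_mem _ hx.1.1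
      · exact hE.left_mem _ hx.1.2
      · exact hE.right_mem _ hx.1.2
    · obtain ⟨a, b, c, d, e, f⟩ := hx.2.ne
      rw [Finset.card_insert_of_notMem (by simp [a, b, c]),
        Finset.card_insert_of_notMem (by simp [d, e]), Finset.card_pair f]
  have hT2 : ∀ c, (P.filter fun x => ({x} : Finset Pt) ⊆ T c) = T c := by
    intro c
    ext x
    simp only [Finset.mem_filter, Finset.singleton_subset_iff, hT]
    tauto
  simp only [hT2] at s2
  have hsum := Finset.sum_le_sum fun c (_ : c ∈ (Finset.univ : Finset (P → Fin (q + 1)))) => hEc c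
  rw [Finset.sum_add_distrib, ← Finset.mul_sum] at hsum
  have hpos : 0 < (q + 1) ^ P.card := by positivity
  refine Nat.le_of_mul_le_mul_right ?_ hpos
  set a := ∑ c : P → Fin (q + 1), (Ec c).card
  set b := ∑ c : P → Fin (q + 1), (T c).card
  set d := ∑ c : P → Fin (q + 1), ((crossings E).filter fun x =>
        ({x.1.1, x.1.2, x.2.1, x.2.2} : Finset Pt) ⊆ T c).card
  have s1' : a * (q + 1) ^ 2 = E.card * (q + 1) ^ P.card := s1
  calc E.card * (q + 1) ^ 2 * (q + 1) ^ P.card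
      = a * (q + 1) ^ 4 := by
        rw [mul_right_comm, ← s1']; ring
    _ ≤ (3 * b + d) * (q + 1) ^ 4 := Nat.mul_le_mul_right _ hsum
    _ = 3 * (b * (q + 1) ^ 1) * (q + 1) ^ 3 + d * (q + 1) ^ 4 := by ring
    _ = (3 * P.card * (q + 1) ^ 3 + (crossings E).card) * (q + 1) ^ P.card := by
        rw [s2, s3]; ring

end CrossingLemma

section LineTraces

/-- Every member of the family is the set of points of `P` on the line through any two of its
points. -/
def IsTraceFamily (P : Finset Pt) (L : Finset (Finset Pt)) : Prop :=
  ∀ T ∈ L, T ⊆ P ∧ ∀ u ∈ T, ∀ v ∈ T, u ≠ v → ∀ w ∈ P, w ∈ T ↔ orient u v w = 0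

theorem IsTraceFamily.eq {P : Finset Pt} {L : Finset (Finset Pt)} (h : IsTraceFamily P L)
    {T T' : Finset Pt} (hT : T ∈ L) (hT' : T' ∈ L) {u v : Pt} (hu : u ∈ T) (hv : v ∈ T)
    (hu' : u ∈ T') (hv' : v ∈ T') (huv : u ≠ v) : T = T' := by
  ext w
  constructor <;> intro hw
  · exact ((h T' hT').2 u hu' v hv' huv w ((h T hT).1 hw)).2
      (((h T hT).2 u hu v hv huv w ((h T hT).1 hw)).1 hw)
  · exact ((h T hT).2 u hu v hv huv w ((h T' hT').1 hw)).2
      (((h T' hT').2 u hu' v hv' huv w ((h T' hT').1 hw)).1 hw)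

open scoped Classical in
/-- The pairs of consecutive points of `T`, ordered by the first coordinate. -/
def consecutivePairs (T : Finset Pt) : Finset (Pt × Pt) :=
  (T ×ˢ T).filter fun e => e.1.1 < e.2.1 ∧ ∀ w ∈ T, w.1 ≤ e.1.1 ∨ e.2.1 ≤ w.1

theorem mem_consecutivePairs {T : Finset Pt} {e : Pt × Pt} : e ∈ consecutivePairs T ↔
    e.1 ∈ T ∧ e.2 ∈ T ∧ e.1.1 < e.2.1 ∧ ∀ w ∈ T, w.1 ≤ e.1.1 ∨ e.2.1 ≤ w.1 := by
  simp only [consecutivePairs, Finset.mem_filter, Finset.mem_product, and_assoc]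

theorem card_le_card_consecutivePairs {T : Finset Pt}
    (hT : Set.InjOn Prod.fst (T : Set Pt)) : T.card ≤ (consecutivePairs T).card + 1 := by
  classical
  rcases T.eq_empty_or_nonempty with rfl | hne
  · simp
  obtain ⟨t, ht, hmax⟩ := Finset.exists_max_image T Prod.fst hne
  rw [← Finset.card_erase_add_one ht]
  refine Nat.add_le_add_right ?_ 1
  refine (Finset.card_le_card (t := (consecutivePairs T).image Prod.fst) ?_).trans
    Finset.card_image_le
  intro u hu
  rw [Finset.mem_erase] at hu
  have hlt : u.1 < t.1 := lt_of_le_of_ne (hmax u hu.2) fun h => hu.1 (hT hu.2 ht h)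
  obtain ⟨v, hv, hmin⟩ := Finset.exists_min_image (T.filter fun v => u.1 < v.1) Prod.fst
    ⟨t, Finset.mem_filter.2 ⟨ht, hlt⟩⟩
  rw [Finset.mem_filter] at hv
  refine Finset.mem_image.2 ⟨(u, v), mem_consecutivePairs.2 ⟨hu.2, hv.1, hv.2, fun w hw => ?_⟩, rfl⟩
  rcases le_or_gt w.1 u.1 with h | h
  · exact Or.inl h
  · exact Or.inr (hmin w (Finset.mem_filter.2 ⟨hw, h⟩))

theorem orient_mul_pos {a b u v w z : Pt} (hw : orient u v w = 0) (hz : orient u v z = 0)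
    (huv : u.1 < v.1) (hwu : w.1 ≤ u.1) (hzu : z.1 ≤ u.1)
    (h : orient a b u * orient a b v < 0) : 0 < orient a b w * orient a b z := by
  have key : ∀ p : Pt, orient u v p = 0 → (v.1 - u.1) * orient a b p =
      (v.1 - p.1) * orient a b u + (p.1 - u.1) * orient a b v := by
    intro p hp
    have : (v.1 - u.1) * orient a b p - ((v.1 - p.1) * orient a b u + (p.1 - u.1) * orient a b v) =
        (b.1 - a.1) * orient u v p := by
      simp only [orient]; ring
    rw [hp] at this
    linarith
  have e1 := key w hw
  have e2 := key z hz
  have hD : 0 < v.1 - u.1 := by linarith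
  rcases mul_neg_iff.1 h with ⟨h1, h2⟩ | ⟨h1, h2⟩
  · have p1 : 0 < orient a b w := by
      refine pos_of_mul_pos_right (a := v.1 - u.1) ?_ hD.le
      rw [e1]
      nlinarith [mul_pos (show 0 < v.1 - w.1 by linarith) h1,
        mul_nonneg (show 0 ≤ u.1 - w.1 by linarith) (neg_pos.2 h2).le]
    have p2 : 0 < orient a b z := by
      refine pos_of_mul_pos_right (a := v.1 - u.1) ?_ hD.le
      rw [e2]
      nlinarith [mul_pos (show 0 < v.1 - z.1 by linarith) h1,
        mul_nonneg (show 0 ≤ u.1 - z.1 by linarith) (neg_pos.2 h2).le]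
    exact mul_pos p1 p2
  · have p1 : 0 < -orient a b w := by
      refine pos_of_mul_pos_right (a := v.1 - u.1) ?_ hD.le
      rw [mul_neg, e1]
      nlinarith [mul_pos (show 0 < v.1 - w.1 by linarith) (neg_pos.2 h1),
        mul_nonneg (show 0 ≤ u.1 - w.1 by linarith) h2.le]
    have p2 : 0 < -orient a b z := by
      refine pos_of_mul_pos_right (a := v.1 - u.1) ?_ hD.le
      rw [mul_neg, e2]
      nlinarith [mul_pos (show 0 < v.1 - z.1 by linarith) (neg_pos.2 h1),
        mul_nonneg (show 0 ≤ u.1 - z.1 by linarith) h2.le]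
    nlinarith [mul_pos p1 p2]

theorem orient_mul_congr {a b c d u v : Pt} (hab : a.1 < b.1)
    (hc : orient a b c = 0) (hd : orient a b d = 0) (h : orient c d u * orient c d v < 0) :
    orient a b u * orient a b v < 0 := by
  have key : ∀ p : Pt, (d.1 - c.1) * orient a b p = (b.1 - a.1) * orient c d p := by
    intro p
    have : (d.1 - c.1) * orient a b p - (b.1 - a.1) * orient c d p =
        (d.1 - p.1) * orient a b c + (p.1 - c.1) * orient a b d := by
      simp only [orient]; ring
    rw [hc, hd] at this
    linarith
  have h1 : (d.1 - c.1) ^ 2 * (orient a b u * orient a b v) =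
      (b.1 - a.1) ^ 2 * (orient c d u * orient c d v) := by
    linear_combination (d.1 - c.1) * orient a b v * key u + (b.1 - a.1) * orient c d u * key v
  have h2 : (b.1 - a.1) ^ 2 * (orient c d u * orient c d v) < 0 :=
    mul_neg_of_pos_of_neg (by have := sub_pos.2 hab; positivity) h
  rw [← h1] at h2
  exact neg_of_mul_neg_right h2 (sq_nonneg _)

theorem IsTraceFamily.card_mul_sq_le {P : Finset Pt} {L : Finset (Finset Pt)}
    (h : IsTraceFamily P L) (hP : Set.InjOn Prod.fst (P : Set Pt)) {k q : ℕ} (hq : 1 ≤ q)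
    (hk : ∀ T ∈ L, k + 1 ≤ T.card) :
    L.card * k * q ^ 2 ≤ 3 * P.card * q ^ 3 + L.card ^ 2 := by
  classical
  set E := L.biUnion consecutivePairs with hE
  have memE : ∀ e, e ∈ E ↔ ∃ T ∈ L, e ∈ consecutivePairs T := fun e => by
    simp only [hE, Finset.mem_biUnion]
  have hdraw : IsDrawing P E := by
    refine ⟨hP, ?_, ?_, ?_, ?_⟩ <;> intro e he <;> obtain ⟨T, hT, heT⟩ := (memE e).1 he <;>
      obtain ⟨h1, h2, h3, h4⟩ := mem_consecutivePairs.1 heT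
    · exact (h T hT).1 h1
    · exact (h T hT).1 h2
    · exact h3
    · intro w hw h0
      exact h4 w (((h T hT).2 _ h1 _ h2 (fun hh => by rw [hh] at h3; exact lt_irrefl _ h3)
        w hw).2 h0)
  have hcard : L.card * k ≤ E.card := by
    rw [hE, Finset.card_biUnion]
    · rw [← smul_eq_mul]
      refine Finset.card_nsmul_le_sum _ _ _ fun T hT => ?_
      have := card_le_card_consecutivePairs
        (hP.mono (by exact_mod_cast (h T hT).1 : (T : Set Pt) ⊆ P))
      have := hk T hT
      omega
    · intro T hT T' hT' hne
      refine Finset.disjoint_left.2 fun e he he' => hne ?_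
      obtain ⟨h1, h2, h3, -⟩ := mem_consecutivePairs.1 he
      obtain ⟨h1', h2', -, -⟩ := mem_consecutivePairs.1 he'
      exact h.eq hT hT' h1 h2 h1' h2' (fun hh => by rw [hh] at h3; exact lt_irrefl _ h3)
  have hcross : (crossings E).card ≤ L.card ^ 2 := by
    choose! t ht1 ht2 using fun e => (memE e).1
    rw [sq, ← Finset.card_product]
    have uniq : ∀ e e' f f', e ∈ E → e' ∈ E → f ∈ E → f' ∈ E → SegCross e e' → SegCross f f' →
        t e = t f → t e' = t f' → ¬f.1.1 < e.1.1 := by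
      intro e e' f f' me me' mf mf' hx hy h1 h2 hlt
      obtain ⟨e1, e2, e3, e4⟩ := mem_consecutivePairs.1 (ht2 e me)
      obtain ⟨e1', e2', e3', e4'⟩ := mem_consecutivePairs.1 (ht2 e' me')
      obtain ⟨f1, f2, f3, f4⟩ := mem_consecutivePairs.1 (ht2 f mf)
      obtain ⟨f1', f2', f3', f4'⟩ := mem_consecutivePairs.1 (ht2 f' mf')
      rw [← h1] at f1 f2 f4
      rw [← h2] at f1' f2' f4'
      have ne : e.1 ≠ e.2 := fun hh => by rw [hh] at e3; exact lt_irrefl _ e3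
      have ne' : e'.1 ≠ e'.2 := fun hh => by rw [hh] at e3'; exact lt_irrefl _ e3'
      have col := fun w hw => ((h _ (ht1 e me)).2 _ e1 _ e2 ne w ((h _ (ht1 e me)).1 hw)).1 hw
      have col' := fun w hw =>
        ((h _ (ht1 e' me')).2 _ e1' _ e2' ne' w ((h _ (ht1 e' me')).1 hw)).1 hw
      have s1 := orient_mul_congr e3' (col' _ f1') (col' _ f2') hy.2
      have h5 : f.2.1 ≤ e.1.1 := by
        rcases f4 _ e1 with h | h
        · omega
        · exact h
      have s2 := orient_mul_pos (col _ f1) (col _ f2) e3 hlt.le h5 hx.2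
      linarith
    have uniq2 : ∀ e e' f f', e ∈ E → e' ∈ E → f ∈ E → f' ∈ E → SegCross e e' → SegCross f f' →
        t e = t f → t e' = t f' → e = f := by
      intro e e' f f' me me' mf mf' hx hy h1 h2
      have hfst : e.1.1 = f.1.1 := le_antisymm (not_lt.1 (uniq e e' f f' me me' mf mf' hx hy h1 h2))
        (not_lt.1 (uniq f f' e e' mf mf' me me' hy hx h1.symm h2.symm))
      obtain ⟨e1, e2, e3, e4⟩ := mem_consecutivePairs.1 (ht2 e me)
      obtain ⟨f1, f2, f3, f4⟩ := mem_consecutivePairs.1 (ht2 f mf)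
      rw [← h1] at f1 f2 f4
      have hsnd : e.2.1 = f.2.1 := by
        rcases e4 _ f2 with a | a <;> rcases f4 _ e2 with b | b <;> omega
      exact Prod.ext (hP (hdraw.left_mem _ me) (hdraw.left_mem _ mf) hfst)
        (hP (hdraw.right_mem _ me) (hdraw.right_mem _ mf) hsnd)
    refine Finset.card_le_card_of_injOn (fun x => (t x.1, t x.2)) ?_ ?_
    · intro x hx
      simp only [crossings, Finset.coe_filter, Finset.mem_product, Set.mem_ofPred_eq] at hx
      exact Finset.mem_coe.2 (Finset.mem_product.2 ⟨ht1 _ hx.1.1, ht1 _ hx.1.2⟩)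
    · intro x hx y hy hxy
      simp only [crossings, Finset.coe_filter, Finset.mem_product, Set.mem_ofPred_eq] at hx hy
      simp only [Prod.mk.injEq] at hxy
      exact Prod.ext (uniq2 _ _ _ _ hx.1.1 hx.1.2 hy.1.1 hy.1.2 hx.2 hy.2 hxy.1 hxy.2)
        (uniq2 _ _ _ _ hx.1.2 hx.1.1 hy.1.2 hy.1.1 hx.2.symm hy.2.symm hxy.2 hxy.1)
  have := hdraw.card_mul_sq_le hq
  calc L.card * k * q ^ 2 ≤ E.card * q ^ 2 := Nat.mul_le_mul_right _ hcard
    _ ≤ _ := by omega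

theorem orient_shear (K : ℤ) (u v w : Pt) :
    orient (K * u.1 + u.2, u.2) (K * v.1 + v.2, v.2) (K * w.1 + w.2, w.2) =
      K * orient u v w := by
  simp only [orient]; ring

theorem exists_shear_injOn (P : Finset Pt) :
    ∃ K : ℤ, 0 < K ∧ Set.InjOn (fun u : Pt => K * u.1 + u.2) (P : Set Pt) := by
  have hle : ∀ u ∈ P, |u.2| ≤ ∑ v ∈ P, |v.2| := fun u hu =>
    Finset.single_le_sum (f := fun v : Pt => |v.2|) (fun v _ => abs_nonneg _) hu
  have hnn := Finset.sum_nonneg fun v (_ : v ∈ P) => abs_nonneg v.2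
  refine ⟨2 * ∑ v ∈ P, |v.2| + 1, by linarith, ?_⟩
  intro u hu v hv huv
  have h1 := hle u hu
  have h2 := hle v hv
  set s := ∑ v ∈ P, |v.2|
  simp only at huv
  have h3 : (2 * s + 1) * (u.1 - v.1) = v.2 - u.2 := by linarith
  have h4 : |v.2 - u.2| < 2 * s + 1 := by
    have := abs_sub v.2 u.2
    linarith
  have h5 : u.1 - v.1 = 0 := by
    by_contra hne
    have : 1 ≤ |u.1 - v.1| := Int.one_le_abs hne
    rw [← h3, abs_mul] at h4
    have h6 : 0 ≤ s := (abs_nonneg _).trans h1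
    rw [abs_of_pos (by linarith : 0 < 2 * s + 1)] at h4
    nlinarith
  rw [h5] at h3
  exact Prod.ext (by linarith) (by linarith)

/-- The Szemerédi–Trotter bound on the number of `k`-rich lines. -/
theorem IsTraceFamily.card_mul_cube_le {P : Finset Pt} {L : Finset (Finset Pt)}
    (h : IsTraceFamily P L) {k : ℕ} (hk2 : 2 ≤ k) (hk : ∀ T ∈ L, k ≤ T.card) :
    (L.card : ℝ) * k ^ 3 ≤ 2304 * (P.card : ℝ) ^ 2 + 24 * P.card * (k : ℝ) ^ 2 := by
  classical
  have main : ∀ q : ℕ, 1 ≤ q →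
      L.card * (k - 1) * q ^ 2 ≤ 3 * P.card * q ^ 3 + L.card ^ 2 := by
    intro q hq
    obtain ⟨K, hK, hinj⟩ := exists_shear_injOn P
    set φ : Pt → Pt := fun u => (K * u.1 + u.2, u.2) with hφ
    have φinj : Function.Injective φ := by
      intro u v huv
      simp only [hφ, Prod.mk.injEq] at huv
      have h2 := huv.2
      have h1 : K * (u.1 - v.1) = 0 := by linarith [huv.1]
      rcases mul_eq_zero.1 h1 with h3 | h3
      · omega
      · exact Prod.ext (by linarith) h2
    have hfam : IsTraceFamily (P.image φ) (L.image fun T => T.image φ) := by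
      intro T' hT'
      obtain ⟨T, hT, rfl⟩ := Finset.mem_image.1 hT'
      refine ⟨Finset.image_subset_image (h T hT).1, ?_⟩
      intro u' hu' v' hv' huv w' hw'
      obtain ⟨u, hu, rfl⟩ := Finset.mem_image.1 hu'
      obtain ⟨v, hv, rfl⟩ := Finset.mem_image.1 hv'
      obtain ⟨w, hw, rfl⟩ := Finset.mem_image.1 hw'
      rw [φinj.mem_finset_image, (h T hT).2 u hu v hv (fun hh => huv (by rw [hh])) w hw]
      simp only [hφ]
      rw [orient_shear]
      simp [hK.ne']
    have := hfam.card_mul_sq_le (k := k - 1) (q := q) (by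
      rintro _ hu' _ hv' huv
      obtain ⟨u, hu, rfl⟩ := Finset.mem_image.1 (Finset.mem_coe.1 hu')
      obtain ⟨v, hv, rfl⟩ := Finset.mem_image.1 (Finset.mem_coe.1 hv')
      rw [hinj hu hv huv]) hq (by
      intro T' hT'
      obtain ⟨T, hT, rfl⟩ := Finset.mem_image.1 hT'
      rw [Finset.card_image_of_injective _ φinj]
      have := hk T hT
      omega)
    rwa [Finset.card_image_of_injective _ φinj,
      Finset.card_image_of_injective _ (Finset.image_injective φinj)] at this
  set N : ℝ := (P.card : ℝ)
  set l : ℝ := (L.card : ℝ)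
  have hk0 : (2 : ℝ) ≤ k := by exact_mod_cast hk2
  have hl0 : 0 ≤ l := Nat.cast_nonneg _
  have hN0 : 0 ≤ N := Nat.cast_nonneg _
  set r := Real.sqrt (l / k) with hr
  have hr0 : 0 ≤ r := Real.sqrt_nonneg _
  have hr2 : r ^ 2 * k = l := by
    rw [hr, Real.sq_sqrt (by positivity)]; field_simp
  have hq := main (⌊2 * r⌋₊ + 1) (by omega)
  set q := ⌊2 * r⌋₊ + 1 with hqdef
  have hq1 : 2 * r ≤ q := by
    rw [hqdef]; push_cast; exact (Nat.lt_floor_add_one _).le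
  have hq2 : (q : ℝ) ≤ 2 * r + 1 := by
    rw [hqdef]; push_cast; linarith [Nat.floor_le (by positivity : 0 ≤ 2 * r)]
  have hqr : l * ((k : ℝ) - 1) * q ^ 2 ≤ 3 * N * q ^ 3 + l ^ 2 := by
    have : ((L.card * (k - 1) * q ^ 2 : ℕ) : ℝ) ≤ ((3 * P.card * q ^ 3 + L.card ^ 2 : ℕ) : ℝ) := by
      exact_mod_cast hq
    push_cast [Nat.cast_sub (by omega : 1 ≤ k)] at this
    exact this
  have hq0 : (0 : ℝ) < q := by rw [hqdef]; positivity
  have h1 : l * k * q ^ 2 / 4 ≤ 3 * N * q ^ 3 := by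
    have e1 : l ^ 2 ≤ l * k * q ^ 2 / 4 := by
      have : 4 * r ^ 2 ≤ (q : ℝ) ^ 2 := by nlinarith
      have h4 : l * (4 * (r ^ 2 * k)) ≤ l * (k * q ^ 2) :=
        mul_le_mul_of_nonneg_left (by nlinarith) hl0
      rw [hr2] at h4
      nlinarith
    have e2 : l * k * q ^ 2 / 2 ≤ l * ((k : ℝ) - 1) * q ^ 2 := by
      have : l * q ^ 2 * (k / 2) ≤ l * q ^ 2 * (k - 1) :=
        mul_le_mul_of_nonneg_left (by linarith) (by positivity)
      nlinarith
    linarith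
  have h2 : l * k ≤ 12 * N * q := by
    have : (l * k) * q ^ 2 ≤ (12 * N * q) * q ^ 2 := by nlinarith
    exact le_of_mul_le_mul_right this (by positivity)
  have h3 : l * k ≤ 24 * N * r + 12 * N := by nlinarith
  rcases le_total (24 * N * r) (12 * N) with h4 | h4
  · have : l * k * k ^ 2 ≤ 24 * N * k ^ 2 :=
        mul_le_mul_of_nonneg_right (by linarith) (by positivity)
    nlinarith [sq_nonneg N]
  · have h5 : l * k ≤ 48 * N * r := by linarith
    have h6 : r * k ^ 2 ≤ 48 * N := by
      rcases hr0.eq_or_lt with h0 | h0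
      · rw [← h0]; simpa using hN0
      · have : r * (r * k ^ 2) ≤ r * (48 * N) := by
          calc r * (r * k ^ 2) = l * k := by rw [← hr2]; ring
            _ ≤ _ := by linarith
        exact le_of_mul_le_mul_left this h0
    have h7 : l * k ^ 3 = (r * k ^ 2) ^ 2 := by rw [← hr2]; ring
    have h8 : (r * (k : ℝ) ^ 2) ^ 2 ≤ (48 * N) ^ 2 := pow_le_pow_left₀ (by positivity) h6 2
    have : 0 ≤ 24 * N * (k : ℝ) ^ 2 := by positivity
    nlinarith

end LineTraces

section LatticeVectors

/-- The determinant of two lattice vectors. -/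
def det (u v : Pt) : ℤ := u.1 * v.2 - u.2 * v.1

/-- The scalar product of two lattice vectors. -/
def dot (u v : Pt) : ℤ := u.1 * v.1 + u.2 * v.2

/-- The rotation by a right angle. -/
def rot (v : Pt) : Pt := (-v.2, v.1)

/-- The primitive vector in the direction of `v`. -/
def dir (v : Pt) : Pt := (v.1 / gcdP v, v.2 / gcdP v)

theorem orient_eq_det (u v w : Pt) : orient u v w = det (v - u) (w - u) := by
  simp [orient, det]

theorem rot_ne_zero {d : Pt} (hd : d ≠ 0) : rot d ≠ 0 := by
  intro h
  simp only [rot, Prod.mk_eq_zero, neg_eq_zero] at h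
  exact hd (Prod.ext h.2 h.1)

theorem rot_injective : Function.Injective rot := by
  intro u v h
  simp only [rot, Prod.mk.injEq, neg_inj] at h
  exact Prod.ext h.2 h.1

theorem rot_neg (d : Pt) : rot (-d) = -rot d := by simp [rot]

theorem det_rot_rot (d e : Pt) : det (rot d) (rot e) = det d e := by simp [rot, det]; ring

theorem det_rot (d e : Pt) : det (rot d) e = -dot d e := by simp [rot, det, dot]; ring

theorem det_neg_left (d e : Pt) : det (-d) e = -det d e := by simp [det]; ring

theorem gcdP_pos {v : Pt} (hv : v ≠ 0) : 0 < gcdP v := by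
  rw [gcdP, Int.gcd_pos_iff]
  by_contra h
  push Not at h
  exact hv (Prod.ext h.1 h.2)

theorem gcdP_neg (v : Pt) : gcdP (-v) = gcdP v := by simp [gcdP]

theorem gcdP_rot (v : Pt) : gcdP (rot v) = gcdP v := by
  simp [gcdP, rot, Int.gcd_comm]

theorem smul_dir (v : Pt) : (gcdP v : ℤ) • dir v = v := by
  ext
  · exact Int.mul_ediv_cancel' (Int.gcd_dvd_left ..)
  · exact Int.mul_ediv_cancel' (Int.gcd_dvd_right ..)

theorem gcdP_dir {v : Pt} (hv : v ≠ 0) : gcdP (dir v) = 1 :=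
  Int.gcd_ediv_gcd_ediv_gcd (gcdP_pos hv)

theorem ne_zero_of_gcdP_eq_one {d : Pt} (hd : gcdP d = 1) : d ≠ 0 := by
  rintro rfl
  simp [gcdP] at hd

theorem dir_ne_zero {v : Pt} (hv : v ≠ 0) : dir v ≠ 0 := ne_zero_of_gcdP_eq_one (gcdP_dir hv)

theorem dir_neg (v : Pt) : dir (-v) = -dir v := by
  rw [dir, dir, gcdP_neg]
  ext
  · exact Int.neg_ediv_of_dvd (Int.gcd_dvd_left ..)
  · exact Int.neg_ediv_of_dvd (Int.gcd_dvd_right ..)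

theorem exists_smul_of_det_eq_zero {d e : Pt} (hd : gcdP d = 1) (h : det d e = 0) :
    ∃ t : ℤ, e = t • d := by
  obtain ⟨a, b, hab⟩ := Int.isCoprime_iff_gcd_eq_one.2 hd
  simp only [det] at h
  refine ⟨a * e.1 + b * e.2, Prod.ext ?_ ?_⟩
  · simp only [Prod.smul_fst, smul_eq_mul]
    linear_combination (-e.1) * hab - b * h
  · simp only [Prod.smul_snd, smul_eq_mul]
    linear_combination (-e.2) * hab + a * h

theorem eq_or_eq_neg_of_det_eq_zero {d e : Pt} (hd : gcdP d = 1) (he : gcdP e = 1)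
    (h : det d e = 0) : e = d ∨ e = -d := by
  obtain ⟨t, rfl⟩ := exists_smul_of_det_eq_zero hd h
  have h1 : t.natAbs = 1 := by
    have h2 : gcdP (t • d) = t.natAbs * gcdP d := Int.gcd_mul_left ..
    rw [← he, h2, hd, mul_one]
  rcases Int.natAbs_eq t with h2 | h2 <;> rw [h2, h1]
  · left; simp
  · right; simp

theorem det_trans {u v w : Pt} (hv : v ≠ 0) (h1 : det u v = 0) (h2 : det v w = 0) :
    det u w = 0 := by
  simp only [det] at *
  by_contra hne
  apply hv
  have e1 : v.1 * (u.1 * w.2 - u.2 * w.1) = 0 := by linear_combination w.1 * h1 + u.1 * h2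
  have e2 : v.2 * (u.1 * w.2 - u.2 * w.1) = 0 := by linear_combination w.2 * h1 + u.2 * h2
  exact Prod.ext ((mul_eq_zero.1 e1).resolve_right hne) ((mul_eq_zero.1 e2).resolve_right hne)

theorem det_comm_eq_zero {u v : Pt} : det u v = 0 ↔ det v u = 0 := by
  have : det u v = -det v u := by simp only [det]; ring
  rw [this, neg_eq_zero]

theorem det_dir_iff {v w : Pt} (hv : v ≠ 0) : det (dir v) w = 0 ↔ det v w = 0 := by
  have h : det v w = gcdP v * det (dir v) w := by
    conv_lhs => rw [← smul_dir v]
    simp only [det, Prod.smul_fst, Prod.smul_snd, smul_eq_mul]; ring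
  rw [h, mul_eq_zero, or_iff_right]
  exact_mod_cast (gcdP_pos hv).ne'

theorem det_rot_dir_iff {v w : Pt} (hv : v ≠ 0) : det (rot (dir v)) w = 0 ↔ dot v w = 0 := by
  have h : dot v w = gcdP v * dot (dir v) w := by
    conv_lhs => rw [← smul_dir v]
    simp only [dot, Prod.smul_fst, Prod.smul_snd, smul_eq_mul]; ring
  rw [det_rot, neg_eq_zero, h, mul_eq_zero, or_iff_right]
  exact_mod_cast (gcdP_pos hv).ne'

theorem eq_zero_of_det_dot {d a : Pt} (hd : d ≠ 0) (h1 : det d a = 0) (h2 : dot d a = 0) :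
    a = 0 := by
  have h3 : det (rot d) a = 0 := by rw [det_rot, h2, neg_zero]
  by_contra ha
  have h4 : det d (rot d) = 0 := det_trans ha h1 (det_comm_eq_zero.1 h3)
  simp only [det, rot] at h4
  have h5 : d.1 ^ 2 = 0 := by nlinarith [sq_nonneg d.1, sq_nonneg d.2]
  have h6 : d.2 ^ 2 = 0 := by nlinarith [sq_nonneg d.1, sq_nonneg d.2]
  exact hd (Prod.ext (pow_eq_zero_iff two_ne_zero |>.1 h5) (pow_eq_zero_iff two_ne_zero |>.1 h6))

end LatticeVectors

section RichLines

open scoped Classical in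
/-- The points of `T` on the line through `x` in direction `d`. -/
def lineFiber (T : Finset Pt) (x d : Pt) : Finset Pt := T.filter fun y => det d (y - x) = 0

theorem mem_lineFiber {T : Finset Pt} {x d y : Pt} :
    y ∈ lineFiber T x d ↔ y ∈ T ∧ det d (y - x) = 0 := by
  simp only [lineFiber, Finset.mem_filter]

theorem lineFiber_neg (T : Finset Pt) (x d : Pt) : lineFiber T x (-d) = lineFiber T x d := by
  ext y
  simp only [mem_lineFiber, det_neg_left, neg_eq_zero]

theorem isTraceFamily_lineFiber {T : Finset Pt} {L : Finset (Finset Pt)}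
    (h : ∀ X ∈ L, ∃ x d, d ≠ 0 ∧ X = lineFiber T x d) : IsTraceFamily T L := by
  intro X hX
  obtain ⟨x, d, hd, rfl⟩ := h X hX
  refine ⟨fun y hy => (mem_lineFiber.1 hy).1, ?_⟩
  intro u hu v hv huv w hw
  rw [mem_lineFiber] at hu hv ⊢
  have sub : ∀ p q : Pt, det d (p - q) = det d (p - x) - det d (q - x) := by
    intro p q
    simp only [det, Prod.fst_sub, Prod.snd_sub]; ring
  have e1 : det d (v - u) = 0 := by rw [sub, hu.2, hv.2, sub_zero]
  have hne : v - u ≠ 0 := sub_ne_zero.2 huv.symm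
  rw [orient_eq_det]
  constructor
  · rintro ⟨-, hw0⟩
    have e2 : det d (w - u) = 0 := by rw [sub, hu.2, hw0, sub_zero]
    exact det_trans hd (det_comm_eq_zero.1 e1) e2
  · intro h0
    refine ⟨hw, ?_⟩
    have e2 : det d (w - u) = 0 := det_trans hne e1 h0
    rw [sub, hu.2, sub_zero] at e2
    exact e2

theorem card_incidences_le {T : Finset Pt} {N : ℝ} (hN : (T.card : ℝ) ≤ N) {k : ℕ} (hk : 2 ≤ k)
    {I : Finset (Pt × Pt)} (hI : ∀ p ∈ I, p.1 ∈ T ∧ gcdP p.2 = 1 ∧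
      k ≤ (lineFiber T p.1 p.2).card ∧ (lineFiber T p.1 p.2).card < 2 * k) :
    (I.card : ℝ) * k ^ 2 ≤ 9216 * N ^ 2 + 96 * N * k ^ 2 := by
  classical
  set L := I.image fun p => lineFiber T p.1 p.2 with hL
  have hfam : IsTraceFamily T L := isTraceFamily_lineFiber fun X hX => by
    obtain ⟨p, hp, rfl⟩ := Finset.mem_image.1 hX
    exact ⟨p.1, p.2, ne_zero_of_gcdP_eq_one (hI p hp).2.1, rfl⟩
  have h1 := hfam.card_mul_cube_le hk fun X hX => by
    obtain ⟨p, hp, rfl⟩ := Finset.mem_image.1 hX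
    exact (hI p hp).2.2.1
  have h2 : I.card ≤ 4 * k * L.card := by
    refine Finset.card_le_mul_card_image I _ fun X hX => ?_
    obtain ⟨p₀, hp₀, rfl⟩ := Finset.mem_image.1 hX
    refine (Finset.card_le_card (t := lineFiber T p₀.1 p₀.2 ×ˢ {p₀.2, -p₀.2}) ?_).trans ?_
    · intro p hp
      obtain ⟨hpI, hpe⟩ := Finset.mem_filter.1 hp
      have hself : p.1 ∈ lineFiber T p.1 p.2 :=
        mem_lineFiber.2 ⟨(hI p hpI).1, by simp [det]⟩
      obtain ⟨u, hu, v, hv, huv⟩ := Finset.one_lt_card.1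
        (lt_of_lt_of_le (by omega : 1 < k) (hI p hpI).2.2.1)
      have par : ∀ x d : Pt, u ∈ lineFiber T x d → v ∈ lineFiber T x d → det d (v - u) = 0 := by
        intro x d h h'
        have e1 := (mem_lineFiber.1 h).2
        have e2 := (mem_lineFiber.1 h').2
        simp only [det, Prod.fst_sub, Prod.snd_sub] at e1 e2 ⊢
        linear_combination e2 - e1
      have d1 := par _ _ hu hv
      rw [hpe] at hu hv
      have d2 := par _ _ hu hv
      have := eq_or_eq_neg_of_det_eq_zero (hI p₀ hp₀).2.1 (hI p hpI).2.1
        (det_trans (sub_ne_zero.2 huv.symm) d2 (det_comm_eq_zero.1 d1))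
      rw [hpe] at hself
      refine Finset.mem_product.2 ⟨hself, ?_⟩
      simpa only [Finset.mem_insert, Finset.mem_singleton] using this
    · rw [Finset.card_product]
      calc _ ≤ (2 * k) * 2 := Nat.mul_le_mul (hI p₀ hp₀).2.2.2.le Finset.card_le_two
        _ = 4 * k := by ring
  have h2' : (I.card : ℝ) ≤ 4 * k * L.card := by exact_mod_cast h2
  have hk0 : (0 : ℝ) < k := by exact_mod_cast (by omega : 0 < k)
  have hT0 : (0 : ℝ) ≤ T.card := Nat.cast_nonneg _
  calc (I.card : ℝ) * k ^ 2 ≤ 4 * k * L.card * k ^ 2 :=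
        mul_le_mul_of_nonneg_right h2' (by positivity)
    _ = 4 * (L.card * k ^ 3) := by ring
    _ ≤ 4 * (2304 * (T.card : ℝ) ^ 2 + 24 * T.card * (k : ℝ) ^ 2) := by linarith
    _ ≤ 4 * (2304 * N ^ 2 + 24 * N * (k : ℝ) ^ 2) := by gcongr
    _ = _ := by ring

/-- The number of points of `A`, of the same level as `x`, on the line through `x` in
direction `d`. -/
def richness (A : Finset Pt) (lev : Pt → ℕ) (x d : Pt) : ℕ :=
  (lineFiber (A.filter fun y => lev y = lev x) x d).card

/-- The larger of the richnesses of the two lines through `x` parallel and perpendicular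
to `d`. -/
def crossRichness (A : Finset Pt) (lev : Pt → ℕ) (x d : Pt) : ℕ :=
  max (richness A lev x d) (richness A lev x (rot d))

/-- One of the two lines through `x` parallel and perpendicular to `d` is very rich. -/
def IsBig (A : Finset Pt) (lev : Pt → ℕ) (C : ℕ) (x d : Pt) : Prop :=
  (2 : ℝ) ^ ((lev x : ℝ) / 2 + C) ≤ crossRichness A lev x d

variable {A : Finset Pt} {lev : Pt → ℕ} {C : ℕ}

theorem richness_neg (x d : Pt) : richness A lev x (-d) = richness A lev x d := by
  rw [richness, lineFiber_neg, richness]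

theorem crossRichness_neg (x d : Pt) : crossRichness A lev x (-d) = crossRichness A lev x d := by
  rw [crossRichness, rot_neg, richness_neg, richness_neg, crossRichness]

theorem isBig_neg (x d : Pt) : IsBig A lev C x (-d) ↔ IsBig A lev C x d := by
  rw [IsBig, crossRichness_neg, IsBig]

theorem crossRichness_pos {x : Pt} (hx : x ∈ A) (d : Pt) : 0 < crossRichness A lev x d := by
  refine lt_of_lt_of_le (Finset.card_pos.2 ⟨x, ?_⟩) (le_max_left _ _)
  exact mem_lineFiber.2 ⟨Finset.mem_filter.2 ⟨hx, rfl⟩, by simp [det]⟩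

theorem card_medium_le (hA : ∀ j, (A.filter fun x => lev x = j).card ≤ 2 ^ j) {j a : ℕ}
    (ha : 1 ≤ a) {I : Finset (Pt × Pt)} (hI : ∀ p ∈ I, p.1 ∈ A ∧ gcdP p.2 = 1 ∧
      lev p.1 = j ∧ ¬IsBig A lev C p.1 p.2 ∧ Nat.log 2 (crossRichness A lev p.1 p.2) = a) :
    (I.card : ℝ) ≤ (18432 + 192 * 4 ^ C) * 2 ^ (2 * (j : ℝ) - 2 * a) := by
  classical
  rcases I.eq_empty_or_nonempty with rfl | ⟨p₀, hp₀⟩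
  · simp only [Finset.card_empty, Nat.cast_zero]; positivity
  set T := A.filter fun x => lev x = j with hT
  have hTN : (T.card : ℝ) ≤ 2 ^ j := by exact_mod_cast hA j
  have hk : 2 ≤ 2 ^ a := by
    calc 2 = 2 ^ 1 := rfl
      _ ≤ _ := Nat.pow_le_pow_right (by norm_num) ha
  have hlog : ∀ p ∈ I, 2 ^ a ≤ crossRichness A lev p.1 p.2 ∧
      crossRichness A lev p.1 p.2 < 2 * 2 ^ a := by
    intro p hp
    obtain ⟨h1, h2, h3, h4, h5⟩ := hI p hp
    refine ⟨h5 ▸ Nat.pow_log_le_self 2 (crossRichness_pos h1 _).ne', ?_⟩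
    have := Nat.lt_pow_succ_log_self (b := 2) (by norm_num) (crossRichness A lev p.1 p.2)
    rw [h5] at this
    omega
  have hsq : ((2 : ℝ) ^ a) ^ 2 ≤ 4 ^ C * 2 ^ j := by
    obtain ⟨h1, h2, h3, h4, h5⟩ := hI p₀ hp₀
    have h6 : ((2 : ℝ) ^ a) ≤ 2 ^ ((j : ℝ) / 2 + C) := by
      rw [IsBig, h3, not_le] at h4
      refine le_trans ?_ h4.le
      exact_mod_cast (hlog p₀ hp₀).1
    calc ((2 : ℝ) ^ a) ^ 2 ≤ (2 ^ ((j : ℝ) / 2 + C)) ^ 2 := pow_le_pow_left₀ (by positivity) h6 2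
      _ = 4 ^ C * 2 ^ j := by
        rw [← Real.rpow_natCast, ← Real.rpow_mul (by norm_num),
          show (4 : ℝ) = 2 ^ (2 : ℝ) by norm_num,
          ← Real.rpow_natCast, ← Real.rpow_natCast, ← Real.rpow_mul (by norm_num),
          ← Real.rpow_add (by norm_num)]
        congr 1
        push_cast
        ring
  set I₁ := I.filter fun p => richness A lev p.1 p.2 = crossRichness A lev p.1 p.2 with hI₁
  set I₂ := I.filter fun p => ¬richness A lev p.1 p.2 = crossRichness A lev p.1 p.2 with hI₂
  set I₃ := I₂.image fun p => (p.1, rot p.2) with hI₃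
  have c1 := card_incidences_le (I := I₁) hTN hk fun p hp => by
    obtain ⟨hp, he⟩ := Finset.mem_filter.1 hp
    obtain ⟨h1, h2, h3, h4, h5⟩ := hI p hp
    have := hlog p hp
    rw [← he, richness, h3] at this
    exact ⟨Finset.mem_filter.2 ⟨h1, h3⟩, h2, this⟩
  have c2 := card_incidences_le (I := I₃) hTN hk fun p' hp' => by
    obtain ⟨p, hp, rfl⟩ := Finset.mem_image.1 hp'
    obtain ⟨hp, he⟩ := Finset.mem_filter.1 hp
    obtain ⟨h1, h2, h3, h4, h5⟩ := hI p hp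
    have he' : richness A lev p.1 (rot p.2) = crossRichness A lev p.1 p.2 := by
      rcases max_choice (richness A lev p.1 p.2) (richness A lev p.1 (rot p.2)) with h | h
      · exact absurd h.symm he
      · exact h.symm
    have := hlog p hp
    rw [← he', richness, h3] at this
    exact ⟨Finset.mem_filter.2 ⟨h1, h3⟩, by rw [gcdP_rot, h2], this⟩
  have c3 : I₃.card = I₂.card := Finset.card_image_of_injective _ fun p q h => by
    simp only [Prod.mk.injEq] at h
    exact Prod.ext h.1 (rot_injective h.2)
  have c4 : I₁.card + I₂.card = I.card := Finset.card_filter_add_card_filter_not _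
  have c5 : (I.card : ℝ) = I₁.card + I₂.card := by exact_mod_cast c4.symm
  rw [c3] at c2
  push_cast at c1 c2
  have c6 : (I.card : ℝ) * (2 ^ a) ^ 2 ≤ (18432 + 192 * 4 ^ C) * (2 ^ j) ^ 2 := by
    have : 192 * (2 : ℝ) ^ j * (2 ^ a) ^ 2 ≤ 192 * 2 ^ j * (4 ^ C * 2 ^ j) :=
      mul_le_mul_of_nonneg_left hsq (by positivity)
    rw [c5]
    nlinarith
  rw [Real.rpow_sub (by norm_num), ← mul_div_assoc, le_div_iff₀ (by positivity)]
  have e : ∀ n : ℕ, (2 : ℝ) ^ (2 * (n : ℝ)) = (2 ^ n) ^ 2 := fun n => by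
    rw [← pow_mul, ← Real.rpow_natCast]; push_cast; ring_nf
  rw [e, e]
  exact c6

theorem card_fiber_le_crossRichness {B : Finset Pt} {x d : Pt} {K : ℝ} (hK : 0 ≤ K) {j : ℕ}
    (h : ∀ y ∈ B, y ∈ A ∧ lev y = j ∧ det d (y - x) = 0 ∧ (richness A lev y d : ℝ) ≤ K) :
    (B.card : ℝ) ≤ K := by
  rcases B.eq_empty_or_nonempty with rfl | ⟨y, hy⟩
  · simpa using hK
  · refine le_trans ?_ (h y hy).2.2.2
    refine Nat.cast_le.2 (Finset.card_le_card fun z hz => mem_lineFiber.2 ⟨Finset.mem_filter.2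
      ⟨(h z hz).1, by rw [(h z hz).2.1, (h y hy).2.1]⟩, ?_⟩)
    have e1 := (h z hz).2.2.1
    have e2 := (h y hy).2.2.1
    simp only [det, Prod.fst_sub, Prod.snd_sub] at e1 e2 ⊢
    linear_combination e1 - e2

/-- Through each point there is at most one very rich line. -/
def UniqueRich (A : Finset Pt) (lev : Pt → ℕ) (C : ℕ) : Prop :=
  ∀ x ∈ A, ∀ d e : Pt, d ≠ 0 → e ≠ 0 → (2 : ℝ) ^ ((lev x : ℝ) / 2 + C) ≤ richness A lev x d →
    (2 : ℝ) ^ ((lev x : ℝ) / 2 + C) ≤ richness A lev x e → det d e = 0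

theorem IsBig.richness_or {x d : Pt} (h : IsBig A lev C x d) :
    (2 : ℝ) ^ ((lev x : ℝ) / 2 + C) ≤ richness A lev x d ∨
      (2 : ℝ) ^ ((lev x : ℝ) / 2 + C) ≤ richness A lev x (rot d) := by
  rcases max_choice (richness A lev x d) (richness A lev x (rot d)) with h1 | h1
  · left; rw [IsBig, crossRichness, h1] at h; exact h
  · right; rw [IsBig, crossRichness, h1] at h; exact h

theorem rot_rot (d : Pt) : rot (rot d) = -d := by ext <;> simp [rot]

theorem card_big_le (hA : ∀ j, (A.filter fun x => lev x = j).card ≤ 2 ^ j)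
    (hu : UniqueRich A lev C) {j : ℕ} {I : Finset (Pt × Pt)}
    (hI : ∀ p ∈ I, p.1 ∈ A ∧ gcdP p.2 = 1 ∧ lev p.1 = j ∧ IsBig A lev C p.1 p.2) :
    (I.card : ℝ) ≤ 4 * 2 ^ (j : ℝ) := by
  classical
  have h1 : I.card ≤ 4 * (I.image Prod.fst).card := by
    refine Finset.card_le_mul_card_image I _ fun x hx => ?_
    obtain ⟨p₀, hp₀, rfl⟩ := Finset.mem_image.1 hx
    have key : ∃ e : Pt, gcdP e = 1 ∧
        (2 : ℝ) ^ ((lev p₀.1 : ℝ) / 2 + C) ≤ richness A lev p₀.1 e := by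
      obtain ⟨h1, h2, h3, h4⟩ := hI p₀ hp₀
      rcases h4.richness_or with h | h
      · exact ⟨_, h2, h⟩
      · exact ⟨_, by rw [gcdP_rot, h2], h⟩
    obtain ⟨e, he, her⟩ := key
    refine (Finset.card_le_card (t := ({e, -e, rot e, -rot e} : Finset Pt).image
      fun d => (p₀.1, d)) ?_).trans (Finset.card_image_le.trans Finset.card_le_four)
    intro p hp
    obtain ⟨hp, hpe⟩ := Finset.mem_filter.1 hp
    obtain ⟨h1, h2, h3, h4⟩ := hI p hp
    refine Finset.mem_image.2 ⟨p.2, ?_, Prod.ext hpe.symm rfl⟩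
    simp only [Finset.mem_insert, Finset.mem_singleton]
    have hz := ne_zero_of_gcdP_eq_one h2
    rcases h4.richness_or with h | h
    · rw [hpe] at h
      rcases eq_or_eq_neg_of_det_eq_zero he h2
        (hu _ (hI p₀ hp₀).1 _ _ (ne_zero_of_gcdP_eq_one he) hz her h) with h | h <;> simp [h]
    · rw [hpe] at h
      rcases eq_or_eq_neg_of_det_eq_zero he (by rw [gcdP_rot, h2])
        (hu _ (hI p₀ hp₀).1 _ _ (ne_zero_of_gcdP_eq_one he) (rot_ne_zero hz) her h) with h | h
      · have := rot_rot p.2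
        rw [h] at this
        rw [this]; simp
      · have := rot_rot p.2
        rw [h, rot_neg, neg_inj] at this
        rw [this]; simp
  have h2 : (I.image Prod.fst).card ≤ 2 ^ j := by
    refine (Finset.card_le_card fun x hx => ?_).trans (hA j)
    obtain ⟨p, hp, rfl⟩ := Finset.mem_image.1 hx
    exact Finset.mem_filter.2 ⟨(hI p hp).1, (hI p hp).2.2.1⟩
  rw [Real.rpow_natCast]
  exact_mod_cast h1.trans (Nat.mul_le_mul_left 4 h2)

end RichLines

section CellSums

theorem sum_le_card_image_mul {α β : Type*} [DecidableEq β] {s : Finset α} {f : α → β} {u : α → ℝ}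
    {K : ℝ} (h : ∀ b ∈ s.image f, ∑ q ∈ s.filter (fun q => f q = b), u q ≤ K) :
    ∑ q ∈ s, u q ≤ (s.image f).card * K := by
  rw [← Finset.sum_fiberwise_of_maps_to (fun q hq => Finset.mem_image_of_mem f hq), ← nsmul_eq_mul]
  exact Finset.sum_le_card_nsmul _ _ _ h

theorem sum_inv_le_sqrt {G : Finset ℕ} (hG : ∀ g ∈ G, 0 < g) :
    ∑ g ∈ G, (1 / g : ℝ) ≤ √(2 * G.card) := by
  apply Real.le_sqrt_of_sq_le
  have h1 : (∑ g ∈ G, (1 / g : ℝ)) ^ 2 ≤ G.card * ∑ g ∈ G, (1 / g : ℝ) ^ 2 :=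
    sq_sum_le_card_mul_sum_sq
  have h2 : ∑ g ∈ G, (1 / g : ℝ) ^ 2 ≤ 2 := by
    have h3 := sum_Ioo_inv_sq_le (α := ℝ) 0 (G.sup id + 1)
    refine le_trans ?_ (h3.trans (by norm_num))
    calc ∑ g ∈ G, (1 / g : ℝ) ^ 2 = ∑ g ∈ G, ((g : ℝ) ^ 2)⁻¹ := by simp
      _ ≤ _ := Finset.sum_le_sum_of_subset_of_nonneg (fun g hg => Finset.mem_Ioo.2
        ⟨hG g hg, Nat.lt_succ_of_le (Finset.le_sup (f := id) hg)⟩) fun _ _ _ => by positivity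
  nlinarith [Nat.cast_nonneg (α := ℝ) G.card]

/-- Nondegenerate rectangles. -/
def IsRectangle (q : Pt × Pt × Pt × Pt) : Prop :=
  q.1 + q.2.2.1 = q.2.1 + q.2.2.2 ∧ dot (q.1 - q.2.1) (q.1 - q.2.2.2) = 0 ∧
    q.1 ≠ q.2.1 ∧ q.1 ≠ q.2.2.2

open scoped Classical in
/-- The nondegenerate rectangles in `A` whose vertices satisfy the given conditions, which may
depend on the direction of the first side. -/
def rectCell (A : Finset Pt) (c₁ c₂ c₃ c₄ : Pt → Pt → Prop) : Finset (Pt × Pt × Pt × Pt) :=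
  (A ×ˢ A ×ˢ A ×ˢ A).filter fun q => IsRectangle q ∧ c₁ q.1 (dir (q.1 - q.2.1)) ∧
    c₂ q.2.1 (dir (q.1 - q.2.1)) ∧ c₃ q.2.2.1 (dir (q.1 - q.2.1)) ∧
    c₄ q.2.2.2 (dir (q.1 - q.2.1))

/-- The number of rectangles in a cell, weighted by the inverse lattice length of the first
side. -/
def cellSum (A : Finset Pt) (c₁ c₂ c₃ c₄ : Pt → Pt → Prop) : ℝ :=
  ∑ q ∈ rectCell A c₁ c₂ c₃ c₄, 1 / (gcdP (q.1 - q.2.1) : ℝ)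

variable {A : Finset Pt} {c₁ c₂ c₃ c₄ : Pt → Pt → Prop}

theorem mem_rectCell {q : Pt × Pt × Pt × Pt} : q ∈ rectCell A c₁ c₂ c₃ c₄ ↔
    (q.1 ∈ A ∧ q.2.1 ∈ A ∧ q.2.2.1 ∈ A ∧ q.2.2.2 ∈ A) ∧ IsRectangle q ∧
    c₁ q.1 (dir (q.1 - q.2.1)) ∧ c₂ q.2.1 (dir (q.1 - q.2.1)) ∧
    c₃ q.2.2.1 (dir (q.1 - q.2.1)) ∧ c₄ q.2.2.2 (dir (q.1 - q.2.1)) := by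
  simp only [rectCell, Finset.mem_filter, Finset.mem_product]

theorem IsRectangle.swap {x y z w : Pt} (h : IsRectangle (x, y, z, w)) :
    IsRectangle (y, x, w, z) := by
  obtain ⟨h1, h2, h3, h4⟩ := h
  simp only at h1 h2 h3 h4
  have e : y - z = x - w := by rw [sub_eq_sub_iff_add_eq_add, h1, add_comm]
  refine ⟨h1.symm, ?_, h3.symm, ?_⟩
  · simp only
    rw [e]
    simp only [dot, Prod.fst_sub, Prod.snd_sub] at h2 ⊢
    linear_combination -h2
  · intro h
    rw [show y = z from h, sub_self] at e
    exact h4 (sub_eq_zero.1 e.symm)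

theorem IsRectangle.flip {x y z w : Pt} (h : IsRectangle (x, y, z, w)) :
    IsRectangle (w, z, y, x) := by
  obtain ⟨h1, h2, h3, h4⟩ := h
  simp only at h1 h2 h3 h4
  have e : w - z = x - y := by
    rw [sub_eq_sub_iff_add_eq_add, h1, add_comm]
  refine ⟨by simp only; rw [add_comm, ← h1, add_comm], ?_, ?_, h4.symm⟩
  · simp only
    rw [e]
    simp only [dot, Prod.fst_sub, Prod.snd_sub] at h2 ⊢
    linear_combination -h2
  · intro h
    rw [show w = z from h, sub_self] at e
    exact h3 (sub_eq_zero.1 e.symm)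

theorem cellSum_swap (h₁ : ∀ x d, c₁ x (-d) ↔ c₁ x d) (h₂ : ∀ x d, c₂ x (-d) ↔ c₂ x d)
    (h₃ : ∀ x d, c₃ x (-d) ↔ c₃ x d) (h₄ : ∀ x d, c₄ x (-d) ↔ c₄ x d) :
    cellSum A c₁ c₂ c₃ c₄ = cellSum A c₂ c₁ c₄ c₃ := by
  refine Finset.sum_nbij' (fun q => (q.2.1, q.1, q.2.2.2, q.2.2.1))
    (fun q => (q.2.1, q.1, q.2.2.2, q.2.2.1)) ?_ ?_ (fun _ _ => rfl) (fun _ _ => rfl) ?_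
  · rintro ⟨x, y, z, w⟩ hq
    rw [mem_rectCell] at hq ⊢
    obtain ⟨⟨a1, a2, a3, a4⟩, hr, b1, b2, b3, b4⟩ := hq
    refine ⟨⟨a2, a1, a4, a3⟩, hr.swap, ?_⟩
    simp only at b1 b2 b3 b4 ⊢
    rw [← neg_sub x y, dir_neg, h₁, h₂, h₃, h₄]
    exact ⟨b2, b1, b4, b3⟩
  · rintro ⟨x, y, z, w⟩ hq
    rw [mem_rectCell] at hq ⊢
    obtain ⟨⟨a1, a2, a3, a4⟩, hr, b1, b2, b3, b4⟩ := hq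
    refine ⟨⟨a2, a1, a4, a3⟩, hr.swap, ?_⟩
    simp only at b1 b2 b3 b4 ⊢
    rw [← neg_sub x y, dir_neg, h₁, h₂, h₃, h₄]
    exact ⟨b2, b1, b4, b3⟩
  · rintro ⟨x, y, z, w⟩ -
    simp only
    rw [← neg_sub x y, gcdP_neg]

theorem mem_rectCell_flip {x y z w : Pt} (hq : (x, y, z, w) ∈ rectCell A c₁ c₂ c₃ c₄) :
    (w, z, y, x) ∈ rectCell A c₄ c₃ c₂ c₁ := by
  rw [mem_rectCell] at hq ⊢
  obtain ⟨⟨a1, a2, a3, a4⟩, hr, b1, b2, b3, b4⟩ := hq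
  have e : w - z = x - y := by
    have := hr.1
    simp only at this
    rw [sub_eq_sub_iff_add_eq_add, this, add_comm]
  refine ⟨⟨a4, a3, a2, a1⟩, hr.flip, ?_⟩
  simp only at b1 b2 b3 b4 ⊢
  rw [e]
  exact ⟨b4, b3, b2, b1⟩

theorem cellSum_flip : cellSum A c₁ c₂ c₃ c₄ = cellSum A c₄ c₃ c₂ c₁ := by
  refine Finset.sum_nbij' (fun q => (q.2.2.2, q.2.2.1, q.2.1, q.1))
    (fun q => (q.2.2.2, q.2.2.1, q.2.1, q.1)) ?_ ?_ (fun _ _ => rfl) (fun _ _ => rfl) ?_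
  · rintro ⟨x, y, z, w⟩ hq
    exact mem_rectCell_flip hq
  · rintro ⟨x, y, z, w⟩ hq
    exact mem_rectCell_flip hq
  · rintro ⟨x, y, z, w⟩ hq
    have := (mem_rectCell.1 hq).2.1.1
    simp only at this ⊢
    rw [show w - z = x - y by rw [sub_eq_sub_iff_add_eq_add, this, add_comm]]

/-- A bound for the number of points satisfying `c` with respect to some direction. -/
def VertexBound (A : Finset Pt) (c : Pt → Pt → Prop) (N : ℝ) : Prop :=
  ∀ B : Finset Pt, (∀ x ∈ B, x ∈ A ∧ ∃ d, c x d) → (B.card : ℝ) ≤ N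

/-- A bound for the number of pairs of a point and a primitive direction satisfying `c`. -/
def PairBound (A : Finset Pt) (c : Pt → Pt → Prop) (N : ℝ) : Prop :=
  ∀ I : Finset (Pt × Pt), (∀ p ∈ I, p.1 ∈ A ∧ gcdP p.2 = 1 ∧ c p.1 p.2) → (I.card : ℝ) ≤ N

/-- A bound for the number of points satisfying `c` with respect to `d` on any line parallel
or perpendicular to `d`. -/
def LineBound (A : Finset Pt) (c : Pt → Pt → Prop) (N : ℝ) : Prop :=
  ∀ (x d e : Pt) (B : Finset Pt), (e = d ∨ e = rot d) →
    (∀ y ∈ B, y ∈ A ∧ c y d ∧ det e (y - x) = 0) → (B.card : ℝ) ≤ N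

theorem LineBound.nonneg {c : Pt → Pt → Prop} {N : ℝ} (h : LineBound A c N) : 0 ≤ N := by
  simpa using h 0 0 0 ∅ (Or.inl rfl) (by simp)

theorem VertexBound.nonneg {c : Pt → Pt → Prop} {N : ℝ} (h : VertexBound A c N) : 0 ≤ N := by
  simpa using h ∅ (by simp)

theorem IsRectangle.det_side {q : Pt × Pt × Pt × Pt} (h : IsRectangle q) :
    det (dir (q.1 - q.2.1)) (q.2.1 - q.1) = 0 := by
  rw [det_dir_iff (sub_ne_zero.2 h.2.2.1)]
  simp only [det, Prod.fst_sub, Prod.snd_sub]; ring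

theorem IsRectangle.det_rot_side {q : Pt × Pt × Pt × Pt} (h : IsRectangle q) :
    det (rot (dir (q.1 - q.2.1))) (q.2.2.2 - q.1) = 0 := by
  rw [det_rot_dir_iff (sub_ne_zero.2 h.2.2.1)]
  have := h.2.1
  simp only [dot, Prod.fst_sub, Prod.snd_sub] at this ⊢
  linear_combination -this

theorem IsRectangle.det_rot_side' {q : Pt × Pt × Pt × Pt} (h : IsRectangle q) :
    det (rot (dir (q.1 - q.2.1))) (q.2.2.1 - q.2.1) = 0 := by
  have e : q.2.2.1 - q.2.1 = q.2.2.2 - q.1 := by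
    rw [sub_eq_sub_iff_add_eq_add, add_comm, h.1, add_comm]
  rw [e, h.det_rot_side]

theorem IsRectangle.eq_of_eq {q q' : Pt × Pt × Pt × Pt} (h : IsRectangle q) (h' : IsRectangle q')
    (h1 : q.1 = q'.1) (h2 : q.2.1 = q'.2.1) (h3 : q.2.2.1 = q'.2.2.1) : q = q' := by
  have e : q.2.2.2 = q'.2.2.2 := by
    have e1 := h.1
    rw [h1, h2, h3, h'.1] at e1
    exact (add_left_cancel e1).symm
  exact Prod.ext h1 (Prod.ext h2 (Prod.ext h3 e))

theorem IsRectangle.eq_of_eq' {q q' : Pt × Pt × Pt × Pt} (h : IsRectangle q) (h' : IsRectangle q')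
    (h1 : q.1 = q'.1) (h2 : q.2.1 = q'.2.1) (h3 : q.2.2.2 = q'.2.2.2) : q = q' := by
  refine h.eq_of_eq h' h1 h2 ?_
  have e1 := h.1
  rw [h1, h2, h3, ← h'.1] at e1
  exact add_left_cancel e1

theorem cellSum_le_pair {B₁ n₂ n₃ : ℝ} (h₁ : PairBound A c₁ B₁) (h₂ : LineBound A c₂ n₂)
    (h₃ : LineBound A c₃ n₃) : cellSum A c₁ c₂ c₃ c₄ ≤ B₁ * (√(2 * n₂) * n₃) := by
  classical
  set s := rectCell A c₁ c₂ c₃ c₄ with hs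
  have hs' : ∀ q ∈ s, IsRectangle q := fun q hq => (mem_rectCell.1 hq).2.1
  refine (sum_le_card_image_mul (s := s) (f := fun q => (q.1, dir (q.1 - q.2.1)))
    (K := √(2 * n₂) * n₃) ?_).trans (mul_le_mul_of_nonneg_right (h₁ _ ?_)
      (mul_nonneg (Real.sqrt_nonneg _) h₃.nonneg))
  · rintro ⟨x, d⟩ hb
    have hd : gcdP d = 1 := by
      obtain ⟨q, hq, he⟩ := Finset.mem_image.1 hb
      rw [← (Prod.mk.inj he).2, gcdP_dir (sub_ne_zero.2 (hs' q hq).2.2.1)]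
    set t := s.filter fun q => (q.1, dir (q.1 - q.2.1)) = (x, d) with ht
    have ht' : ∀ q ∈ t, q ∈ s ∧ q.1 = x ∧ dir (q.1 - q.2.1) = d := fun q hq => by
      obtain ⟨h1, h2⟩ := Finset.mem_filter.1 hq
      exact ⟨h1, Prod.mk.inj h2⟩
    rw [← Finset.sum_fiberwise_of_maps_to (fun q hq => Finset.mem_image_of_mem (fun q => q.2.1) hq)]
    set Y := t.image fun q => q.2.1 with hY
    have hYg : ∀ y ∈ Y, (gcdP (x - y) : ℤ) • d = x - y := by
      intro y hy
      obtain ⟨q, hq, rfl⟩ := Finset.mem_image.1 hy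
      obtain ⟨h1, h2, h3⟩ := ht' q hq
      rw [← h3, h2, smul_dir]
    have hY2 : (Y.card : ℝ) ≤ n₂ := by
      refine h₂ x d d Y (Or.inl rfl) fun y hy => ?_
      obtain ⟨q, hq, rfl⟩ := Finset.mem_image.1 hy
      obtain ⟨h1, h2, h3⟩ := ht' q hq
      have h4 := mem_rectCell.1 h1
      rw [h3] at h4
      have h5 := (hs' q h1).det_side
      rw [h3, h2] at h5
      exact ⟨h4.1.2.1, h4.2.2.2.1, h5⟩
    have hsum : ∀ y ∈ Y, ∑ q ∈ t.filter (fun q => q.2.1 = y), 1 / (gcdP (q.1 - q.2.1) : ℝ) ≤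
        1 / (gcdP (x - y) : ℝ) * n₃ := by
      intro y hy
      have hc : ((t.filter fun q => q.2.1 = y).card : ℝ) ≤ n₃ := by
        rw [← Finset.card_image_of_injOn (f := fun q => q.2.2.1)]
        · refine h₃ y d (rot d) _ (Or.inr rfl) fun z hz => ?_
          obtain ⟨q, hq, rfl⟩ := Finset.mem_image.1 hz
          obtain ⟨hqt, rfl⟩ := Finset.mem_filter.1 hq
          obtain ⟨h1, h2, h3⟩ := ht' q hqt
          have h4 := mem_rectCell.1 h1
          have h5 := (hs' q h1).det_rot_side'
          rw [h3] at h4 h5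
          exact ⟨h4.1.2.2.1, h4.2.2.2.2.1, h5⟩
        · intro q hq q' hq' he
          obtain ⟨hq, h6⟩ := Finset.mem_filter.1 (Finset.mem_coe.1 hq)
          obtain ⟨hq', h6'⟩ := Finset.mem_filter.1 (Finset.mem_coe.1 hq')
          obtain ⟨h1, h2, h3⟩ := ht' q hq
          obtain ⟨h1', h2', h3'⟩ := ht' q' hq'
          exact (hs' q h1).eq_of_eq (hs' q' h1') (h2.trans h2'.symm) (h6.trans h6'.symm) he
      rw [Finset.sum_congr rfl (g := fun _ => 1 / (gcdP (x - y) : ℝ)), Finset.sum_const,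
        nsmul_eq_mul, mul_comm]
      · exact mul_le_mul_of_nonneg_left hc (by positivity)
      · intro q hq
        obtain ⟨hq, h6⟩ := Finset.mem_filter.1 hq
        rw [(ht' q hq).2.1, h6]
    refine (Finset.sum_le_sum hsum).trans ?_
    rw [← Finset.sum_mul]
    refine mul_le_mul_of_nonneg_right ?_ h₃.nonneg
    have hinj : Set.InjOn (fun y => gcdP (x - y)) (Y : Set Pt) := by
      intro y hy y' hy' he
      simp only at he
      have e1 := hYg y hy
      rw [he, hYg y' hy'] at e1
      exact (sub_right_injective e1).symm
    have := sum_inv_le_sqrt (G := Y.image fun y => gcdP (x - y)) (by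
      intro g hg
      obtain ⟨y, hy, rfl⟩ := Finset.mem_image.1 hg
      refine gcdP_pos (sub_ne_zero.2 ?_)
      obtain ⟨q, hq, rfl⟩ := Finset.mem_image.1 hy
      obtain ⟨h1, h2, h3⟩ := ht' q hq
      rw [← h2]
      exact (hs' q h1).2.2.1)
    rw [Finset.sum_image hinj, Finset.card_image_of_injOn hinj] at this
    exact this.trans (Real.sqrt_le_sqrt (by linarith))
  · intro p hp
    obtain ⟨q, hq, rfl⟩ := Finset.mem_image.1 hp
    have h4 := mem_rectCell.1 hq
    exact ⟨h4.1.1, gcdP_dir (sub_ne_zero.2 (hs' q hq).2.2.1), h4.2.2.1⟩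

theorem cellSum_le_card_mul {α : Type*} [DecidableEq α] (f : Pt × Pt × Pt × Pt → α) {K : ℝ}
    (h : ∀ q₀ ∈ rectCell A c₁ c₂ c₃ c₄,
      (((rectCell A c₁ c₂ c₃ c₄).filter fun q => f q = f q₀).card : ℝ) ≤ K) :
    cellSum A c₁ c₂ c₃ c₄ ≤ ((rectCell A c₁ c₂ c₃ c₄).image f).card * K := by
  refine sum_le_card_image_mul fun b hb => ?_
  obtain ⟨q₀, hq₀, rfl⟩ := Finset.mem_image.1 hb
  refine le_trans ?_ (h q₀ hq₀)
  rw [← nsmul_one]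
  refine Finset.sum_le_card_nsmul _ _ _ fun q hq => ?_
  have := gcdP_pos (sub_ne_zero.2 (mem_rectCell.1 (Finset.mem_filter.1 hq).1).2.1.2.2.1)
  rw [div_le_one (by exact_mod_cast this)]
  exact_mod_cast this

theorem card_image_pair_le {α : Type*} {s : Finset α} {f g : α → Pt} {N₁ N₂ : ℝ}
    {c c' : Pt → Pt → Prop} (h₁ : VertexBound A c N₁) (h₂ : VertexBound A c' N₂)
    (h : ∀ q ∈ s, (f q ∈ A ∧ ∃ d, c (f q) d) ∧ (g q ∈ A ∧ ∃ d, c' (g q) d)) :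
    ((s.image fun q => (f q, g q)).card : ℝ) ≤ N₁ * N₂ := by
  classical
  have e1 : ((s.image f).card : ℝ) ≤ N₁ := h₁ _ fun x hx => by
    obtain ⟨q, hq, rfl⟩ := Finset.mem_image.1 hx
    exact (h q hq).1
  have e2 : ((s.image g).card : ℝ) ≤ N₂ := h₂ _ fun x hx => by
    obtain ⟨q, hq, rfl⟩ := Finset.mem_image.1 hx
    exact (h q hq).2
  calc ((s.image fun q => (f q, g q)).card : ℝ) ≤ ((s.image f ×ˢ s.image g).card : ℝ) := by
        refine Nat.cast_le.2 (Finset.card_le_card fun p hp => ?_)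
        obtain ⟨q, hq, rfl⟩ := Finset.mem_image.1 hp
        exact Finset.mem_product.2 ⟨Finset.mem_image_of_mem f hq, Finset.mem_image_of_mem g hq⟩
    _ = (s.image f).card * (s.image g).card := by rw [Finset.card_product, Nat.cast_mul]
    _ ≤ _ := mul_le_mul e1 e2 (Nat.cast_nonneg _) h₁.nonneg

theorem cellSum_le_adjacent {N₁ N₂ n₄ : ℝ} (h₁ : VertexBound A c₁ N₁) (h₂ : VertexBound A c₂ N₂)
    (h₄ : LineBound A c₄ n₄) : cellSum A c₁ c₂ c₃ c₄ ≤ N₁ * N₂ * n₄ := by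
  classical
  refine (cellSum_le_card_mul (fun q => (q.1, q.2.1)) (K := n₄) fun q₀ hq₀ => ?_).trans
    (mul_le_mul_of_nonneg_right (card_image_pair_le h₁ h₂ fun q hq => ?_) h₄.nonneg)
  · rw [← Finset.card_image_of_injOn (f := fun q => q.2.2.2)]
    · refine h₄ q₀.1 (dir (q₀.1 - q₀.2.1)) _ _ (Or.inr rfl) fun w hw => ?_
      obtain ⟨q, hq, rfl⟩ := Finset.mem_image.1 hw
      obtain ⟨hq, he⟩ := Finset.mem_filter.1 hq
      obtain ⟨e1, e2⟩ := Prod.mk.inj he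
      have h4 := mem_rectCell.1 hq
      have h5 := h4.2.1.det_rot_side
      rw [e1, e2] at h4 h5
      exact ⟨h4.1.2.2.2, h4.2.2.2.2.2, h5⟩
    · intro q hq q' hq' he
      obtain ⟨hq, h6⟩ := Finset.mem_filter.1 (Finset.mem_coe.1 hq)
      obtain ⟨hq', h6'⟩ := Finset.mem_filter.1 (Finset.mem_coe.1 hq')
      obtain ⟨e1, e2⟩ := Prod.mk.inj (h6.trans h6'.symm)
      exact (mem_rectCell.1 hq).2.1.eq_of_eq' (mem_rectCell.1 hq').2.1 e1 e2 he
  · have h4 := mem_rectCell.1 hq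
    exact ⟨⟨h4.1.1, _, h4.2.2.1⟩, h4.1.2.1, _, h4.2.2.2.1⟩

theorem cellSum_le_adjacent' {N₁ N₄ n₂ : ℝ} (h₂' : ∀ x d, c₂ x (-d) ↔ c₂ x d)
    (h₁ : VertexBound A c₁ N₁) (h₄ : VertexBound A c₄ N₄)
    (h₂ : LineBound A c₂ n₂) : cellSum A c₁ c₂ c₃ c₄ ≤ N₁ * N₄ * n₂ := by
  classical
  refine (cellSum_le_card_mul (fun q => (q.1, q.2.2.2)) (K := n₂) fun q₀ hq₀ => ?_).trans
    (mul_le_mul_of_nonneg_right (card_image_pair_le h₁ h₄ fun q hq => ?_) h₂.nonneg)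
  · rw [← Finset.card_image_of_injOn (f := fun q => q.2.1)]
    · refine h₂ q₀.1 (dir (q₀.1 - q₀.2.1)) _ _ (Or.inl rfl) fun y hy => ?_
      obtain ⟨q, hq, rfl⟩ := Finset.mem_image.1 hy
      obtain ⟨hq, he⟩ := Finset.mem_filter.1 hq
      obtain ⟨e1, e2⟩ := Prod.mk.inj he
      have h4 := mem_rectCell.1 hq
      have hz := mem_rectCell.1 hq₀
      have n1 := sub_ne_zero.2 h4.2.1.2.2.1
      have n0 := sub_ne_zero.2 hz.2.1.2.2.1
      have h5 := h4.2.1.det_side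
      have p1 := h4.2.1.det_rot_side
      have p0 := hz.2.1.det_rot_side
      rw [show q.2.2.2 - q.1 = q₀.2.2.2 - q₀.1 by rw [e1, e2]] at p1
      have p2 := det_trans (sub_ne_zero.2 hz.2.1.2.2.2.symm) p0 (det_comm_eq_zero.1 p1)
      rw [det_rot_rot] at p2
      rcases eq_or_eq_neg_of_det_eq_zero (gcdP_dir n0) (gcdP_dir n1) p2 with h | h
      · rw [h] at h5 h4
        rw [e1] at h5
        exact ⟨h4.1.2.1, h4.2.2.2.1, h5⟩
      · rw [h, h₂'] at h4
        rw [h, det_neg_left, neg_eq_zero, e1] at h5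
        exact ⟨h4.1.2.1, h4.2.2.2.1, h5⟩
    · intro q hq q' hq' he
      obtain ⟨hq, h6⟩ := Finset.mem_filter.1 (Finset.mem_coe.1 hq)
      obtain ⟨hq', h6'⟩ := Finset.mem_filter.1 (Finset.mem_coe.1 hq')
      obtain ⟨e1, e2⟩ := Prod.mk.inj (h6.trans h6'.symm)
      exact (mem_rectCell.1 hq).2.1.eq_of_eq' (mem_rectCell.1 hq').2.1 e1 he e2
  · have h4 := mem_rectCell.1 hq
    exact ⟨⟨h4.1.1, _, h4.2.2.1⟩, h4.1.2.2.2, _, h4.2.2.2.2.2⟩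

end CellSums

section CellBounds

variable {A : Finset Pt} {lev : Pt → ℕ} {C : ℕ}

/-- The points of level `j` that are big with respect to the direction. -/
def BigAt (A : Finset Pt) (lev : Pt → ℕ) (C j : ℕ) (x d : Pt) : Prop :=
  lev x = j ∧ IsBig A lev C x d

/-- The points of level `j` that are not big with respect to the direction. -/
def SmallAt (A : Finset Pt) (lev : Pt → ℕ) (C j : ℕ) (x d : Pt) : Prop :=
  lev x = j ∧ ¬IsBig A lev C x d

/-- The points of level `j` that are not big and have dyadic richness `a`. -/
def TagAt (A : Finset Pt) (lev : Pt → ℕ) (C j a : ℕ) (x d : Pt) : Prop :=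
  lev x = j ∧ ¬IsBig A lev C x d ∧ Nat.log 2 (crossRichness A lev x d) = a

theorem tagAt_neg (j a : ℕ) (x d : Pt) : TagAt A lev C j a x (-d) ↔ TagAt A lev C j a x d := by
  rw [TagAt, isBig_neg, crossRichness_neg, TagAt]

theorem richness_le_crossRichness {y d e : Pt} (he : e = d ∨ e = rot d) :
    richness A lev y e ≤ crossRichness A lev y d := by
  rcases he with rfl | rfl
  · exact le_max_left _ _
  · exact le_max_right _ _

theorem smallAt_lineBound (j : ℕ) :
    LineBound A (SmallAt A lev C j) (2 ^ ((j : ℝ) / 2 + C)) := by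
  intro x d e B he h
  refine card_fiber_le_crossRichness (A := A) (lev := lev) (x := x) (d := e) (j := j)
    (by positivity) fun y hy => ?_
  obtain ⟨h1, ⟨h2, h3⟩, h4⟩ := h y hy
  refine ⟨h1, h2, h4, ?_⟩
  rw [IsBig, h2, not_le] at h3
  exact le_trans (Nat.cast_le.2 (richness_le_crossRichness he)) h3.le

theorem tagAt_lineBound (j a : ℕ) :
    LineBound A (TagAt A lev C j a) (2 ^ ((a : ℝ) + 1)) := by
  intro x d e B he h
  refine card_fiber_le_crossRichness (A := A) (lev := lev) (x := x) (d := e) (j := j)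
    (by positivity) fun y hy => ?_
  obtain ⟨h1, ⟨h2, h3, h5⟩, h4⟩ := h y hy
  refine ⟨h1, h2, h4, ?_⟩
  have := Nat.lt_pow_succ_log_self (b := 2) (by norm_num) (crossRichness A lev y d)
  rw [h5] at this
  have h6 := (richness_le_crossRichness (A := A) (lev := lev) (y := y) he).trans this.le
  have h7 : (2 : ℝ) ^ ((a : ℝ) + 1) = ((2 ^ (a + 1) : ℕ) : ℝ) := by
    push_cast
    rw [← Real.rpow_natCast]; push_cast; rfl
  rw [h7]
  exact Nat.cast_le.2 h6

theorem vertexBound_of_lev (hA : ∀ j, (A.filter fun x => lev x = j).card ≤ 2 ^ j) {j : ℕ}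
    {c : Pt → Pt → Prop} (hc : ∀ x d, c x d → lev x = j) : VertexBound A c (2 ^ (j : ℝ)) := by
  intro B hB
  rw [Real.rpow_natCast]
  have : B.card ≤ 2 ^ j := (Finset.card_le_card fun x hx => Finset.mem_filter.2
    ⟨(hB x hx).1, (hB x hx).2.elim fun d hd => hc x d hd⟩).trans (hA j)
  exact_mod_cast this

theorem bigAt_pairBound (hA : ∀ j, (A.filter fun x => lev x = j).card ≤ 2 ^ j)
    (hu : UniqueRich A lev C) (j : ℕ) : PairBound A (BigAt A lev C j) (4 * 2 ^ (j : ℝ)) :=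
  fun _ hI => card_big_le hA hu hI

theorem tagAt_pairBound (hA : ∀ j, (A.filter fun x => lev x = j).card ≤ 2 ^ j) (j : ℕ) {a : ℕ}
    (ha : 1 ≤ a) : PairBound A (TagAt A lev C j a)
      ((18432 + 192 * 4 ^ C) * 2 ^ (2 * (j : ℝ) - 2 * a)) :=
  fun _ hI => card_medium_le (C := C) hA ha hI

theorem cellSum_big_small_le (hA : ∀ j, (A.filter fun x => lev x = j).card ≤ 2 ^ j)
    (hu : UniqueRich A lev C) (j₁ j₂ j₃ j₄ : ℕ) :
    cellSum A (BigAt A lev C j₁) (SmallAt A lev C j₂) (SmallAt A lev C j₃) (BigAt A lev C j₄) ≤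
      8 * 4 ^ C * 2 ^ ((j₁ : ℝ) + j₂ / 4 + j₃ / 2) := by
  refine (cellSum_le_pair (bigAt_pairBound hA hu j₁) (smallAt_lineBound j₂)
    (smallAt_lineBound j₃)).trans ?_
  have e1 : √(2 * 2 ^ ((j₂ : ℝ) / 2 + C)) = 2 ^ ((j₂ : ℝ) / 4 + C / 2 + 1 / 2) := by
    rw [Real.sqrt_eq_rpow, ← Real.rpow_one_add' (by norm_num) (by positivity),
      ← Real.rpow_mul (by norm_num)]
    ring_nf
  have e2 : (4 : ℝ) = 2 ^ (2 : ℝ) := by norm_num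
  have e3 : (8 : ℝ) = 2 ^ (3 : ℝ) := by norm_num
  rw [e1, e3, e2, ← Real.rpow_natCast, ← Real.rpow_mul (by norm_num),
    ← Real.rpow_add (by norm_num), ← Real.rpow_add (by norm_num), ← Real.rpow_add (by norm_num),
    ← Real.rpow_add (by norm_num), ← Real.rpow_add (by norm_num)]
  refine Real.rpow_le_rpow_of_exponent_le (by norm_num) ?_
  have : (0 : ℝ) ≤ C := Nat.cast_nonneg _
  linarith

theorem big_small_exponent {a b c d : ℝ} (hb : 0 ≤ b) (hc : 0 ≤ c) :
    a + b / 4 + c / 2 ≤ (a + b + c + d) / 2 - 1 / 32 * (|a - d| + |b - c|) ∨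
    d + c / 4 + b / 2 ≤ (a + b + c + d) / 2 - 1 / 32 * (|a - d| + |b - c|) := by
  by_contra! h
  obtain ⟨h1, h2⟩ := h
  rcases abs_cases (a - d) with ⟨e1, _⟩ | ⟨e1, _⟩ <;>
    rcases abs_cases (b - c) with ⟨e2, _⟩ | ⟨e2, _⟩ <;>
    rw [e1, e2] at h1 h2 <;> linarith

theorem cellSum_big_small_le' (hA : ∀ j, (A.filter fun x => lev x = j).card ≤ 2 ^ j)
    (hu : UniqueRich A lev C) (j₁ j₂ j₃ j₄ : ℕ) :
    cellSum A (BigAt A lev C j₁) (SmallAt A lev C j₂) (SmallAt A lev C j₃) (BigAt A lev C j₄) ≤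
      8 * 4 ^ C * 2 ^ (((j₁ : ℝ) + j₂ + j₃ + j₄) / 2 -
        1 / 32 * (|(j₁ : ℝ) - j₄| + |(j₂ : ℝ) - j₃|)) := by
  rcases big_small_exponent (a := j₁) (d := j₄) (Nat.cast_nonneg (α := ℝ) j₂)
    (Nat.cast_nonneg (α := ℝ) j₃) with h | h
  · refine (cellSum_big_small_le hA hu j₁ j₂ j₃ j₄).trans ?_
    gcongr
    norm_num
  · rw [cellSum_flip]
    refine (cellSum_big_small_le hA hu j₄ j₃ j₂ j₁).trans ?_
    gcongr
    norm_num

/-- The weighted number of rectangles without big vertices and with prescribed levels and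
richnesses. -/
def tagSum (A : Finset Pt) (lev : Pt → ℕ) (C : ℕ) (p₁ p₂ p₃ p₄ : ℕ × ℕ) : ℝ :=
  cellSum A (TagAt A lev C p₁.1 p₁.2) (TagAt A lev C p₂.1 p₂.2) (TagAt A lev C p₃.1 p₃.2)
    (TagAt A lev C p₄.1 p₄.2)

theorem tagSum_swap (p₁ p₂ p₃ p₄ : ℕ × ℕ) :
    tagSum A lev C p₁ p₂ p₃ p₄ = tagSum A lev C p₂ p₁ p₄ p₃ :=
  cellSum_swap (tagAt_neg _ _) (tagAt_neg _ _) (tagAt_neg _ _) (tagAt_neg _ _)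

theorem tagSum_flip (p₁ p₂ p₃ p₄ : ℕ × ℕ) :
    tagSum A lev C p₁ p₂ p₃ p₄ = tagSum A lev C p₄ p₃ p₂ p₁ := cellSum_flip

theorem tagSum_le_pair (hA : ∀ j, (A.filter fun x => lev x = j).card ≤ 2 ^ j)
    {p₁ p₂ p₃ p₄ : ℕ × ℕ} (h : 1 ≤ p₁.2) {t : ℝ}
    (ht : 2 * (p₁.1 : ℝ) - 2 * p₁.2 + p₂.2 / 2 + p₃.2 ≤ t) :
    tagSum A lev C p₁ p₂ p₃ p₄ ≤ 4 * (18432 + 192 * 4 ^ C) * 2 ^ t := by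
  refine (cellSum_le_pair (tagAt_pairBound hA p₁.1 h) (tagAt_lineBound _ _)
    (tagAt_lineBound _ _)).trans ?_
  have e1 : √(2 * 2 ^ ((p₂.2 : ℝ) + 1)) = 2 ^ ((p₂.2 : ℝ) / 2 + 1) := by
    rw [Real.sqrt_eq_rpow, ← Real.rpow_one_add' (by norm_num) (by positivity),
      ← Real.rpow_mul (by norm_num)]
    ring_nf
  have e2 : 4 * (18432 + 192 * (4 : ℝ) ^ C) * 2 ^ t = (18432 + 192 * 4 ^ C) * 2 ^ (2 + t) := by
    rw [Real.rpow_add (by norm_num)]; norm_num; ring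
  rw [e2, e1, mul_comm, mul_left_comm]
  refine mul_le_mul_of_nonneg_left ?_ (by positivity)
  rw [← Real.rpow_add (by norm_num), ← Real.rpow_add (by norm_num)]
  exact Real.rpow_le_rpow_of_exponent_le (by norm_num) (by linarith)

theorem tagSum_le_adjacent (hA : ∀ j, (A.filter fun x => lev x = j).card ≤ 2 ^ j)
    {p₁ p₂ p₃ p₄ : ℕ × ℕ} {t : ℝ} (ht : (p₁.1 : ℝ) + p₂.1 + p₄.2 ≤ t) :
    tagSum A lev C p₁ p₂ p₃ p₄ ≤ 4 * (18432 + 192 * 4 ^ C) * 2 ^ t := by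
  refine (cellSum_le_adjacent (vertexBound_of_lev hA fun _ _ h => h.1)
    (vertexBound_of_lev hA fun _ _ h => h.1) (tagAt_lineBound _ _)).trans ?_
  calc (2 : ℝ) ^ (p₁.1 : ℝ) * 2 ^ (p₂.1 : ℝ) * 2 ^ ((p₄.2 : ℝ) + 1)
      = 2 * 2 ^ ((p₁.1 : ℝ) + p₂.1 + p₄.2) := by
        rw [← Real.rpow_add (by norm_num), ← Real.rpow_add (by norm_num), ← add_assoc,
          Real.rpow_add_one (by norm_num), mul_comm]
    _ ≤ 4 * (18432 + 192 * 4 ^ C) * 2 ^ t := by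
        gcongr
        · have : (0 : ℝ) < 4 ^ C := by positivity
          linarith
        · norm_num

theorem tagSum_le_adjacent' (hA : ∀ j, (A.filter fun x => lev x = j).card ≤ 2 ^ j)
    {p₁ p₂ p₃ p₄ : ℕ × ℕ} {t : ℝ} (ht : (p₁.1 : ℝ) + p₄.1 + p₂.2 ≤ t) :
    tagSum A lev C p₁ p₂ p₃ p₄ ≤ 4 * (18432 + 192 * 4 ^ C) * 2 ^ t := by
  refine (cellSum_le_adjacent' (tagAt_neg _ _) (vertexBound_of_lev hA fun _ _ h => h.1)
    (vertexBound_of_lev hA fun _ _ h => h.1) (tagAt_lineBound _ _)).trans ?_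
  calc (2 : ℝ) ^ (p₁.1 : ℝ) * 2 ^ (p₄.1 : ℝ) * 2 ^ ((p₂.2 : ℝ) + 1)
      = 2 * 2 ^ ((p₁.1 : ℝ) + p₄.1 + p₂.2) := by
        rw [← Real.rpow_add (by norm_num), ← Real.rpow_add (by norm_num), ← add_assoc,
          Real.rpow_add_one (by norm_num), mul_comm]
    _ ≤ 4 * (18432 + 192 * 4 ^ C) * 2 ^ t := by
        gcongr
        · have : (0 : ℝ) < 4 ^ C := by positivity
          linarith
        · norm_num

theorem exponent_all_medium {a b c d α β γ δ : ℝ} (hα : 0 ≤ α) (hβ : 0 ≤ β) (hγ : 0 ≤ γ)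
    (hδ : 0 ≤ δ) {t : ℝ}
    (ht : t = (a + b + c + d) / 2 - 1 / 32 * (|a - d| + |b - c| + (α + β + γ + δ))) :
    2 * a - 2 * α + β / 2 + γ ≤ t ∨ 2 * b - 2 * β + α / 2 + δ ≤ t ∨
    2 * c - 2 * γ + δ / 2 + α ≤ t ∨ 2 * d - 2 * δ + γ / 2 + β ≤ t := by
  by_contra! h
  obtain ⟨h1, h2, h3, h4⟩ := h
  rcases abs_cases (a - d) with ⟨e1, _⟩ | ⟨e1, _⟩ <;>
    rcases abs_cases (b - c) with ⟨e2, _⟩ | ⟨e2, _⟩ <;>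
    rw [e1, e2] at ht <;> linarith

theorem exponent_half_medium {a b c d β γ : ℝ} (hβ : 0 ≤ β) (hγ : 0 ≤ γ) {t : ℝ}
    (ht : t = (a + b + c + d) / 2 - 1 / 32 * (|a - d| + |b - c| + (β + γ))) :
    a + b ≤ t ∨ d + c ≤ t ∨ a + d + β ≤ t ∨ d + a + γ ≤ t ∨
      2 * b - 2 * β ≤ t ∨ 2 * c - 2 * γ ≤ t := by
  by_contra! h
  obtain ⟨h1, h2, h3, h4, h5, h6⟩ := h
  rcases abs_cases (a - d) with ⟨e1, _⟩ | ⟨e1, _⟩ <;>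
    rcases abs_cases (b - c) with ⟨e2, _⟩ | ⟨e2, _⟩ <;>
    rw [e1, e2] at ht <;> linarith

theorem exponent_generic {a b c d : ℝ} {t : ℝ}
    (ht : t = (a + b + c + d) / 2 - 1 / 32 * (|a - c| + |b - d|)) :
    a + b ≤ t ∨ d + c ≤ t ∨ a + d ≤ t ∨ b + c ≤ t := by
  by_contra! h
  obtain ⟨h1, h2, h3, h4⟩ := h
  rcases abs_cases (a - c) with ⟨e1, _⟩ | ⟨e1, _⟩ <;>
    rcases abs_cases (b - d) with ⟨e2, _⟩ | ⟨e2, _⟩ <;>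
    rw [e1, e2] at ht <;> linarith

theorem tagSum_le_of_half (hA : ∀ j, (A.filter fun x => lev x = j).card ≤ 2 ^ j)
    {p₁ p₂ p₃ p₄ : ℕ × ℕ} (h1 : p₁.2 = 0) (h4 : p₄.2 = 0) (h2 : 1 ≤ p₂.2) (h3 : 1 ≤ p₃.2) {t : ℝ}
    (ht : t = ((p₁.1 : ℝ) + p₂.1 + p₃.1 + p₄.1) / 2 - 1 / 32 * (|(p₁.1 : ℝ) - p₄.1| +
      |(p₂.1 : ℝ) - p₃.1| + ((p₂.2 : ℝ) + p₃.2))) :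
    tagSum A lev C p₁ p₂ p₃ p₄ ≤ 4 * (18432 + 192 * 4 ^ C) * 2 ^ t := by
  rcases exponent_half_medium (Nat.cast_nonneg (α := ℝ) p₂.2) (Nat.cast_nonneg (α := ℝ) p₃.2)
    ht with
    h | h | h | h | h | h
  · exact tagSum_le_adjacent hA (by rw [h4]; simpa using h)
  · rw [tagSum_flip]
    exact tagSum_le_adjacent hA (by rw [h1]; simpa using h)
  · exact tagSum_le_adjacent' hA h
  · rw [tagSum_flip]
    exact tagSum_le_adjacent' hA h
  · rw [tagSum_swap]
    exact tagSum_le_pair hA h2 (by rw [h1, h4]; simpa using h)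
  · rw [tagSum_flip, tagSum_swap]
    exact tagSum_le_pair hA h3 (by rw [h1, h4]; simpa using h)

/-- The power saving for a cell of rectangles without big vertices. -/
theorem tagSum_le (hA : ∀ j, (A.filter fun x => lev x = j).card ≤ 2 ^ j)
    {p₁ p₂ p₃ p₄ : ℕ × ℕ} (h14 : p₁.2 = 0 ↔ p₄.2 = 0) (h23 : p₂.2 = 0 ↔ p₃.2 = 0) :
    tagSum A lev C p₁ p₂ p₃ p₄ ≤ 4 * (18432 + 192 * 4 ^ C) *
      (2 ^ (((p₁.1 : ℝ) + p₂.1 + p₃.1 + p₄.1) / 2 - 1 / 32 * (|(p₁.1 : ℝ) - p₄.1| +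
        |(p₂.1 : ℝ) - p₃.1| + ((p₁.2 : ℝ) + p₂.2 + p₃.2 + p₄.2))) +
      2 ^ (((p₁.1 : ℝ) + p₂.1 + p₃.1 + p₄.1) / 2 - 1 / 32 * (|(p₁.1 : ℝ) - p₃.1| +
        |(p₂.1 : ℝ) - p₄.1| + ((p₁.2 : ℝ) + p₂.2 + p₃.2 + p₄.2)))) := by
  obtain ⟨t, ht⟩ : ∃ t : ℝ, t = ((p₁.1 : ℝ) + p₂.1 + p₃.1 + p₄.1) / 2 -
    1 / 32 * (|(p₁.1 : ℝ) - p₄.1| + |(p₂.1 : ℝ) - p₃.1| + ((p₁.2 : ℝ) + p₂.2 + p₃.2 + p₄.2)) :=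
    ⟨_, rfl⟩
  obtain ⟨s, hs⟩ : ∃ s : ℝ, s = ((p₁.1 : ℝ) + p₂.1 + p₃.1 + p₄.1) / 2 -
    1 / 32 * (|(p₁.1 : ℝ) - p₃.1| + |(p₂.1 : ℝ) - p₄.1| + ((p₁.2 : ℝ) + p₂.2 + p₃.2 + p₄.2)) :=
    ⟨_, rfl⟩
  rw [← ht, ← hs, mul_add]
  have hpos : ∀ r : ℝ, 0 ≤ 4 * (18432 + 192 * (4 : ℝ) ^ C) * 2 ^ r := fun r => by positivity
  have left : tagSum A lev C p₁ p₂ p₃ p₄ ≤ 4 * (18432 + 192 * 4 ^ C) * 2 ^ t →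
      tagSum A lev C p₁ p₂ p₃ p₄ ≤ 4 * (18432 + 192 * 4 ^ C) * 2 ^ t +
        4 * (18432 + 192 * 4 ^ C) * 2 ^ s := fun h => h.trans (le_add_of_nonneg_right (hpos s))
  have right : tagSum A lev C p₁ p₂ p₃ p₄ ≤ 4 * (18432 + 192 * 4 ^ C) * 2 ^ s →
      tagSum A lev C p₁ p₂ p₃ p₄ ≤ 4 * (18432 + 192 * 4 ^ C) * 2 ^ t +
        4 * (18432 + 192 * 4 ^ C) * 2 ^ s := fun h => h.trans (le_add_of_nonneg_left (hpos t))
  rcases Nat.eq_zero_or_pos p₁.2 with h1 | h1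
  · have h4 := h14.1 h1
    rcases Nat.eq_zero_or_pos p₂.2 with h2 | h2
    · have h3 := h23.1 h2
      apply right
      rw [h1, h2, h3, h4] at hs
      rcases exponent_generic (a := p₁.1) (b := p₂.1) (c := p₃.1) (d := p₄.1)
        (hs.trans (by simp)) with h | h | h | h
      · exact tagSum_le_adjacent hA (by rw [h4]; simpa using h)
      · rw [tagSum_flip]
        exact tagSum_le_adjacent hA (by rw [h1]; simpa using h)
      · exact tagSum_le_adjacent' hA (by rw [h2]; simpa using h)
      · rw [tagSum_swap]
        exact tagSum_le_adjacent' hA (by rw [h1]; simpa using h)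
    · have h3 : 1 ≤ p₃.2 := Nat.pos_of_ne_zero fun h => h2.ne' (h23.2 h)
      apply left
      refine tagSum_le_of_half hA h1 h4 h2 h3 ?_
      rw [ht, h1, h4]; simp
  · have h4 : 1 ≤ p₄.2 := Nat.pos_of_ne_zero fun h => h1.ne' (h14.2 h)
    apply left
    rcases Nat.eq_zero_or_pos p₂.2 with h2 | h2
    · have h3 := h23.1 h2
      rw [tagSum_swap]
      refine tagSum_le_of_half hA h2 h3 h1 h4 ?_
      rw [ht, h2, h3]; push_cast; ring
    · have h3 : 1 ≤ p₃.2 := Nat.pos_of_ne_zero fun h => h2.ne' (h23.2 h)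
      rcases exponent_all_medium (Nat.cast_nonneg (α := ℝ) p₁.2) (Nat.cast_nonneg (α := ℝ) p₂.2)
        (Nat.cast_nonneg (α := ℝ) p₃.2) (Nat.cast_nonneg (α := ℝ) p₄.2) ht with h | h | h | h
      · exact tagSum_le_pair hA h1 h
      · rw [tagSum_swap]
        exact tagSum_le_pair hA h2 h
      · rw [tagSum_flip, tagSum_swap]
        exact tagSum_le_pair hA h3 h
      · rw [tagSum_flip]
        exact tagSum_le_pair hA h4 h

end CellBounds

section TagSums

/-- The exponentially decaying weight `2 ^ (-r / 32)`. -/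
def decay (r : ℝ) : ℝ := 2 ^ (-(r / 32))

theorem decay_pos (r : ℝ) : 0 < decay r := Real.rpow_pos_of_pos (by norm_num) _

theorem decay_add (r s : ℝ) : decay (r + s) = decay r * decay s := by
  rw [decay, decay, decay, ← Real.rpow_add (by norm_num)]
  ring_nf

theorem decay_one_lt_one : decay 1 < 1 :=
  Real.rpow_lt_one_of_one_lt_of_neg (by norm_num) (by norm_num)

theorem decay_natCast (n : ℕ) : decay n = decay 1 ^ n := by
  rw [decay, decay, ← Real.rpow_natCast, ← Real.rpow_mul (by norm_num)]
  ring_nf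

/-- The sum of the decaying weights over the natural numbers. -/
def decaySum : ℝ := (1 - decay 1)⁻¹

theorem decaySum_pos : 0 < decaySum := inv_pos.2 (sub_pos.2 decay_one_lt_one)

theorem sum_range_decay_le (n : ℕ) : ∑ a ∈ Finset.range n, decay a ≤ decaySum := by
  simp only [decay_natCast]
  rw [decaySum, ← tsum_geometric_of_lt_one (decay_pos 1).le decay_one_lt_one]
  exact (summable_geometric_of_lt_one (decay_pos 1).le decay_one_lt_one).sum_le_tsum _
    fun _ _ => pow_nonneg (decay_pos 1).le _

theorem sum_range_decay_abs_le (i n : ℕ) :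
    ∑ j ∈ Finset.range n, decay |(i : ℝ) - j| ≤ 2 * decaySum := by
  calc ∑ j ∈ Finset.range n, decay |(i : ℝ) - j|
      ≤ ∑ j ∈ Finset.range (i + 1 + n), decay |(i : ℝ) - j| :=
        Finset.sum_le_sum_of_subset_of_nonneg
          (Finset.range_subset_range.2 (Nat.le_add_left _ _)) fun _ _ _ => (decay_pos _).le
    _ = ∑ j ∈ Finset.range (i + 1), decay j + ∑ j ∈ Finset.range n, decay ((j + 1 : ℕ) : ℝ) := by
        rw [Finset.sum_range_add, ← Finset.sum_range_reflect (fun j : ℕ => decay (j : ℝ))]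
        congr 1
        · refine Finset.sum_congr rfl fun j hj => ?_
          have hj' : j ≤ i := Nat.lt_succ_iff.1 (Finset.mem_range.1 hj)
          rw [Nat.add_sub_cancel, Nat.cast_sub hj',
            abs_of_nonneg (sub_nonneg.2 (Nat.cast_le.2 hj'))]
        · refine Finset.sum_congr rfl fun j _ => ?_
          rw [abs_sub_comm, abs_of_nonneg (by push_cast; linarith [Nat.cast_nonneg (α := ℝ) j])]
          push_cast
          ring_nf
    _ ≤ decaySum + decaySum := by
        refine add_le_add (sum_range_decay_le _) (le_trans ?_ (sum_range_decay_le (n + 1)))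
        rw [Finset.sum_range_succ']
        exact le_add_of_nonneg_right (decay_pos _).le
    _ = _ := by ring

/-- Schur's test for the kernel `decay |i - j|`. -/
theorem sum_mul_decay_le (lam : ℕ → ℝ) (n : ℕ) :
    ∑ i ∈ Finset.range n, ∑ j ∈ Finset.range n, lam i * lam j * decay |(i : ℝ) - j| ≤
      2 * decaySum * ∑ j ∈ Finset.range n, lam j ^ 2 := by
  have h1 : ∀ i ∈ Finset.range n, ∑ j ∈ Finset.range n, lam i ^ 2 * decay |(i : ℝ) - j| ≤
      lam i ^ 2 * (2 * decaySum) := fun i _ => by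
    rw [← Finset.mul_sum]
    exact mul_le_mul_of_nonneg_left (sum_range_decay_abs_le i n) (sq_nonneg _)
  have h2 := Finset.sum_le_sum h1
  rw [← Finset.sum_mul] at h2
  have h3 : ∑ i ∈ Finset.range n, ∑ j ∈ Finset.range n, lam j ^ 2 * decay |(i : ℝ) - j| =
      ∑ i ∈ Finset.range n, ∑ j ∈ Finset.range n, lam i ^ 2 * decay |(i : ℝ) - j| := by
    rw [Finset.sum_comm]
    simp only [abs_sub_comm]
  have h4 : ∑ i ∈ Finset.range n, ∑ j ∈ Finset.range n, lam i * lam j * decay |(i : ℝ) - j| ≤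
      ∑ i ∈ Finset.range n, ∑ j ∈ Finset.range n,
        (1 / 2 * (lam i ^ 2 * decay |(i : ℝ) - j|) + 1 / 2 * (lam j ^ 2 * decay |(i : ℝ) - j|)) :=
    Finset.sum_le_sum fun i _ => Finset.sum_le_sum fun j _ => by
      nlinarith [mul_nonneg (sq_nonneg (lam i - lam j)) (decay_pos |(i : ℝ) - j|).le]
  simp only [Finset.sum_add_distrib, ← Finset.mul_sum] at h4
  simp only [← Finset.mul_sum] at h2 h3
  linarith

/-- The kernel on pairs of a level and a richness arising from two tags. -/
def tagKernel (lam : ℕ → ℝ) (p p' : ℕ × ℕ) : ℝ :=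
  lam p.1 * decay p.2 * (lam p'.1 * decay p'.2) * decay |(p.1 : ℝ) - p'.1|

theorem sum_tagKernel_le (lam : ℕ → ℝ) (n N : ℕ) :
    ∑ p ∈ Finset.range n ×ˢ Finset.range N, ∑ p' ∈ Finset.range n ×ˢ Finset.range N,
      tagKernel lam p p' ≤ 2 * decaySum ^ 3 * ∑ j ∈ Finset.range n, lam j ^ 2 := by
  have h1 : ∑ p ∈ Finset.range n ×ˢ Finset.range N, ∑ p' ∈ Finset.range n ×ˢ Finset.range N,
      tagKernel lam p p' =
      (∑ i ∈ Finset.range n, ∑ j ∈ Finset.range n, lam i * lam j * decay |(i : ℝ) - j|) *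
        (∑ a ∈ Finset.range N, decay a) ^ 2 := by
    rw [Finset.sum_product, Finset.sum_mul]
    refine Finset.sum_congr rfl fun i _ => ?_
    simp only [Finset.sum_product]
    rw [Finset.sum_comm, Finset.sum_mul]
    refine Finset.sum_congr rfl fun j _ => ?_
    rw [sq, Finset.sum_mul_sum, Finset.mul_sum]
    refine Finset.sum_congr rfl fun a _ => ?_
    rw [Finset.mul_sum]
    refine Finset.sum_congr rfl fun b _ => ?_
    rw [tagKernel]; ring
  have h2 : 0 ≤ ∑ a ∈ Finset.range N, decay a := Finset.sum_nonneg fun _ _ => (decay_pos _).le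
  have h3 : (∑ a ∈ Finset.range N, decay a) ^ 2 ≤ decaySum ^ 2 :=
    pow_le_pow_left₀ h2 (sum_range_decay_le N) 2
  have h4 : 0 ≤ ∑ j ∈ Finset.range n, lam j ^ 2 := Finset.sum_nonneg fun _ _ => sq_nonneg _
  rw [h1]
  calc _ ≤ (2 * decaySum * ∑ j ∈ Finset.range n, lam j ^ 2) *
        (∑ a ∈ Finset.range N, decay a) ^ 2 :=
        mul_le_mul_of_nonneg_right (sum_mul_decay_le lam n) (sq_nonneg _)
    _ ≤ (2 * decaySum * ∑ j ∈ Finset.range n, lam j ^ 2) * decaySum ^ 2 :=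
        mul_le_mul_of_nonneg_left h3 (mul_nonneg (mul_nonneg (by norm_num) decaySum_pos.le) h4)
    _ = _ := by ring

theorem tagKernel_mul_tagKernel (lam : ℕ → ℝ) (p₁ p₂ p₃ p₄ : ℕ × ℕ) :
    lam p₁.1 * 2 ^ (-(p₁.1 : ℝ) / 2) * (lam p₂.1 * 2 ^ (-(p₂.1 : ℝ) / 2)) *
      (lam p₃.1 * 2 ^ (-(p₃.1 : ℝ) / 2)) * (lam p₄.1 * 2 ^ (-(p₄.1 : ℝ) / 2)) *
      2 ^ (((p₁.1 : ℝ) + p₂.1 + p₃.1 + p₄.1) / 2 - 1 / 32 * (|(p₁.1 : ℝ) - p₄.1| +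
        |(p₂.1 : ℝ) - p₃.1| + ((p₁.2 : ℝ) + p₂.2 + p₃.2 + p₄.2))) =
      tagKernel lam p₁ p₄ * tagKernel lam p₂ p₃ := by
  have h : (2 : ℝ) ^ (((p₁.1 : ℝ) + p₂.1 + p₃.1 + p₄.1) / 2 - 1 / 32 * (|(p₁.1 : ℝ) - p₄.1| +
        |(p₂.1 : ℝ) - p₃.1| + ((p₁.2 : ℝ) + p₂.2 + p₃.2 + p₄.2))) * 2 ^ (-(p₁.1 : ℝ) / 2) *
        2 ^ (-(p₂.1 : ℝ) / 2) * 2 ^ (-(p₃.1 : ℝ) / 2) * 2 ^ (-(p₄.1 : ℝ) / 2) =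
      decay (|(p₁.1 : ℝ) - p₄.1| + |(p₂.1 : ℝ) - p₃.1| + ((p₁.2 : ℝ) + p₂.2 + p₃.2 + p₄.2)) := by
    rw [decay, ← Real.rpow_add (by norm_num), ← Real.rpow_add (by norm_num),
      ← Real.rpow_add (by norm_num), ← Real.rpow_add (by norm_num)]
    ring_nf
  calc _ = lam p₁.1 * lam p₂.1 * lam p₃.1 * lam p₄.1 * (2 ^ (((p₁.1 : ℝ) + p₂.1 + p₃.1 + p₄.1) / 2 -
        1 / 32 * (|(p₁.1 : ℝ) - p₄.1| + |(p₂.1 : ℝ) - p₃.1| +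
        ((p₁.2 : ℝ) + p₂.2 + p₃.2 + p₄.2))) * 2 ^ (-(p₁.1 : ℝ) / 2) *
        2 ^ (-(p₂.1 : ℝ) / 2) * 2 ^ (-(p₃.1 : ℝ) / 2) * 2 ^ (-(p₄.1 : ℝ) / 2)) := by ring
    _ = _ := by
      rw [h]
      simp only [decay_add, tagKernel]
      ring

/-- The exponent saving, in terms of tags, of rectangles whose first and fourth vertices are
related. -/
def tagExponent (p₁ p₂ p₃ p₄ : ℕ × ℕ) : ℝ :=
  ((p₁.1 : ℝ) + p₂.1 + p₃.1 + p₄.1) / 2 - 1 / 32 * (|(p₁.1 : ℝ) - p₄.1| +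
    |(p₂.1 : ℝ) - p₃.1| + ((p₁.2 : ℝ) + p₂.2 + p₃.2 + p₄.2))

/-- Summation of weights over cells with a power saving. -/
theorem sum_tags_le {α : Type*} {R : Finset α} {u : α → ℝ} {t₁ t₂ t₃ t₄ : α → ℕ × ℕ} {n N : ℕ}
    {lam : ℕ → ℝ} (hlam : ∀ j < n, 0 ≤ lam j) {c : ℝ} (hc : 0 ≤ c)
    (ht : ∀ q ∈ R, (t₁ q ∈ Finset.range n ×ˢ Finset.range N) ∧
      (t₂ q ∈ Finset.range n ×ˢ Finset.range N) ∧ (t₃ q ∈ Finset.range n ×ˢ Finset.range N) ∧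
      (t₄ q ∈ Finset.range n ×ˢ Finset.range N))
    (hu : ∀ p₁ p₂ p₃ p₄ : ℕ × ℕ,
      ∑ q ∈ R.filter (fun q => (t₁ q, t₂ q, t₃ q, t₄ q) = (p₁, p₂, p₃, p₄)), u q ≤
        c * (2 ^ tagExponent p₁ p₂ p₃ p₄ + 2 ^ tagExponent p₁ p₂ p₄ p₃)) :
    ∑ q ∈ R, lam (t₁ q).1 * 2 ^ (-((t₁ q).1 : ℝ) / 2) * (lam (t₂ q).1 * 2 ^ (-((t₂ q).1 : ℝ) / 2)) *
      (lam (t₃ q).1 * 2 ^ (-((t₃ q).1 : ℝ) / 2)) * (lam (t₄ q).1 * 2 ^ (-((t₄ q).1 : ℝ) / 2)) *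
      u q ≤ 8 * c * decaySum ^ 6 * (∑ j ∈ Finset.range n, lam j ^ 2) ^ 2 := by
  obtain ⟨J, hJ⟩ : ∃ J, J = Finset.range n ×ˢ Finset.range N := ⟨_, rfl⟩
  rw [← hJ] at ht
  obtain ⟨φ, hφ⟩ : ∃ φ : ℕ × ℕ → ℝ, ∀ p, φ p = lam p.1 * 2 ^ (-(p.1 : ℝ) / 2) := ⟨_, fun _ => rfl⟩
  have hφ0 : ∀ p ∈ J, 0 ≤ φ p := fun p hp => by
    rw [hφ]
    rw [hJ, Finset.mem_product, Finset.mem_range] at hp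
    exact mul_nonneg (hlam _ hp.1) (by positivity)
  simp only [← hφ]
  rw [← Finset.sum_fiberwise_of_maps_to (t := J ×ˢ J ×ˢ J ×ˢ J)
    (g := fun q => (t₁ q, t₂ q, t₃ q, t₄ q)) fun q hq => by
      simpa only [Finset.mem_product] using ht q hq]
  have h1 : ∀ p ∈ J ×ˢ J ×ˢ J ×ˢ J,
      ∑ q ∈ R.filter (fun q => (t₁ q, t₂ q, t₃ q, t₄ q) = p),
        φ (t₁ q) * φ (t₂ q) * φ (t₃ q) * φ (t₄ q) * u q ≤
      c * (tagKernel lam p.1 p.2.2.2 * tagKernel lam p.2.1 p.2.2.1) +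
      c * (tagKernel lam p.1 p.2.2.1 * tagKernel lam p.2.1 p.2.2.2) := by
    rintro ⟨p₁, p₂, p₃, p₄⟩ hp
    simp only [Finset.mem_product] at hp
    obtain ⟨a1, a2, a3, a4⟩ := hp
    have hpos : 0 ≤ φ p₁ * φ p₂ * φ p₃ * φ p₄ :=
      mul_nonneg (mul_nonneg (mul_nonneg (hφ0 _ a1) (hφ0 _ a2)) (hφ0 _ a3)) (hφ0 _ a4)
    have e : ∀ q ∈ R.filter (fun q => (t₁ q, t₂ q, t₃ q, t₄ q) = (p₁, p₂, p₃, p₄)),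
        φ (t₁ q) * φ (t₂ q) * φ (t₃ q) * φ (t₄ q) * u q = φ p₁ * φ p₂ * φ p₃ * φ p₄ * u q := by
      intro q hq
      have := (Finset.mem_filter.1 hq).2
      simp only [Prod.mk.injEq] at this
      rw [this.1, this.2.1, this.2.2.1, this.2.2.2]
    rw [Finset.sum_congr rfl e, ← Finset.mul_sum]
    refine (mul_le_mul_of_nonneg_left (hu p₁ p₂ p₃ p₄) hpos).trans (le_of_eq ?_)
    have k1 := tagKernel_mul_tagKernel lam p₁ p₂ p₃ p₄
    have k2 := tagKernel_mul_tagKernel lam p₁ p₂ p₄ p₃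
    rw [← tagExponent, ← hφ, ← hφ, ← hφ, ← hφ] at k1 k2
    simp only
    rw [← k1, ← k2]
    ring
  refine (Finset.sum_le_sum h1).trans
    (le_of_eq_of_le (b := 2 * c * (∑ p ∈ J, ∑ p' ∈ J, tagKernel lam p p') ^ 2) ?_ ?_)
  · rw [Finset.sum_add_distrib, ← Finset.mul_sum, ← Finset.mul_sum]
    have s1 : ∑ p ∈ J ×ˢ J ×ˢ J ×ˢ J, tagKernel lam p.1 p.2.2.2 * tagKernel lam p.2.1 p.2.2.1 =
        (∑ p ∈ J, ∑ p' ∈ J, tagKernel lam p p') ^ 2 := by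
      simp only [Finset.sum_product]
      simp only [← Finset.sum_mul]
      rw [sq, Finset.sum_mul]
      refine Finset.sum_congr rfl fun p₁ _ => ?_
      simp only [Finset.mul_sum]
    have s2 : ∑ p ∈ J ×ˢ J ×ˢ J ×ˢ J, tagKernel lam p.1 p.2.2.1 * tagKernel lam p.2.1 p.2.2.2 =
        (∑ p ∈ J, ∑ p' ∈ J, tagKernel lam p p') ^ 2 := by
      simp only [Finset.sum_product]
      simp only [← Finset.mul_sum, ← Finset.sum_mul]
      rw [sq]
    rw [s1, s2]; ring
  · have h2 := sum_tagKernel_le lam n N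
    rw [← hJ] at h2
    have h3 : 0 ≤ ∑ p ∈ J, ∑ p' ∈ J, tagKernel lam p p' := by
      refine Finset.sum_nonneg fun p hp => Finset.sum_nonneg fun p' hp' => ?_
      rw [hJ, Finset.mem_product, Finset.mem_range] at hp hp'
      rw [tagKernel]
      have := hlam _ hp.1
      have := hlam _ hp'.1
      have := decay_pos p.2
      have := decay_pos p'.2
      have := decay_pos |(p.1 : ℝ) - p'.1|
      positivity
    calc _ ≤ 2 * c * (2 * decaySum ^ 3 * ∑ j ∈ Finset.range n, lam j ^ 2) ^ 2 := by gcongr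
      _ = _ := by ring

end TagSums

section RectangleSums

/-- The value at `x` of the function with coefficient `lam j` on level `j`. -/
def weight (lev : Pt → ℕ) (lam : ℕ → ℝ) (x : Pt) : ℝ := lam (lev x) * 2 ^ (-(lev x : ℝ) / 2)

/-- The product of the weights of the vertices, divided by the lattice length of the first
side. -/
def rectWeight (lev : Pt → ℕ) (lam : ℕ → ℝ) (q : Pt × Pt × Pt × Pt) : ℝ :=
  weight lev lam q.1 * weight lev lam q.2.1 * weight lev lam q.2.2.1 * weight lev lam q.2.2.2 *
    (1 / (gcdP (q.1 - q.2.1) : ℝ))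

/-- Opposite sides have the same classes of vertices, with respect to bigness and to triviality of
the richness. -/
def Matched (A : Finset Pt) (lev : Pt → ℕ) (C : ℕ) (q : Pt × Pt × Pt × Pt) : Prop :=
  (IsBig A lev C q.1 (dir (q.1 - q.2.1)) ↔ IsBig A lev C q.2.2.2 (dir (q.1 - q.2.1))) ∧
  (IsBig A lev C q.2.1 (dir (q.1 - q.2.1)) ↔ IsBig A lev C q.2.2.1 (dir (q.1 - q.2.1))) ∧
  (Nat.log 2 (crossRichness A lev q.1 (dir (q.1 - q.2.1))) = 0 ↔
    Nat.log 2 (crossRichness A lev q.2.2.2 (dir (q.1 - q.2.1))) = 0) ∧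
  (Nat.log 2 (crossRichness A lev q.2.1 (dir (q.1 - q.2.1))) = 0 ↔
    Nat.log 2 (crossRichness A lev q.2.2.1 (dir (q.1 - q.2.1))) = 0)

variable {A : Finset Pt} {lev : Pt → ℕ} {C n : ℕ} {lam : ℕ → ℝ}

theorem weight_nonneg (hlev : ∀ x ∈ A, lev x < n) (hlam : ∀ j < n, 0 ≤ lam j) {x : Pt}
    (hx : x ∈ A) : 0 ≤ weight lev lam x :=
  mul_nonneg (hlam _ (hlev x hx)) (by positivity)

theorem sum_weight_sq_le (hA : ∀ j, (A.filter fun x => lev x = j).card ≤ 2 ^ j)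
    (hlev : ∀ x ∈ A, lev x < n) :
    ∑ x ∈ A, weight lev lam x ^ 2 ≤ ∑ j ∈ Finset.range n, lam j ^ 2 := by
  rw [← Finset.sum_fiberwise_of_maps_to fun x hx => Finset.mem_range.2 (hlev x hx)]
  refine Finset.sum_le_sum fun j _ => ?_
  have e : ∀ x ∈ A.filter (fun x => lev x = j),
      weight lev lam x ^ 2 = lam j ^ 2 * 2 ^ (-(j : ℝ)) := fun x hx => by
    rw [weight, (Finset.mem_filter.1 hx).2, mul_pow, ← Real.rpow_mul_natCast (by norm_num)]
    norm_num
  rw [Finset.sum_congr rfl e, Finset.sum_const, nsmul_eq_mul]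
  have h1 : ((A.filter fun x => lev x = j).card : ℝ) ≤ 2 ^ (j : ℝ) := by
    rw [Real.rpow_natCast]; exact_mod_cast hA j
  calc _ ≤ 2 ^ (j : ℝ) * (lam j ^ 2 * 2 ^ (-(j : ℝ))) :=
        mul_le_mul_of_nonneg_right h1 (by positivity)
    _ = lam j ^ 2 * (2 ^ (j : ℝ) * 2 ^ (-(j : ℝ))) := by ring
    _ = _ := by rw [← Real.rpow_add (by norm_num), add_neg_cancel, Real.rpow_zero, mul_one]

theorem sum_le_cellSum {R : Finset (Pt × Pt × Pt × Pt)} {c₁ c₂ c₃ c₄ : Pt → Pt → Prop}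
    (h : R ⊆ rectCell A c₁ c₂ c₃ c₄) :
    ∑ q ∈ R, 1 / (gcdP (q.1 - q.2.1) : ℝ) ≤ cellSum A c₁ c₂ c₃ c₄ :=
  Finset.sum_le_sum_of_subset_of_nonneg h fun _ _ _ => by positivity

theorem sum_rectWeight_big_small_le (hA : ∀ j, (A.filter fun x => lev x = j).card ≤ 2 ^ j)
    (hu : UniqueRich A lev C) (hlev : ∀ x ∈ A, lev x < n) (hlam : ∀ j < n, 0 ≤ lam j)
    {R : Finset (Pt × Pt × Pt × Pt)}
    (hR : R ⊆ rectCell A (IsBig A lev C) (fun x d => ¬IsBig A lev C x d)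
      (fun x d => ¬IsBig A lev C x d) (IsBig A lev C)) :
    ∑ q ∈ R, rectWeight lev lam q ≤
      64 * 4 ^ C * decaySum ^ 6 * (∑ j ∈ Finset.range n, lam j ^ 2) ^ 2 := by
  refine (sum_tags_le (R := R) (u := fun q => 1 / (gcdP (q.1 - q.2.1) : ℝ))
    (t₁ := fun q => (lev q.1, 0)) (t₂ := fun q => (lev q.2.1, 0))
    (t₃ := fun q => (lev q.2.2.1, 0)) (t₄ := fun q => (lev q.2.2.2, 0)) (N := 1) hlam
    (c := 8 * 4 ^ C) (by positivity) ?_ ?_).trans (le_of_eq (by ring))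
  · intro q hq
    obtain ⟨h1, h2, h3, h4⟩ := (mem_rectCell.1 (hR hq)).1
    simp [hlev _ h1, hlev _ h2, hlev _ h3, hlev _ h4]
  · rintro ⟨j₁, a₁⟩ ⟨j₂, a₂⟩ ⟨j₃, a₃⟩ ⟨j₄, a₄⟩
    have hpos : ∀ r : ℝ, (0 : ℝ) ≤ 8 * 4 ^ C * 2 ^ r := fun r => by positivity
    rw [mul_add]
    rcases Finset.eq_empty_or_nonempty (R.filter fun q => ((lev q.1, 0), (lev q.2.1, 0),
      (lev q.2.2.1, 0), (lev q.2.2.2, 0)) = ((j₁, a₁), (j₂, a₂), (j₃, a₃), (j₄, a₄)))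
    with h | ⟨q, hq⟩
    · rw [h, Finset.sum_empty]
      exact add_nonneg (hpos _) (hpos _)
    · have h1 := (Finset.mem_filter.1 hq).2
      simp only [Prod.mk.injEq] at h1
      obtain ⟨⟨-, rfl⟩, ⟨-, rfl⟩, ⟨-, rfl⟩, -, rfl⟩ := h1
      refine le_trans ?_ (le_add_of_nonneg_right (hpos _))
      refine (sum_le_cellSum (A := A) (c₁ := BigAt A lev C j₁) (c₂ := SmallAt A lev C j₂)
        (c₃ := SmallAt A lev C j₃) (c₄ := BigAt A lev C j₄) fun q hq => ?_).trans
        ((cellSum_big_small_le' hA hu j₁ j₂ j₃ j₄).trans (le_of_eq ?_))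
      · obtain ⟨h1, h2⟩ := Finset.mem_filter.1 hq
        simp only [Prod.mk.injEq, and_true] at h2
        have h3 := mem_rectCell.1 (hR h1)
        exact mem_rectCell.2 ⟨h3.1, h3.2.1, ⟨h2.1, h3.2.2.1⟩, ⟨h2.2.1, h3.2.2.2.1⟩,
          ⟨h2.2.2.1, h3.2.2.2.2.1⟩, ⟨h2.2.2.2, h3.2.2.2.2.2⟩⟩
      · simp [tagExponent]

theorem sum_rectWeight_small_le (hA : ∀ j, (A.filter fun x => lev x = j).card ≤ 2 ^ j)
    (hlev : ∀ x ∈ A, lev x < n) (hlam : ∀ j < n, 0 ≤ lam j)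
    {R : Finset (Pt × Pt × Pt × Pt)}
    (hR : R ⊆ rectCell A (fun x d => ¬IsBig A lev C x d) (fun x d => ¬IsBig A lev C x d)
      (fun x d => ¬IsBig A lev C x d) (fun x d => ¬IsBig A lev C x d))
    (hm : ∀ q ∈ R, Matched A lev C q) :
    ∑ q ∈ R, rectWeight lev lam q ≤
      32 * (18432 + 192 * 4 ^ C) * decaySum ^ 6 * (∑ j ∈ Finset.range n, lam j ^ 2) ^ 2 := by
  obtain ⟨al, hal⟩ : ∃ al : Pt → Pt → ℕ, ∀ x d, al x d = Nat.log 2 (crossRichness A lev x d) :=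
    ⟨_, fun _ _ => rfl⟩
  have hbd : ∀ x d, al x d < A.card + 1 := fun x d => by
    rw [hal, Nat.lt_succ_iff]
    refine (Nat.log_le_self _ _).trans (max_le ?_ ?_) <;>
    · refine Finset.card_le_card ?_
      exact (Finset.filter_subset _ _).trans (Finset.filter_subset _ _)
  refine (sum_tags_le (R := R) (u := fun q => 1 / (gcdP (q.1 - q.2.1) : ℝ))
    (t₁ := fun q => (lev q.1, al q.1 (dir (q.1 - q.2.1))))
    (t₂ := fun q => (lev q.2.1, al q.2.1 (dir (q.1 - q.2.1))))
    (t₃ := fun q => (lev q.2.2.1, al q.2.2.1 (dir (q.1 - q.2.1))))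
    (t₄ := fun q => (lev q.2.2.2, al q.2.2.2 (dir (q.1 - q.2.1)))) (N := A.card + 1) hlam
    (c := 4 * (18432 + 192 * 4 ^ C)) (by positivity) ?_ ?_).trans (le_of_eq (by ring))
  · intro q hq
    obtain ⟨h1, h2, h3, h4⟩ := (mem_rectCell.1 (hR hq)).1
    simp only [Finset.mem_product, Finset.mem_range]
    exact ⟨⟨hlev _ h1, hbd _ _⟩, ⟨hlev _ h2, hbd _ _⟩, ⟨hlev _ h3, hbd _ _⟩, hlev _ h4, hbd _ _⟩
  · intro p₁ p₂ p₃ p₄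
    obtain ⟨R', hR'⟩ : ∃ R', R' = R.filter fun q => ((lev q.1, al q.1 (dir (q.1 - q.2.1))),
      (lev q.2.1, al q.2.1 (dir (q.1 - q.2.1))), (lev q.2.2.1, al q.2.2.1 (dir (q.1 - q.2.1))),
      (lev q.2.2.2, al q.2.2.2 (dir (q.1 - q.2.1)))) = (p₁, p₂, p₃, p₄) := ⟨_, rfl⟩
    rw [← hR']
    have hp : ∀ q ∈ R', q ∈ R ∧ (lev q.1, al q.1 (dir (q.1 - q.2.1))) = p₁ ∧
        (lev q.2.1, al q.2.1 (dir (q.1 - q.2.1))) = p₂ ∧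
        (lev q.2.2.1, al q.2.2.1 (dir (q.1 - q.2.1))) = p₃ ∧
        (lev q.2.2.2, al q.2.2.2 (dir (q.1 - q.2.1))) = p₄ := fun q hq => by
      rw [hR'] at hq
      simpa only [Prod.mk.injEq] using Finset.mem_filter.1 hq
    rcases R'.eq_empty_or_nonempty with h | ⟨q, hq⟩
    · rw [h, Finset.sum_empty]
      positivity
    · have hmat : (p₁.2 = 0 ↔ p₄.2 = 0) ∧ (p₂.2 = 0 ↔ p₃.2 = 0) := by
        obtain ⟨h0, rfl, rfl, rfl, rfl⟩ := hp q hq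
        simp only [hal]
        exact (hm q h0).2.2
      have hexp : tagExponent p₁ p₂ p₄ p₃ = ((p₁.1 : ℝ) + p₂.1 + p₃.1 + p₄.1) / 2 -
          1 / 32 * (|(p₁.1 : ℝ) - p₃.1| + |(p₂.1 : ℝ) - p₄.1| +
            ((p₁.2 : ℝ) + p₂.2 + p₃.2 + p₄.2)) := by
        rw [tagExponent]; ring
      rw [hexp, tagExponent]
      refine le_trans (sum_le_cellSum fun q hq => ?_)
        (tagSum_le (A := A) (lev := lev) (C := C) hA hmat.1 hmat.2)
      obtain ⟨h0, rfl, rfl, rfl, rfl⟩ := hp q hq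
      have h3 := mem_rectCell.1 (hR h0)
      exact mem_rectCell.2 ⟨h3.1, h3.2.1, ⟨rfl, h3.2.2.1, (hal _ _).symm⟩,
        ⟨rfl, h3.2.2.2.1, (hal _ _).symm⟩, ⟨rfl, h3.2.2.2.2.1, (hal _ _).symm⟩,
        ⟨rfl, h3.2.2.2.2.2, (hal _ _).symm⟩⟩

theorem IsRectangle.eq_of_det {q q' : Pt × Pt × Pt × Pt} (h : IsRectangle q) (h' : IsRectangle q')
    (h1 : q.1 = q'.1) (h3 : q.2.2.1 = q'.2.2.1)
    (hd : det (dir (q.1 - q.2.1)) (dir (q'.1 - q'.2.1)) = 0) : q = q' := by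
  refine h.eq_of_eq h' h1 ?_ h3
  have n1 := dir_ne_zero (sub_ne_zero.2 h.2.2.1)
  have n2 := dir_ne_zero (sub_ne_zero.2 h'.2.2.1)
  have e1 := h.det_side
  have e2 := det_trans n2 hd h'.det_side
  have f1 := h.det_rot_side'
  have hd' : det (rot (dir (q.1 - q.2.1))) (rot (dir (q'.1 - q'.2.1))) = 0 := by
    rw [det_rot_rot, hd]
  have f2 := det_trans (rot_ne_zero n2) hd' h'.det_rot_side'
  rw [← h1] at e2
  rw [← h3] at f2
  rw [det_rot, neg_eq_zero] at f1 f2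
  rw [← sub_eq_zero]
  refine eq_zero_of_det_dot n1 ?_ ?_
  · simp only [det, Prod.fst_sub, Prod.snd_sub] at e1 e2 ⊢
    linear_combination e1 - e2
  · simp only [dot, Prod.fst_sub, Prod.snd_sub] at f1 f2 ⊢
    linear_combination f2 - f1

theorem sum_diagonal_big_le (hu : UniqueRich A lev C) {R : Finset (Pt × Pt × Pt × Pt)}
    (hR : ∀ q ∈ R, (q.1 ∈ A ∧ q.2.2.1 ∈ A) ∧ IsRectangle q ∧
      IsBig A lev C q.1 (dir (q.1 - q.2.1))) {v : Pt → ℝ} (hv : ∀ x, 0 ≤ v x) :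
    ∑ q ∈ R, v q.1 * v q.2.2.1 ≤ 2 * (∑ x ∈ A, v x) ^ 2 := by
  classical
  have hone : ∀ P : Finset (Pt × Pt × Pt × Pt), P ⊆ R →
      (∀ q ∈ P, ∀ q' ∈ P, q.1 = q'.1 → det (dir (q.1 - q.2.1)) (dir (q'.1 - q'.2.1)) = 0) →
      ∑ q ∈ P, v q.1 * v q.2.2.1 ≤ (∑ x ∈ A, v x) ^ 2 := by
    intro P hP hdet
    rw [sq, Finset.sum_mul_sum, ← Finset.sum_product' (f := fun x y => v x * v y)]
    have hinj : Set.InjOn (fun q : Pt × Pt × Pt × Pt => (q.1, q.2.2.1)) P := by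
      intro q hq q' hq' h
      rw [Prod.mk.injEq] at h
      exact (hR q (hP hq)).2.1.eq_of_det (hR q' (hP hq')).2.1 h.1 h.2 (hdet q hq q' hq' h.1)
    rw [← Finset.sum_image (f := fun p : Pt × Pt => v p.1 * v p.2) hinj]
    refine Finset.sum_le_sum_of_subset_of_nonneg ?_ fun _ _ _ => mul_nonneg (hv _) (hv _)
    intro p hp
    obtain ⟨q, hq, rfl⟩ := Finset.mem_image.1 hp
    exact Finset.mem_product.2 (hR q (hP hq)).1
  have hne : ∀ q ∈ R, dir (q.1 - q.2.1) ≠ 0 := fun q hq =>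
    dir_ne_zero (sub_ne_zero.2 (hR q hq).2.1.2.2.1)
  rw [← Finset.sum_filter_add_sum_filter_not R fun q =>
    (2 : ℝ) ^ ((lev q.1 : ℝ) / 2 + C) ≤ richness A lev q.1 (dir (q.1 - q.2.1)), two_mul]
  refine add_le_add (hone _ (Finset.filter_subset _ _) ?_)
    (hone _ (Finset.filter_subset _ _) ?_)
  · intro q hq q' hq' h
    obtain ⟨h1, h2⟩ := Finset.mem_filter.1 hq
    obtain ⟨h1', h2'⟩ := Finset.mem_filter.1 hq'
    have n2 := hne q' h1'
    rw [← h] at h2' n2 ⊢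
    exact hu _ (hR q h1).1.1 _ _ (hne q h1) n2 h2 h2'
  · intro q hq q' hq' h
    obtain ⟨h1, h2⟩ := Finset.mem_filter.1 hq
    obtain ⟨h1', h2'⟩ := Finset.mem_filter.1 hq'
    have h3 := (hR q h1).2.2.richness_or.resolve_left h2
    have h3' := (hR q' h1').2.2.richness_or.resolve_left h2'
    have n2 := hne q' h1'
    rw [← h] at h3' n2 ⊢
    rw [← det_rot_rot]
    exact hu _ (hR q h1).1.1 _ _ (rot_ne_zero (hne q h1)) (rot_ne_zero n2) h3 h3'

theorem swap_mem_rectCell {c₁ c₂ c₃ c₄ : Pt → Pt → Prop} (h₁ : ∀ x d, c₁ x (-d) ↔ c₁ x d)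
    (h₂ : ∀ x d, c₂ x (-d) ↔ c₂ x d) (h₃ : ∀ x d, c₃ x (-d) ↔ c₃ x d)
    (h₄ : ∀ x d, c₄ x (-d) ↔ c₄ x d) {q : Pt × Pt × Pt × Pt}
    (hq : q ∈ rectCell A c₁ c₂ c₃ c₄) :
    (q.2.1, q.1, q.2.2.2, q.2.2.1) ∈ rectCell A c₂ c₁ c₄ c₃ := by
  obtain ⟨x, y, z, w⟩ := q
  rw [mem_rectCell] at hq ⊢
  obtain ⟨⟨a1, a2, a3, a4⟩, hr, b1, b2, b3, b4⟩ := hq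
  refine ⟨⟨a2, a1, a4, a3⟩, hr.swap, ?_⟩
  simp only at b1 b2 b3 b4 ⊢
  rw [← neg_sub x y, dir_neg, h₁, h₂, h₃, h₄]
  exact ⟨b2, b1, b4, b3⟩

theorem swap_injective : Function.Injective
    fun q : Pt × Pt × Pt × Pt => (q.2.1, q.1, q.2.2.2, q.2.2.1) := by
  rintro ⟨x, y, z, w⟩ ⟨x', y', z', w'⟩ h
  simp only [Prod.mk.injEq] at h ⊢
  exact ⟨h.2.1, h.1, h.2.2.2, h.2.2.1⟩

theorem sum_rectWeight_small_big_le (hA : ∀ j, (A.filter fun x => lev x = j).card ≤ 2 ^ j)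
    (hu : UniqueRich A lev C) (hlev : ∀ x ∈ A, lev x < n) (hlam : ∀ j < n, 0 ≤ lam j)
    {R : Finset (Pt × Pt × Pt × Pt)}
    (hR : R ⊆ rectCell A (fun x d => ¬IsBig A lev C x d) (IsBig A lev C) (IsBig A lev C)
      (fun x d => ¬IsBig A lev C x d)) :
    ∑ q ∈ R, rectWeight lev lam q ≤
      64 * 4 ^ C * decaySum ^ 6 * (∑ j ∈ Finset.range n, lam j ^ 2) ^ 2 := by
  classical
  refine le_of_eq_of_le ?_ (sum_rectWeight_big_small_le hA hu hlev hlam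
    (R := R.image fun q => (q.2.1, q.1, q.2.2.2, q.2.2.1)) ?_)
  · rw [Finset.sum_image swap_injective.injOn]
    refine Finset.sum_congr rfl fun q _ => ?_
    simp only [rectWeight]
    rw [← neg_sub q.1 q.2.1, gcdP_neg]
    ring
  · intro q hq
    obtain ⟨q', hq', rfl⟩ := Finset.mem_image.1 hq
    exact swap_mem_rectCell (fun _ _ => not_congr (isBig_neg _ _)) isBig_neg isBig_neg
      (fun _ _ => not_congr (isBig_neg _ _)) (hR hq')

theorem sum_rectWeight_big_le (hA : ∀ j, (A.filter fun x => lev x = j).card ≤ 2 ^ j)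
    (hu : UniqueRich A lev C) (hlev : ∀ x ∈ A, lev x < n) (hlam : ∀ j < n, 0 ≤ lam j)
    {R : Finset (Pt × Pt × Pt × Pt)}
    (hR : R ⊆ rectCell A (IsBig A lev C) (IsBig A lev C) (IsBig A lev C) (IsBig A lev C)) :
    ∑ q ∈ R, rectWeight lev lam q ≤ 2 * (∑ j ∈ Finset.range n, lam j ^ 2) ^ 2 := by
  classical
  obtain ⟨v, hv⟩ : ∃ v : Pt → ℝ, ∀ x, v x = weight lev lam x ^ 2 := ⟨_, fun _ => rfl⟩
  have hv0 : ∀ x, 0 ≤ v x := fun x => by rw [hv]; exact sq_nonneg _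
  have hdiag : ∀ P, P ⊆ rectCell A (IsBig A lev C) (IsBig A lev C) (IsBig A lev C)
      (IsBig A lev C) → ∑ q ∈ P, v q.1 * v q.2.2.1 ≤ 2 * (∑ x ∈ A, v x) ^ 2 := fun P hP =>
    sum_diagonal_big_le hu (fun q hq => by
      have h := mem_rectCell.1 (hP hq)
      exact ⟨⟨h.1.1, h.1.2.2.1⟩, h.2.1, h.2.2.1⟩) hv0
  have h1 := hdiag R hR
  have h2 := hdiag (R.image fun q => (q.2.1, q.1, q.2.2.2, q.2.2.1)) fun q hq => by
    obtain ⟨q', hq', rfl⟩ := Finset.mem_image.1 hq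
    exact swap_mem_rectCell isBig_neg isBig_neg isBig_neg isBig_neg (hR hq')
  rw [Finset.sum_image swap_injective.injOn] at h2
  have h3 : ∑ q ∈ R, rectWeight lev lam q ≤
      ∑ q ∈ R, (1 / 2 * (v q.1 * v q.2.2.1) + 1 / 2 * (v q.2.1 * v q.2.2.2)) := by
    refine Finset.sum_le_sum fun q hq => ?_
    obtain ⟨⟨a1, a2, a3, a4⟩, hr, -⟩ := mem_rectCell.1 (hR hq)
    have hg : (1 / (gcdP (q.1 - q.2.1) : ℝ)) ≤ 1 :=
      div_le_one_of_le₀ (by exact_mod_cast gcdP_pos (sub_ne_zero.2 hr.2.2.1)) (by positivity)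
    have hw := fun {x} => weight_nonneg (x := x) hlev hlam
    refine (mul_le_of_le_one_right (mul_nonneg (mul_nonneg (mul_nonneg (hw a1) (hw a2)) (hw a3))
      (hw a4)) hg).trans ?_
    simp only [hv]
    nlinarith [sq_nonneg (weight lev lam q.1 * weight lev lam q.2.2.1 -
      weight lev lam q.2.1 * weight lev lam q.2.2.2)]
  have h4 : ∑ x ∈ A, v x ≤ ∑ j ∈ Finset.range n, lam j ^ 2 := by
    simp only [hv]; exact sum_weight_sq_le hA hlev
  have h5 : (∑ x ∈ A, v x) ^ 2 ≤ (∑ j ∈ Finset.range n, lam j ^ 2) ^ 2 :=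
    pow_le_pow_left₀ (Finset.sum_nonneg fun x _ => hv0 x) h4 2
  rw [Finset.sum_add_distrib, ← Finset.mul_sum, ← Finset.mul_sum] at h3
  linarith

/-- The constant in the bound for matched rectangles. -/
def rectConst (C : ℕ) : ℝ :=
  2 + (128 * 4 ^ C + 32 * (18432 + 192 * 4 ^ C)) * decaySum ^ 6

theorem sum_rectWeight_matched_le (hA : ∀ j, (A.filter fun x => lev x = j).card ≤ 2 ^ j)
    (hu : UniqueRich A lev C) (hlev : ∀ x ∈ A, lev x < n) (hlam : ∀ j < n, 0 ≤ lam j)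
    {R : Finset (Pt × Pt × Pt × Pt)}
    (hR : ∀ q ∈ R, (q.1 ∈ A ∧ q.2.1 ∈ A ∧ q.2.2.1 ∈ A ∧ q.2.2.2 ∈ A) ∧ IsRectangle q ∧
      Matched A lev C q) :
    ∑ q ∈ R, rectWeight lev lam q ≤
      rectConst C * (∑ j ∈ Finset.range n, lam j ^ 2) ^ 2 := by
  classical
  rw [← Finset.sum_filter_add_sum_filter_not R fun q => IsBig A lev C q.1 (dir (q.1 - q.2.1)),
    ← Finset.sum_filter_add_sum_filter_not
      (R.filter fun q => IsBig A lev C q.1 (dir (q.1 - q.2.1)))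
      fun q => IsBig A lev C q.2.1 (dir (q.1 - q.2.1)),
    ← Finset.sum_filter_add_sum_filter_not
      (R.filter fun q => ¬IsBig A lev C q.1 (dir (q.1 - q.2.1)))
      fun q => IsBig A lev C q.2.1 (dir (q.1 - q.2.1))]
  simp only [Finset.filter_filter]
  have b1 := sum_rectWeight_big_le hA hu hlev hlam (R := R.filter fun q =>
    IsBig A lev C q.1 (dir (q.1 - q.2.1)) ∧ IsBig A lev C q.2.1 (dir (q.1 - q.2.1))) fun q hq => by
      obtain ⟨h0, h1, h2⟩ := Finset.mem_filter.1 hq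
      obtain ⟨h3, h4, m1, m2, -⟩ := hR q h0
      exact mem_rectCell.2 ⟨h3, h4, h1, h2, m2.1 h2, m1.1 h1⟩
  have b2 := sum_rectWeight_big_small_le hA hu hlev hlam (R := R.filter fun q =>
    IsBig A lev C q.1 (dir (q.1 - q.2.1)) ∧ ¬IsBig A lev C q.2.1 (dir (q.1 - q.2.1))) fun q hq => by
      obtain ⟨h0, h1, h2⟩ := Finset.mem_filter.1 hq
      obtain ⟨h3, h4, m1, m2, -⟩ := hR q h0
      exact mem_rectCell.2 ⟨h3, h4, h1, h2, fun h => h2 (m2.2 h), m1.1 h1⟩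
  have b3 := sum_rectWeight_small_big_le hA hu hlev hlam (R := R.filter fun q =>
    ¬IsBig A lev C q.1 (dir (q.1 - q.2.1)) ∧ IsBig A lev C q.2.1 (dir (q.1 - q.2.1))) fun q hq => by
      obtain ⟨h0, h1, h2⟩ := Finset.mem_filter.1 hq
      obtain ⟨h3, h4, m1, m2, -⟩ := hR q h0
      exact mem_rectCell.2 ⟨h3, h4, h1, h2, m2.1 h2, fun h => h1 (m1.2 h)⟩
  have b4 := sum_rectWeight_small_le (C := C) hA hlev hlam (R := R.filter fun q =>
    ¬IsBig A lev C q.1 (dir (q.1 - q.2.1)) ∧ ¬IsBig A lev C q.2.1 (dir (q.1 - q.2.1)))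
    (fun q hq => by
      obtain ⟨h0, h1, h2⟩ := Finset.mem_filter.1 hq
      obtain ⟨h3, h4, m1, m2, -⟩ := hR q h0
      exact mem_rectCell.2 ⟨h3, h4, h1, h2, fun h => h2 (m2.2 h), fun h => h1 (m1.2 h)⟩)
    fun q hq => (hR q (Finset.mem_filter.1 hq).1).2.2
  refine (add_le_add (add_le_add b1 b2) (add_le_add b3 b4)).trans (le_of_eq ?_)
  rw [rectConst]; ring

end RectangleSums

section Reduction

theorem sum_mul_comp_eq {ε β : Type*} [DecidableEq β] {E : Finset ε} {P : Finset β} {π : ε → β}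
    (hπ : ∀ e ∈ E, π e ∈ P) (w : ε → ℝ) (f : β → ℝ) :
    ∑ e ∈ E, w e * f (π e) = ∑ p ∈ P, (∑ e ∈ E.filter (fun e => π e = p), w e) * f p := by
  rw [← Finset.sum_fiberwise_of_maps_to hπ]
  refine Finset.sum_congr rfl fun p _ => ?_
  rw [Finset.sum_mul]
  refine Finset.sum_congr rfl fun e he => ?_
  rw [(Finset.mem_filter.1 he).2]

theorem sum_sum_mul_comp_eq {ε β : Type*} [DecidableEq β] {E : Finset ε} {P : Finset β} {π : ε → β}
    (hπ : ∀ e ∈ E, π e ∈ P) (w : ε → ℝ) (f : β → β → ℝ) :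
    ∑ e ∈ E, ∑ e' ∈ E, w e * w e' * f (π e) (π e') =
      ∑ p ∈ P, ∑ p' ∈ P, (∑ e ∈ E.filter (fun e => π e = p), w e) *
        (∑ e ∈ E.filter (fun e => π e = p'), w e) * f p p' := by
  have h1 : ∀ e, ∑ e' ∈ E, w e * w e' * f (π e) (π e') =
      w e * ∑ p' ∈ P, (∑ e ∈ E.filter (fun e => π e = p'), w e) * f (π e) p' := fun e => by
    rw [← sum_mul_comp_eq hπ, Finset.mul_sum]
    simp only [mul_assoc]
  simp only [h1]
  rw [sum_mul_comp_eq hπ w fun b => ∑ p' ∈ P, (∑ e ∈ E.filter (fun e => π e = p'), w e) * f b p']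
  refine Finset.sum_congr rfl fun p _ => ?_
  rw [Finset.mul_sum]
  simp only [mul_assoc]

/-- Two keys with the same first entry and distinct second entries at distance less than `M`. -/
def Near {V : Type*} (M : ℕ) (p p' : V × ℤ) : Prop :=
  p.1 = p'.1 ∧ 0 < |p.2 - p'.2| ∧ |p.2 - p'.2| < M

theorem Near.symm {V : Type*} {M : ℕ} {p p' : V × ℤ} (h : Near M p p') : Near M p' p := by
  refine ⟨h.1.symm, ?_⟩
  rw [abs_sub_comm]
  exact h.2

theorem card_near_le {V : Type*} {P : Finset (V × ℤ)} {g : V → ℕ} (hg : ∀ p ∈ P, 0 < g p.1)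
    (hdvd : ∀ p ∈ P, (g p.1 : ℤ) ∣ p.2) (M : ℕ) {p : V × ℤ} (hp : p ∈ P) {B : Finset (V × ℤ)}
    (hB : ∀ p' ∈ B, p' ∈ P ∧ Near M p p') : (B.card : ℝ) ≤ 2 * M * (1 / (g p.1 : ℝ)) := by
  have hg0 := hg p hp
  have h1 : B.card ≤
      ((Finset.Icc (-((M / g p.1 : ℕ) : ℤ)) ((M / g p.1 : ℕ) : ℤ)).erase 0).card := by
    refine Finset.card_le_card_of_injOn (fun p' => (p'.2 - p.2) / (g p.1 : ℤ)) ?_ ?_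
    · intro p' hp'
      obtain ⟨h2, h3, h4, h5⟩ := hB p' hp'
      obtain ⟨k, hk⟩ : (g p.1 : ℤ) ∣ p'.2 - p.2 :=
        dvd_sub (by rw [h3]; exact hdvd p' h2) (hdvd p hp)
      have hgz : (0 : ℤ) < g p.1 := by exact_mod_cast hg0
      have hkk : (p'.2 - p.2) / (g p.1 : ℤ) = k := by rw [hk, Int.mul_ediv_cancel_left _ hgz.ne']
      rw [abs_sub_comm, hk, abs_mul, abs_of_pos hgz] at h4 h5
      have h6 : |k| ≤ ((M / g p.1 : ℕ) : ℤ) := by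
        rw [Int.natCast_ediv]
        exact (Int.le_ediv_iff_mul_le hgz).2 (by rw [mul_comm]; exact h5.le)
      simp only [Finset.coe_erase, Finset.coe_Icc, Set.mem_sdiff, Set.mem_Icc,
        Set.mem_singleton_iff, hkk]
      refine ⟨abs_le.1 h6, ?_⟩
      rintro rfl
      simp at h4
    · intro a ha b hb hab
      obtain ⟨h2, h3, -⟩ := hB a ha
      obtain ⟨h2', h3', -⟩ := hB b hb
      have d1 : (g p.1 : ℤ) ∣ a.2 - p.2 := dvd_sub (by rw [h3]; exact hdvd a h2) (hdvd p hp)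
      have d2 : (g p.1 : ℤ) ∣ b.2 - p.2 := dvd_sub (by rw [h3']; exact hdvd b h2') (hdvd p hp)
      have := (Int.ediv_left_inj d1 d2).1 hab
      exact Prod.ext (h3.symm.trans h3') (by linarith)
  have hd0 := Int.natCast_nonneg (M / g p.1)
  rw [Finset.card_erase_of_mem (Finset.mem_Icc.2 ⟨neg_nonpos.2 hd0, hd0⟩), Int.card_Icc] at h1
  have h2 : B.card ≤ 2 * (M / g p.1) := by omega
  have h3 : (B.card : ℝ) ≤ 2 * ((M / g p.1 : ℕ) : ℝ) := by exact_mod_cast h2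
  have h4 : ((M / g p.1 : ℕ) : ℝ) ≤ M / g p.1 := Nat.cast_div_le
  calc (B.card : ℝ) ≤ 2 * (M / g p.1) := by linarith
    _ = _ := by ring

/-- The sum over pairs of nearby elements is controlled by the sum over pairs of elements with the
same key and the same class. -/
theorem sum_near_le {ε V K : Type*} [DecidableEq V] [DecidableEq K] [Fintype K] {E : Finset ε}
    {w : ε → ℝ} {π : ε → V × ℤ} {κ : ε → K} {g : V → ℕ}
    (hg : ∀ e ∈ E, 0 < g (π e).1) (hdvd : ∀ e ∈ E, (g (π e).1 : ℤ) ∣ (π e).2) (M : ℕ)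
    [DecidableRel (Near (V := V) M)] :
    ∑ e ∈ E, ∑ e' ∈ E, w e * w e' * (if Near M (π e) (π e') then 1 else 0) ≤
      2 * M * Fintype.card K * ∑ e ∈ E, ∑ e' ∈ E,
        w e * w e' * (if π e = π e' ∧ κ e = κ e' then 1 / (g (π e).1 : ℝ) else 0) := by
  obtain ⟨P, hP⟩ : ∃ P, P = E.image π := ⟨_, rfl⟩
  have hπ : ∀ e ∈ E, π e ∈ P := fun e he => hP ▸ Finset.mem_image_of_mem π he
  have hgP : ∀ p ∈ P, 0 < g p.1 := fun p hp => by
    rw [hP] at hp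
    obtain ⟨e, he, rfl⟩ := Finset.mem_image.1 hp
    exact hg e he
  have hdP : ∀ p ∈ P, (g p.1 : ℤ) ∣ p.2 := fun p hp => by
    rw [hP] at hp
    obtain ⟨e, he, rfl⟩ := Finset.mem_image.1 hp
    exact hdvd e he
  rw [sum_sum_mul_comp_eq hπ w fun p p' => if Near M p p' then 1 else 0]
  obtain ⟨H, hH⟩ : ∃ H : V × ℤ → ℝ, ∀ p, H p = ∑ e ∈ E.filter (fun e => π e = p), w e :=
    ⟨_, fun _ => rfl⟩
  simp only [← hH]
  have h1 : ∑ p ∈ P, ∑ p' ∈ P, H p * H p' * (if Near M p p' then 1 else 0) ≤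
      ∑ p ∈ P, H p ^ 2 * (2 * M * (1 / (g p.1 : ℝ))) := by
    have a1 : ∑ p ∈ P, ∑ p' ∈ P, H p * H p' * (if Near M p p' then 1 else 0) ≤
        ∑ p ∈ P, ∑ p' ∈ P, (1 / 2 * (H p ^ 2 * (if Near M p p' then 1 else 0)) +
          1 / 2 * (H p' ^ 2 * (if Near M p p' then 1 else 0))) := by
      refine Finset.sum_le_sum fun p _ => Finset.sum_le_sum fun p' _ => ?_
      split_ifs
      · nlinarith [sq_nonneg (H p - H p')]
      · simp
    have a2 : ∑ p ∈ P, ∑ p' ∈ P, H p' ^ 2 * (if Near M p p' then (1 : ℝ) else 0) =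
        ∑ p ∈ P, ∑ p' ∈ P, H p ^ 2 * (if Near M p p' then 1 else 0) := by
      rw [Finset.sum_comm]
      refine Finset.sum_congr rfl fun p _ => Finset.sum_congr rfl fun p' _ => ?_
      rw [if_congr ⟨Near.symm, Near.symm⟩ rfl rfl]
    have a3 : ∑ p ∈ P, ∑ p' ∈ P, H p ^ 2 * (if Near M p p' then (1 : ℝ) else 0) ≤
        ∑ p ∈ P, H p ^ 2 * (2 * M * (1 / (g p.1 : ℝ))) := by
      refine Finset.sum_le_sum fun p hp => ?_
      rw [← Finset.mul_sum, Finset.sum_boole]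
      exact mul_le_mul_of_nonneg_left (card_near_le hgP hdP M hp fun p' hp' =>
        Finset.mem_filter.1 hp') (sq_nonneg _)
    simp only [Finset.sum_add_distrib, ← Finset.mul_sum] at a1 a2 a3
    linarith
  refine h1.trans ?_
  have h2 := sum_sum_mul_comp_eq (E := E) (P := P ×ˢ Finset.univ) (π := fun e => (π e, κ e))
    (fun e he => Finset.mem_product.2 ⟨hπ e he, Finset.mem_univ _⟩) w
    fun p p' => if p = p' then 1 / (g p.1.1 : ℝ) else 0
  simp only [Prod.mk.injEq] at h2
  rw [h2, Finset.mul_sum, Finset.sum_product]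
  refine Finset.sum_le_sum fun p hp => ?_
  have h3 : ∀ k : K, ∑ p' ∈ P ×ˢ Finset.univ,
      (∑ e ∈ E.filter (fun e => (π e, κ e) = (p, k)), w e) *
        (∑ e ∈ E.filter (fun e => (π e, κ e) = p'), w e) *
        (if (p, k) = p' then 1 / (g (p, k).1.1 : ℝ) else 0) =
      (∑ e ∈ E.filter (fun e => (π e, κ e) = (p, k)), w e) ^ 2 * (1 / (g p.1 : ℝ)) := by
    intro k
    rw [Finset.sum_eq_single (p, k)]
    · rw [if_pos rfl, sq]
    · intro b _ hb
      rw [if_neg hb.symm, mul_zero]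
    · intro h
      exact absurd (Finset.mem_product.2 ⟨hp, Finset.mem_univ _⟩) h
  have h4 : H p = ∑ k : K, ∑ e ∈ E.filter (fun e => (π e, κ e) = (p, k)), w e := by
    rw [hH, ← Finset.sum_fiberwise (g := κ)]
    refine Finset.sum_congr rfl fun k _ => ?_
    rw [Finset.filter_filter]
    simp only [Prod.mk.injEq]
  have h5 : H p ^ 2 ≤ Fintype.card K *
      ∑ k : K, (∑ e ∈ E.filter (fun e => (π e, κ e) = (p, k)), w e) ^ 2 := by
    rw [h4]
    exact sq_sum_le_card_mul_sum_sq
  simp only [← Finset.mul_sum] at h3 ⊢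
  rw [Finset.sum_congr rfl fun k _ => h3 k, ← Finset.sum_mul]
  have h6 : 0 ≤ 2 * M * (1 / (g p.1 : ℝ)) := by positivity
  refine (mul_le_mul_of_nonneg_right h5 h6).trans (le_of_eq ?_)
  ring

end Reduction

section Assembly

variable {A : Finset Pt} {lev : Pt → ℕ} {C n : ℕ} {lam : ℕ → ℝ}

/-- The difference vector of an edge, together with the height of the edge in the direction of
this vector. -/
def edgeKey (e : Pt × Pt) : Pt × ℤ := (e.1 - e.2, dot (e.1 - e.2) e.1)

theorem edgeKey_ne_zero {e : Pt × Pt} (he : e.1 ≠ e.2) : (edgeKey e).1 ≠ 0 := sub_ne_zero.2 he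

theorem gcdP_dvd_dot (v x : Pt) : (gcdP v : ℤ) ∣ dot v x :=
  dvd_add ((Int.gcd_dvd_left _ _).mul_right _) ((Int.gcd_dvd_right _ _).mul_right _)

/-- The classes of the endpoints of an edge, with respect to bigness and to triviality of the
richness. -/
def edgeClass (A : Finset Pt) (lev : Pt → ℕ) (C : ℕ) (e : Pt × Pt) : Prop × Prop × Prop × Prop :=
  (IsBig A lev C e.1 (dir (e.1 - e.2)), IsBig A lev C e.2 (dir (e.1 - e.2)),
    Nat.log 2 (crossRichness A lev e.1 (dir (e.1 - e.2))) = 0,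
    Nat.log 2 (crossRichness A lev e.2 (dir (e.1 - e.2))) = 0)

theorem isRectangle_of_edgeKey_eq {e e' : Pt × Pt} (he : e.1 ≠ e.2) (hne : e ≠ e')
    (h : edgeKey e = edgeKey e') : IsRectangle (e.1, e.2, e'.2, e'.1) := by
  obtain ⟨x, y⟩ := e
  obtain ⟨w, z⟩ := e'
  simp only [edgeKey, Prod.mk.injEq] at h
  obtain ⟨h1, h2⟩ := h
  simp only at he
  refine ⟨?_, ?_, he, ?_⟩
  · simp only
    rw [sub_eq_sub_iff_add_eq_add] at h1
    rw [h1, add_comm]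
  · rw [← h1] at h2
    simp only [dot, Prod.fst_sub, Prod.snd_sub] at h2 ⊢
    linear_combination h2
  · simp only
    rintro rfl
    exact hne (Prod.ext rfl (sub_right_injective h1))

theorem matched_of_edgeClass_eq {e e' : Pt × Pt} (h : edgeKey e = edgeKey e')
    (hc : edgeClass A lev C e = edgeClass A lev C e') : Matched A lev C (e.1, e.2, e'.2, e'.1) := by
  have h1 : e.1 - e.2 = e'.1 - e'.2 := (Prod.mk.inj h).1
  simp only [edgeClass, Prod.mk.injEq, ← h1] at hc
  exact ⟨hc.1.to_iff, hc.2.1.to_iff, hc.2.2.1.to_iff, hc.2.2.2.to_iff⟩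

open scoped Classical in
theorem sum_edges_matched_le (hA : ∀ j, (A.filter fun x => lev x = j).card ≤ 2 ^ j)
    (hu : UniqueRich A lev C) (hlev : ∀ x ∈ A, lev x < n) (hlam : ∀ j < n, 0 ≤ lam j)
    {E : Finset (Pt × Pt)} (hE : ∀ e ∈ E, (e.1 ∈ A ∧ e.2 ∈ A) ∧ e.1 ≠ e.2) :
    ∑ e ∈ E, ∑ e' ∈ E, weight lev lam e.1 * weight lev lam e.2 *
      (weight lev lam e'.1 * weight lev lam e'.2) *
      (if edgeKey e = edgeKey e' ∧ edgeClass A lev C e = edgeClass A lev C e' then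
        1 / (gcdP (edgeKey e).1 : ℝ) else 0) ≤
      (1 + rectConst C) * (∑ j ∈ Finset.range n, lam j ^ 2) ^ 2 := by
  have hw := fun {x} => weight_nonneg (x := x) hlev hlam
  rw [← Finset.sum_product' (f := fun e e' => weight lev lam e.1 * weight lev lam e.2 *
      (weight lev lam e'.1 * weight lev lam e'.2) *
      (if edgeKey e = edgeKey e' ∧ edgeClass A lev C e = edgeClass A lev C e' then
        1 / (gcdP (edgeKey e).1 : ℝ) else 0))]
  simp only [mul_ite, mul_zero]
  rw [← Finset.sum_filter,
    ← Finset.sum_filter_add_sum_filter_not _ fun q : (Pt × Pt) × (Pt × Pt) => q.1 = q.2, add_mul,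
    one_mul]
  refine add_le_add ?_ ?_
  · have hsq : (∑ x ∈ A, weight lev lam x ^ 2) ^ 2 ≤ (∑ j ∈ Finset.range n, lam j ^ 2) ^ 2 :=
      pow_le_pow_left₀ (Finset.sum_nonneg fun x _ => sq_nonneg _) (sum_weight_sq_le hA hlev) 2
    refine le_trans ?_ hsq
    rw [sq, Finset.sum_mul_sum,
      ← Finset.sum_product' (f := fun x y => weight lev lam x ^ 2 * weight lev lam y ^ 2)]
    refine le_trans (b := ∑ e ∈ E, weight lev lam e.1 ^ 2 * weight lev lam e.2 ^ 2) ?_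
      (Finset.sum_le_sum_of_subset_of_nonneg (fun e he => Finset.mem_product.2 (hE e he).1)
        fun _ _ _ => by positivity)
    rw [← Finset.sum_image (s := E) (g := fun e => (e, e)) (f := fun q : (Pt × Pt) × (Pt × Pt) =>
      weight lev lam q.1.1 ^ 2 * weight lev lam q.1.2 ^ 2) fun a _ b _ h => (Prod.mk.inj h).1]
    refine le_trans (Finset.sum_le_sum fun q hq => ?_)
      (Finset.sum_le_sum_of_subset_of_nonneg (fun q hq => ?_) fun _ _ _ => by positivity)
    · obtain ⟨hq1, hq2⟩ := Finset.mem_filter.1 hq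
      have hqE := (Finset.mem_product.1 (Finset.mem_filter.1 hq1).1).1
      rw [← hq2]
      refine (mul_le_of_le_one_right ?_ ?_).trans (le_of_eq ?_)
      · exact mul_self_nonneg _
      · exact div_le_one_of_le₀ (by exact_mod_cast gcdP_pos (edgeKey_ne_zero (hE _ hqE).2))
          (by positivity)
      · ring
    · obtain ⟨hq1, hq2⟩ := Finset.mem_filter.1 hq
      exact Finset.mem_image.2
        ⟨q.1, (Finset.mem_product.1 (Finset.mem_filter.1 hq1).1).1, Prod.ext rfl hq2⟩
  · obtain ⟨T, hT⟩ : ∃ T, T = ((E ×ˢ E).filter fun q : (Pt × Pt) × (Pt × Pt) =>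
      edgeKey q.1 = edgeKey q.2 ∧ edgeClass A lev C q.1 = edgeClass A lev C q.2).filter
        fun q => ¬q.1 = q.2 := ⟨_, rfl⟩
    rw [← hT]
    have hTm : ∀ q ∈ T, (q.1 ∈ E ∧ q.2 ∈ E) ∧ (edgeKey q.1 = edgeKey q.2 ∧
        edgeClass A lev C q.1 = edgeClass A lev C q.2) ∧ q.1 ≠ q.2 := fun q hq => by
      rw [hT] at hq
      simpa only [Finset.mem_filter, Finset.mem_product, and_assoc] using hq
    have hinj : Set.InjOn (fun q : (Pt × Pt) × (Pt × Pt) => (q.1.1, q.1.2, q.2.2, q.2.1)) T := by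
      intro a _ b _ h
      simp only [Prod.mk.injEq] at h
      exact Prod.ext (Prod.ext h.1 h.2.1) (Prod.ext h.2.2.2 h.2.2.1)
    refine le_of_eq_of_le ?_ (sum_rectWeight_matched_le hA hu hlev hlam
      (R := T.image fun q => (q.1.1, q.1.2, q.2.2, q.2.1)) ?_)
    · rw [Finset.sum_image hinj]
      refine Finset.sum_congr rfl fun q _ => ?_
      rw [rectWeight, edgeKey]
      ring
    · intro q hq
      obtain ⟨p, hp, rfl⟩ := Finset.mem_image.1 hq
      obtain ⟨⟨h1, h2⟩, ⟨h3, h4⟩, h5⟩ := hTm p hp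
      exact ⟨⟨(hE _ h1).1.1, (hE _ h1).1.2, (hE _ h2).1.2, (hE _ h2).1.1⟩,
        isRectangle_of_edgeKey_eq (hE _ h1).2 h5 h3, matched_of_edgeClass_eq h3 h4⟩

/-- The parallelogram with two given opposite sides. -/
def quadOfEdges (q : (Pt × Pt) × (Pt × Pt)) : Quad := ![q.1.1, q.1.2, q.2.2, q.2.1]

theorem quadOfEdges_injective : Function.Injective quadOfEdges := by
  intro p q h
  have h0 := congrFun h 0
  have h1 := congrFun h 1
  have h2 := congrFun h 2
  have h3 := congrFun h 3
  exact Prod.ext (Prod.ext h0 h1) (Prod.ext h3 h2)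

theorem near_edgeKey {M : ℕ} (hM : 0 < M) {Q : Quad} (hQ : IsPara Q) (h1 : (M : ℤ) ≤ tauQ Q)
    (h2 : tauQ Q < 2 * M) : Near M (edgeKey (Q 0, Q 1)) (edgeKey (Q 3, Q 2)) ∧ Q 0 ≠ Q 1 ∧
      Q 3 ≠ Q 2 := by
  have hv : Q 0 - Q 1 = Q 3 - Q 2 := by
    rw [sub_eq_sub_iff_add_eq_add, add_comm (Q 3)]
    exact hQ
  have hd : (edgeKey (Q 0, Q 1)).2 - (edgeKey (Q 3, Q 2)).2 = dotQ Q := by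
    simp only [edgeKey]
    rw [← hv]
    simp only [dot, dotQ, Prod.fst_sub, Prod.snd_sub]
    ring
  have hne : Q 0 ≠ Q 1 := by
    intro h
    have : dotQ Q = 0 := by simp [dotQ, h]
    rw [tauQ, this] at h1
    simp at h1
    omega
  refine ⟨⟨hv, ?_⟩, hne, fun h => hne ?_⟩
  · rw [hd]
    rw [tauQ] at h1 h2
    constructor <;> omega
  · rw [h, sub_self] at hv
    exact sub_eq_zero.1 hv

theorem tsum_parallelograms_le (hA : ∀ j, (A.filter fun x => lev x = j).card ≤ 2 ^ j)
    (hu : UniqueRich A lev C) (hlev : ∀ x ∈ A, lev x < n) (hlam : ∀ j < n, 0 ≤ lam j)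
    {f : Pt → ℝ} (hf : ∀ x ∈ A, f x = weight lev lam x) (hf0 : ∀ x ∉ A, f x = 0) {M : ℕ}
    (hM : 0 < M) :
    ∑' Q : Quad, Set.indicator
        {Q : Quad | IsPara Q ∧ (M : ℤ) ≤ tauQ Q ∧ tauQ Q < 2 * (M : ℤ)} (fQ f) Q ≤
      32 * (1 + rectConst C) * M * (∑ j ∈ Finset.range n, lam j ^ 2) ^ 2 := by
  classical
  obtain ⟨E, hE⟩ : ∃ E, E = (A ×ˢ A).filter fun e : Pt × Pt => e.1 ≠ e.2 := ⟨_, rfl⟩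
  have hEm : ∀ e ∈ E, (e.1 ∈ A ∧ e.2 ∈ A) ∧ e.1 ≠ e.2 := fun e he => by
    rw [hE] at he
    simpa only [Finset.mem_filter, Finset.mem_product] using he
  have hw := fun {x} => weight_nonneg (x := x) hlev hlam
  have h0 : ∀ Q ∉ (E ×ˢ E).image quadOfEdges, Set.indicator
      {Q : Quad | IsPara Q ∧ (M : ℤ) ≤ tauQ Q ∧ tauQ Q < 2 * (M : ℤ)} (fQ f) Q = 0 := by
    intro Q hQ
    by_contra hne
    apply hQ
    obtain ⟨⟨hp, h1, h2⟩, h3⟩ := Set.indicator_apply_ne_zero.1 hne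
    have hmem : ∀ k, Q k ∈ A := fun k => by
      by_contra hk
      exact h3 (Finset.prod_eq_zero (Finset.mem_univ k) (hf0 _ hk))
    obtain ⟨-, h4, h5⟩ := near_edgeKey hM hp h1 h2
    refine Finset.mem_image.2 ⟨((Q 0, Q 1), (Q 3, Q 2)), ?_, ?_⟩
    · simp [hE, hmem, h4, h5]
    · funext k
      fin_cases k <;> rfl
  rw [tsum_eq_sum h0, Finset.sum_image quadOfEdges_injective.injOn, Finset.sum_product]
  have h1 : ∀ e ∈ E, ∀ e' ∈ E, Set.indicator
      {Q : Quad | IsPara Q ∧ (M : ℤ) ≤ tauQ Q ∧ tauQ Q < 2 * (M : ℤ)} (fQ f) (quadOfEdges (e, e')) ≤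
      weight lev lam e.1 * weight lev lam e.2 * (weight lev lam e'.1 * weight lev lam e'.2) *
        (if Near M (edgeKey e) (edgeKey e') then 1 else 0) := by
    intro e he e' he'
    obtain ⟨⟨a1, a2⟩, -⟩ := hEm e he
    obtain ⟨⟨a3, a4⟩, -⟩ := hEm e' he'
    have hnn := mul_nonneg (mul_nonneg (hw a1) (hw a2)) (mul_nonneg (hw a3) (hw a4))
    by_cases hQ : quadOfEdges (e, e') ∈
        {Q : Quad | IsPara Q ∧ (M : ℤ) ≤ tauQ Q ∧ tauQ Q < 2 * (M : ℤ)}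
    · have hnear : Near M (edgeKey e) (edgeKey e') := (near_edgeKey hM hQ.1 hQ.2.1 hQ.2.2).1
      rw [Set.indicator_of_mem hQ, if_pos hnear, mul_one, fQ, Fin.prod_univ_four]
      simp only [quadOfEdges, Matrix.cons_val]
      rw [hf _ a1, hf _ a2, hf _ a3, hf _ a4]
      exact le_of_eq (by ring)
    · rw [Set.indicator_of_notMem hQ]
      exact mul_nonneg hnn (by split_ifs <;> norm_num)
  refine (Finset.sum_le_sum fun e he => Finset.sum_le_sum fun e' he' => h1 e he e' he').trans ?_
  have h2 := sum_near_le (E := E) (w := fun e => weight lev lam e.1 * weight lev lam e.2)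
    (π := edgeKey) (κ := edgeClass A lev C) (g := gcdP)
    (fun e he => gcdP_pos (edgeKey_ne_zero (hEm e he).2)) (fun e _ => gcdP_dvd_dot _ _) M
  have h3 := sum_edges_matched_le hA hu hlev hlam hEm
  have hcard : Fintype.card (Prop × Prop × Prop × Prop) = 16 := by
    simp [Fintype.card_prod, Fintype.card_prop]
  rw [hcard] at h2
  refine h2.trans ?_
  calc _ ≤ 2 * M * ((16 : ℕ) : ℝ) *
        ((1 + rectConst C) * (∑ j ∈ Finset.range n, lam j ^ 2) ^ 2) := by
        refine mul_le_mul_of_nonneg_left ?_ (by positivity)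
        convert h3
    _ = _ := by push_cast; ring

theorem isLine_direction (x : Pt) {d : Pt} (hd : d ≠ 0) :
    IsLine {y | ∃ t : ℝ, y = emb x + t • emb d} := by
  refine ⟨emb x, emb d, fun h => hd ?_, rfl⟩
  simp only [emb, Prod.mk_eq_zero, Int.cast_eq_zero] at h
  exact Prod.ext h.1 h.2

theorem emb_injective : Function.Injective emb := by
  intro x y h
  simp only [emb, Prod.mk.injEq, Int.cast_inj] at h
  exact Prod.ext h.1 h.2

theorem emb_mem_line {x d y : Pt} (hd : d ≠ 0) :
    emb y ∈ {y | ∃ t : ℝ, y = emb x + t • emb d} ↔ det d (y - x) = 0 := by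
  simp only [Set.mem_ofPred_eq, emb, Prod.smul_mk, smul_eq_mul, Prod.mk_add_mk, Prod.mk.injEq]
  constructor
  · rintro ⟨t, h1, h2⟩
    have : ((det d (y - x) : ℤ) : ℝ) = 0 := by
      simp only [det, Prod.fst_sub, Prod.snd_sub]
      push_cast
      rw [h1, h2]
      ring
    exact_mod_cast this
  · intro h
    have h' : (d.1 : ℝ) * (y.2 - x.2) - d.2 * (y.1 - x.1) = 0 := by
      have : ((det d (y - x) : ℤ) : ℝ) = 0 := by rw [h]; simp
      simpa [det] using this
    by_cases h1 : d.1 = 0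
    · have h2 : (d.2 : ℝ) ≠ 0 := fun h2 => hd (Prod.ext h1 (by exact_mod_cast h2))
      refine ⟨(y.2 - x.2) / d.2, ?_, ?_⟩
      · rw [h1] at h' ⊢
        have h3 : (y.1 : ℝ) = x.1 := by
          have h4 : (d.2 : ℝ) * (y.1 - x.1) = 0 := by push_cast at h'; linarith
          linarith [(mul_eq_zero.1 h4).resolve_left h2]
        rw [h3]
        simp
      · field_simp
        ring
    · have h2 : (d.1 : ℝ) ≠ 0 := by exact_mod_cast h1
      refine ⟨(y.1 - x.1) / d.1, ?_, ?_⟩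
      · field_simp
        ring
      · field_simp
        linarith

theorem lineCount_line_eq (T : Finset Pt) (x : Pt) {d : Pt} (hd : d ≠ 0) :
    lineCount {y | ∃ t : ℝ, y = emb x + t • emb d} T = (lineFiber T x d).card := by
  have : {y | ∃ t : ℝ, y = emb x + t • emb d} ∩ emb '' (T : Set Pt) =
      emb '' (lineFiber T x d : Set Pt) := by
    ext z
    constructor
    · rintro ⟨h1, y, hy, rfl⟩
      exact ⟨y, Finset.mem_coe.2 (mem_lineFiber.2 ⟨hy, (emb_mem_line hd).1 h1⟩), rfl⟩
    · rintro ⟨y, hy, rfl⟩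
      obtain ⟨h1, h2⟩ := mem_lineFiber.1 (Finset.mem_coe.1 hy)
      exact ⟨(emb_mem_line hd).2 h2, y, h1, rfl⟩
  rw [lineCount, this, Set.ncard_image_of_injective _ emb_injective, Set.ncard_coe_finset]

end Assembly

/-- **Estimate (3.2) of Proposition 3.1.** For every dyadic `M`,
`(1/M) Σ_{M ≤ τ < 2M} Σ_{Q ∈ 𝒬^τ} f(Q) ≲ ‖λ‖_{ℓ²}⁴`. -/
theorem sum_parallelograms_dyadic_bound (C : ℕ) :
    ∃ c : ℝ, 0 < c ∧
      ∀ (m : ℕ) (S : ℕ → Finset Pt) (lam : ℕ → ℝ),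
        1 ≤ m →
        (∀ i ≤ m, ∀ j ≤ m, i ≠ j → Disjoint (S i) (S j)) →
        (∀ j ≤ m, (S j).card ≤ 2 ^ j) →
        (∀ j ≤ m, 0 ≤ lam j) →
        (∀ j ≤ m, ∀ ξ ∈ S j, ∀ ℓ₁ ℓ₂ : Set (ℝ × ℝ), IsLine ℓ₁ → IsLine ℓ₂ →
          emb ξ ∈ ℓ₁ → emb ξ ∈ ℓ₂ →
          (2 : ℝ) ^ ((j : ℝ) / 2 + (C : ℝ)) ≤ (lineCount ℓ₁ (S j) : ℝ) →
          (2 : ℝ) ^ ((j : ℝ) / 2 + (C : ℝ)) ≤ (lineCount ℓ₂ (S j) : ℝ) → ℓ₁ = ℓ₂) →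
        ∀ M : ℕ, (∃ k : ℕ, M = 2 ^ k) →
          (1 / (M : ℝ)) *
              ∑' Q : Quad, Set.indicator
                {Q : Quad | IsPara Q ∧ (M : ℤ) ≤ tauQ Q ∧ tauQ Q < 2 * (M : ℤ)}
                (fQ (fWt S lam m)) Q ≤
            c * (∑ j ∈ Finset.range (m + 1), lam j ^ 2) ^ 2 := by
  have hpos : 0 < rectConst C := by
    have := decaySum_pos
    unfold rectConst
    positivity
  refine ⟨32 * (1 + rectConst C), by positivity, ?_⟩
  rintro m S lam - hdisj hcard hlam hline M ⟨k, rfl⟩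
  obtain ⟨A, hA⟩ : ∃ A, A = (Finset.range (m + 1)).biUnion S := ⟨_, rfl⟩
  have hAm : ∀ {x}, x ∈ A ↔ ∃ j, j ≤ m ∧ x ∈ S j := fun {x} => by
    simp only [hA, Finset.mem_biUnion, Finset.mem_range, Nat.lt_succ_iff]
  choose! lev hlev using fun x => (hAm (x := x)).1
  have hlev_eq : ∀ {j x}, j ≤ m → x ∈ S j → lev x = j := fun {j x} hj hx => by
    obtain ⟨h1, h2⟩ := hlev x (hAm.2 ⟨j, hj, hx⟩)
    by_contra hne
    exact Finset.disjoint_left.1 (hdisj _ h1 _ hj hne) h2 hx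
  have hfib : ∀ j ≤ m, (A.filter fun x => lev x = j) = S j := fun j hj => by
    ext x
    rw [Finset.mem_filter]
    constructor
    · rintro ⟨hx, rfl⟩
      exact (hlev x hx).2
    · exact fun hx => ⟨hAm.2 ⟨j, hj, hx⟩, hlev_eq hj hx⟩
  have hsize : ∀ j, (A.filter fun x => lev x = j).card ≤ 2 ^ j := fun j => by
    by_cases hj : j ≤ m
    · exact (hfib j hj).symm ▸ hcard j hj
    · rw [Finset.filter_eq_empty_iff.2]
      · simp
      · rintro x hx rfl
        exact hj (hlev x hx).1
  have hu : UniqueRich A lev C := by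
    intro x hx d e hd he h1 h2
    obtain ⟨hm, hxS⟩ := hlev x hx
    rw [richness, hfib _ hm, ← lineCount_line_eq _ _ hd] at h1
    rw [richness, hfib _ hm, ← lineCount_line_eq _ _ he] at h2
    have hmem : ∀ {v : Pt}, v ≠ 0 → emb x ∈ {y | ∃ t : ℝ, y = emb x + t • emb v} := fun hv =>
      (emb_mem_line hv).2 (by simp [det])
    have heq := hline _ hm x hxS _ _ (isLine_direction x hd) (isLine_direction x he) (hmem hd)
      (hmem he) h1 h2
    have hxe : emb (x + e) ∈ {y | ∃ t : ℝ, y = emb x + t • emb d} := by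
      rw [heq, emb_mem_line he]
      simp [det, mul_comm]
    simpa using (emb_mem_line hd).1 hxe
  have hf : ∀ x ∈ A, fWt S lam m x = weight lev lam x := fun x hx => by
    obtain ⟨hm, hxS⟩ := hlev x hx
    rw [fWt, Finset.sum_eq_single (lev x), if_pos hxS, weight]
    · intro j hj hne
      exact if_neg fun hxj => hne (hlev_eq (Nat.lt_succ_iff.1 (Finset.mem_range.1 hj)) hxj).symm
    · exact fun h => absurd (Finset.mem_range.2 (Nat.lt_succ_iff.2 hm)) h
  have hf0 : ∀ x ∉ A, fWt S lam m x = 0 := fun x hx =>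
    Finset.sum_eq_zero fun j hj => if_neg fun hxj =>
      hx (hAm.2 ⟨j, Nat.lt_succ_iff.1 (Finset.mem_range.1 hj), hxj⟩)
  have hM : 0 < 2 ^ k := by positivity
  have hmain := tsum_parallelograms_le hsize hu (fun x hx => Nat.lt_succ_iff.2 (hlev x hx).1)
    (fun j hj => hlam j (Nat.lt_succ_iff.1 hj)) hf hf0 hM
  have hM' : (0 : ℝ) < ((2 ^ k : ℕ) : ℝ) := by exact_mod_cast hM
  rw [one_div_mul_eq_div, div_le_iff₀ hM']
  refine hmain.trans (le_of_eq ?_)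
  ring
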